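/- Let E ⊂ ℝ^d be H^n-measurable with H^n(E) < ∞, and let μ = H^n restricted to E. Then E is n-rectifiable if and only if ∫₀¹ β_{μ,2}(x,r)² dr/r < ∞ for H^n-a.e. x ∈ E. -/

import Mathlib

open MeasureTheory Metric Set Filter
open scoped ENNReal NNReal

/-- The squared `L²` Jones beta number `β_{μ,2}(x,r)²`, infimum over affine `n`-planes. -/
noncomputable def beta2sq (n d : ℕ) (μ : Measure (EuclideanSpace ℝ (Fin d)))
    (x : EuclideanSpace ℝ (Fin d)) (r : ℝ) : ℝ≥0∞ :=
  ⨅ L : {L : AffineSubspace ℝ (EuclideanSpace ℝ (Fin d)) //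
      Module.finrank ℝ L.direction = n},
    (∫⁻ y in closedBall x r,
        ENNReal.ofReal ((infDist y (L.1 : Set (EuclideanSpace ℝ (Fin d))) / r) ^ 2) ∂μ) /
      ENNReal.ofReal (r ^ n)

/-- Short name for Euclidean space. -/
abbrev Eu (n : ℕ) := EuclideanSpace ℝ (Fin n)

section

theorem density_fin (n d : ℕ) (ν : Measure (Eu d)) [IsFiniteMeasure ν] :
    μH[(n:ℝ)] {x : Eu d | ∀ N : ℕ, ∃ r : ℝ, 0 < r ∧ r < 1/((N:ℝ)+1) ∧
      (N:ℝ≥0∞) * ENNReal.ofReal (r^n) < ν (closedBall x r)} = 0 := by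
  set A := {x : Eu d | ∀ N : ℕ, ∃ r : ℝ, 0 < r ∧ r < 1/((N:ℝ)+1) ∧
      (N:ℝ≥0∞) * ENNReal.ofReal (r^n) < ν (closedBall x r)} with hA
  have key : ∀ N : ℕ, ∃ u : Set (Eu d × ℝ), u.Countable ∧ (∀ p ∈ u, 0 < p.2 ∧ p.2 < 1/((N:ℝ)+1) ∧
      (N:ℝ≥0∞) * ENNReal.ofReal (p.2^n) < ν (closedBall p.1 p.2)) ∧
      u.PairwiseDisjoint (fun p => closedBall p.1 p.2) ∧
      A ⊆ ⋃ p : u, closedBall p.1.1 (5 * p.1.2) := by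
    intro N
    set t : Set (Eu d × ℝ) := {p | 0 < p.2 ∧ p.2 < 1/((N:ℝ)+1) ∧
      (N:ℝ≥0∞) * ENNReal.ofReal (p.2^n) < ν (closedBall p.1 p.2)}
    obtain ⟨u, hut, hdis, hcov⟩ := Vitali.exists_disjoint_subfamily_covering_enlargement_closedBall
      t (fun p => p.1) (fun p => p.2) (1/((N:ℝ)+1)) (fun p hp => hp.2.1.le) 5 (by norm_num)
    refine ⟨u, ?_, fun p hp => hut hp, hdis, ?_⟩
    · apply hdis.countable_of_nonempty_interior
      intro p hp
      have := (hut hp).1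
      exact ⟨p.1, ball_subset_interior_closedBall (mem_ball_self this)⟩
    · intro x hx
      obtain ⟨r, hr⟩ := hx N
      obtain ⟨b, hb, hsub⟩ := hcov (x, r) hr
      exact mem_iUnion.2 ⟨⟨b, hb⟩, hsub (mem_closedBall_self hr.1.le)⟩
  choose u hc hu hdis hcov using key
  have : ∀ N, Countable (u N) := fun N => (hc N).to_subtype
  have hr0 : Tendsto (fun N : ℕ => ENNReal.ofReal (10 * (1/((N:ℝ)+1)))) atTop (nhds 0) := by
    rw [← ENNReal.ofReal_zero]
    apply ENNReal.tendsto_ofReal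
    simpa using (tendsto_one_div_add_atTop_nhds_zero_nat (𝕜 := ℝ)).const_mul 10
  have hd : ∀ N (p : u N), ediam (closedBall p.1.1 (5 * p.1.2)) ≤ ENNReal.ofReal (10 * p.1.2) := by
    intro N p
    have h0 := (hu N p p.2).1
    rw [show 10 * p.1.2 = 2 * (5 * p.1.2) by ring, ENNReal.ofReal_mul (by norm_num)]
    rw [← ENNReal.ofReal_mul (by norm_num)]
    refine ediam_le fun y hy z hz => ?_
    rw [edist_dist]
    refine ENNReal.ofReal_le_ofReal ?_
    have := dist_triangle_right y z p.1.1
    rw [mem_closedBall] at hy hz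
    linarith
  have h1 := Measure.hausdorffMeasure_le_liminf_tsum (n:ℝ) A (l := atTop) _ hr0
    (fun N (p : u N) => closedBall p.1.1 (5 * p.1.2))
    (Eventually.of_forall fun N p => (hd N p).trans (ENNReal.ofReal_le_ofReal
      (by have := (hu N p p.2).2.1; linarith)))
    (Eventually.of_forall hcov)
  have h2 : ∀ N : ℕ, 1 ≤ N → ∑' p : u N, ediam (closedBall p.1.1 (5 * p.1.2)) ^ (n:ℝ) ≤
      (10^n * ν univ) / (N:ℝ≥0∞) := by
    intro N hN
    rw [ENNReal.le_div_iff_mul_le (by left; positivity) (by left; simp), ← ENNReal.tsum_mul_right]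
    calc _ ≤ ∑' p : u N, 10^n * ν (closedBall p.1.1 p.1.2) := by
          apply ENNReal.tsum_le_tsum
          intro p
          have h0 := (hu N p p.2).1
          have h3 := (hu N p p.2).2.2
          calc _ ≤ ENNReal.ofReal (10 * p.1.2) ^ n * N := by
                rw [ENNReal.rpow_natCast]; gcongr; exact hd N p
            _ = 10^n * (N * ENNReal.ofReal (p.1.2^n)) := by
                rw [ENNReal.ofReal_mul (by norm_num), mul_pow, ENNReal.ofReal_pow h0.le]
                simp; ring
            _ ≤ _ := by gcongr
      _ = 10^n * ∑' p : u N, ν (closedBall p.1.1 p.1.2) := ENNReal.tsum_mul_left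
      _ ≤ _ := by
          gcongr
          rw [← measure_biUnion (hc N) (hdis N) (fun p _ => measurableSet_closedBall)]
          exact measure_mono (subset_univ _)
  have h3 : Tendsto (fun N : ℕ => (10^n * ν univ) / (N:ℝ≥0∞)) atTop (nhds 0) := by
    have : (10^n * ν univ) ≠ ⊤ := ENNReal.mul_ne_top (by simp) (measure_ne_top _ _)
    have h := ENNReal.Tendsto.const_div (a := 10^n * ν univ) ENNReal.tendsto_nat_nhds_top (by right; exact this)
    simpa using h
  have h4 : liminf (fun N : ℕ => ∑' p : u N, ediam (closedBall p.1.1 (5 * p.1.2)) ^ (n:ℝ)) atTop ≤ 0 := by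
    rw [← h3.liminf_eq]
    refine liminf_le_liminf ?_ (by isBoundedDefault) (by isBoundedDefault)
    filter_upwards [eventually_ge_atTop 1] with N hN using h2 N hN
  exact le_antisymm (h1.trans h4) bot_le

theorem density_fin_ae (n d : ℕ) (ν : Measure (Eu d)) [IsFiniteMeasure ν] :
    ∀ᵐ x ∂(μH[(n:ℝ)] : Measure (Eu d)), ∃ N : ℕ, ∀ r : ℝ, 0 < r → r < 1/((N:ℝ)+1) →
      ν (closedBall x r) ≤ (N:ℝ≥0∞) * ENNReal.ofReal (r^n) := by
  rw [ae_iff]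
  convert density_fin n d ν using 3
  ext x
  push Not
  rfl

theorem density_low (n d : ℕ) (hn : 1 ≤ n) (F : Set (Eu d)) (h0 : μH[(n:ℝ)] F ≠ 0)
    (hF : μH[(n:ℝ)] F ≠ ⊤) (r0 : ℝ) (hr0 : 0 < r0) :
    ∃ x ∈ F, ∃ r : ℝ, 0 < r ∧ r < r0 ∧ ENNReal.ofReal (r^n/2) ≤ μH[(n:ℝ)] (F ∩ closedBall x r) := by
  by_contra! hcon
  have hlt : μH[(n:ℝ)] F < 2 * μH[(n:ℝ)] F := by
    rw [two_mul]; exact ENNReal.lt_add_right hF h0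
  have h1 : (⨅ (t : ℕ → Set (Eu d)) (_ : F ⊆ ⋃ n, t n) (_ : ∀ n, ediam (t n) ≤ ENNReal.ofReal (r0/2)),
          ∑' i, ⨆ _ : (t i).Nonempty, ediam (t i) ^ (n:ℝ)) ≤ μH[(n:ℝ)] F := by
    rw [Measure.hausdorffMeasure_apply]
    exact le_iSup₂_of_le (ENNReal.ofReal (r0/2)) (by simp; linarith) le_rfl
  have h2 := h1.trans_lt hlt
  simp only [iInf_lt_iff] at h2
  obtain ⟨t, hcov, hdiam, hsum⟩ := h2
  have h3 : ∀ i, 2 * μH[(n:ℝ)] (F ∩ t i) ≤ ⨆ _ : (t i).Nonempty, ediam (t i) ^ (n:ℝ) := by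
    intro i
    by_cases hne : (F ∩ t i).Nonempty
    · obtain ⟨x, hxF, hxt⟩ := hne
      have hne : (t i).Nonempty := ⟨x, hxt⟩
      simp only [hne, iSup_pos]
      have hfin : ediam (t i) ≠ ⊤ := ne_top_of_le_ne_top ENNReal.ofReal_ne_top (hdiam i)
      have hle : (ediam (t i)).toReal ≤ r0/2 := ENNReal.toReal_le_of_le_ofReal (by linarith) (hdiam i)
      have hsub : F ∩ t i ⊆ F ∩ closedBall x (ediam (t i)).toReal := by
        rintro y ⟨hyF, hy⟩
        refine ⟨hyF, ?_⟩
        rw [mem_closedBall, dist_edist]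
        exact ENNReal.toReal_mono hfin (edist_le_ediam_of_mem hy hxt)
      rcases eq_or_lt_of_le (ENNReal.toReal_nonneg (a := ediam (t i))) with hz | hpos
      · rw [← hz, closedBall_zero] at hsub
        have hn0 : (0:ℝ) < n := by exact_mod_cast hn
        have := Measure.nullSingletonClass_hausdorff (Eu d) hn0
        have : μH[(n:ℝ)] (F ∩ t i) = 0 := measure_mono_null (hsub.trans inter_subset_right) (measure_singleton x)
        simp [this]
      · have := (hcon x hxF _ hpos (by linarith)).le
        calc _ ≤ 2 * ENNReal.ofReal ((ediam (t i)).toReal^n/2) := by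
              gcongr; exact (measure_mono hsub).trans this
          _ = _ := by
              have e2 : ∀ z : ℝ, 2 * ENNReal.ofReal (z/2) = ENNReal.ofReal z := by
                intro z
                rw [← ENNReal.ofReal_ofNat 2, ← ENNReal.ofReal_mul (by norm_num), mul_div_cancel₀ _ (by norm_num)]
              rw [e2, ENNReal.ofReal_pow hpos.le, ENNReal.ofReal_toReal hfin, ENNReal.rpow_natCast]
    · rw [not_nonempty_iff_eq_empty.1 hne]; simp
  have h4 : 2 * μH[(n:ℝ)] F ≤ ∑' i, ⨆ _ : (t i).Nonempty, ediam (t i) ^ (n:ℝ) := by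
    calc _ ≤ 2 * μH[(n:ℝ)] (⋃ i, F ∩ t i) := by
          gcongr; rw [← inter_iUnion]; exact subset_inter subset_rfl hcov
      _ ≤ 2 * ∑' i, μH[(n:ℝ)] (F ∩ t i) := by gcongr; exact measure_iUnion_le _
      _ = ∑' i, 2 * μH[(n:ℝ)] (F ∩ t i) := ENNReal.tsum_mul_left.symm
      _ ≤ _ := ENNReal.tsum_le_tsum h3
  exact absurd (h4.trans_lt hsum) (lt_irrefl _)

end

section

instance haarH (n : ℕ) : (μH[(n:ℝ)] : Measure (Eu n)).IsAddHaarMeasure := by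
  have h := isAddHaarMeasure_hausdorffMeasure (E := Eu n)
  simpa using h

theorem degenerate_image (n d : ℕ) (f : Eu n → Eu d) (A : Eu n →L[ℝ] Eu d) (K ε : ℝ≥0)
    (hA : ‖A‖ ≤ K) (hinj : ¬ Function.Injective A) (hε0 : 0 < ε) (hε : ε ≤ 1) (Z : Set (Eu n))
    (hf : ApproximatesLinearOn f A Z ε) :
    μH[(n:ℝ)] (f '' Z) ≤ (K+1)^n * ε * μH[(n:ℝ)] Z := by
  obtain ⟨e, he1, he⟩ : ∃ e : Eu n, ‖e‖ = 1 ∧ A e = 0 := by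
    have : ∃ e, A e = 0 ∧ e ≠ 0 := by
      by_contra! h
      exact hinj ((injective_iff_map_eq_zero A).2 h)
    obtain ⟨e, h1, h2⟩ := this
    refine ⟨(‖e‖⁻¹ : ℝ) • e, ?_, by simp [h1]⟩
    rw [norm_smul]; simp [h2]
  set φ : Module.Dual ℝ (Eu n) := (innerSL ℝ e : Eu n →ₗ[ℝ] ℝ) with hφ
  have hφe : φ e = 1 := by simp [hφ, he1]
  set S : Eu n →ₗ[ℝ] Eu n := LinearMap.transvection φ (((ε:ℝ) - 1) • e) with hS
  have hSw : ∀ w, S w = w + φ w • (((ε:ℝ) - 1) • e) := fun w => rfl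
  have hdet : LinearMap.det S = ε := by
    rw [hS, LinearMap.transvection.det, map_smul, hφe]; simp
  have hA' : ∀ w, A w = A (w - φ w • e) := by intro w; simp [he]
  have hpyth : ∀ w, ‖S w‖^2 = ‖w - φ w • e‖^2 + (ε * φ w)^2 := by
    intro w
    have h : S w = (w - φ w • e) + (ε * φ w) • e := by
      rw [hSw]; module
    rw [h, @norm_add_sq_real, inner_sub_left, inner_smul_right, inner_smul_right, inner_smul_left]
    have h1 : inner ℝ w e = φ w := by simp [hφ, real_inner_comm]
    rw [h1]
    simp [he1, norm_smul, mul_pow]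
  have hpyth2 : ∀ w, ‖w‖^2 = ‖w - φ w • e‖^2 + (φ w)^2 := by
    intro w
    have h : w = (w - φ w • e) + (φ w) • e := by module
    conv_lhs => rw [h]
    rw [@norm_add_sq_real, inner_sub_left, inner_smul_right, inner_smul_right, inner_smul_left]
    have h1 : inner ℝ w e = φ w := by simp [hφ, real_inner_comm]
    rw [h1]
    simp [he1, norm_smul]
  have hε' : (ε:ℝ) ≤ 1 := hε
  have hb1 : ∀ w, ‖w - φ w • e‖ ≤ ‖S w‖ := by
    intro w
    apply le_of_sq_le_sq _ (norm_nonneg _)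
    rw [hpyth]; nlinarith [sq_nonneg (ε * φ w)]
  have hb2 : ∀ w, ε * ‖w‖ ≤ ‖S w‖ := by
    intro w
    apply le_of_sq_le_sq _ (norm_nonneg _)
    rw [mul_pow, hpyth, hpyth2]
    have : (ε:ℝ)^2 ≤ 1 := by nlinarith [ε.2]
    nlinarith [sq_nonneg ‖w - φ w • e‖]
  have hmain : ∀ u ∈ Z, ∀ v ∈ Z, ‖f u - f v‖ ≤ (K+1) * ‖S u - S v‖ := by
    intro u hu v hv
    have h1 := hf u hu v hv
    rw [← map_sub S]
    have h2 : ‖A (u - v)‖ ≤ K * ‖S (u-v)‖ := by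
      rw [hA']
      calc _ ≤ ‖A‖ * _ := A.le_opNorm _
        _ ≤ _ := by gcongr; exact hb1 _
    have h3 : f u - f v = (f u - f v - A (u-v)) + A (u-v) := by abel
    calc ‖f u - f v‖ ≤ ‖f u - f v - A (u-v)‖ + ‖A (u-v)‖ := by
          conv_lhs => rw [h3]
          exact norm_add_le _ _
      _ ≤ _ := by
        have := hb2 (u-v)
        nlinarith
  have hSinj : Function.Injective S := by
    apply (injective_iff_map_eq_zero S).2
    intro w hw
    have := hb2 w
    rw [hw, norm_zero] at this
    have h2 : ‖w‖ ≤ 0 := by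
      by_contra! h
      have : 0 < ε * ‖w‖ := by positivity
      linarith
    simpa using h2
  have him : f '' Z = (f ∘ Function.invFun S) '' (S '' Z) := by
    rw [image_comp]
    congr 1
    rw [← image_comp, Function.invFun_comp hSinj, image_id]
  have hlip : LipschitzOnWith (K+1) (f ∘ Function.invFun S) (S '' Z) := by
    apply LipschitzOnWith.of_dist_le_mul
    rintro _ ⟨u, hu, rfl⟩ _ ⟨v, hv, rfl⟩
    simp only [Function.comp, Function.leftInverse_invFun hSinj _, dist_eq_norm]
    exact_mod_cast hmain u hu v hv
  rw [him]
  refine (hlip.hausdorffMeasure_image_le (by positivity)).trans ?_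
  rw [Measure.addHaar_image_linearMap, hdet]
  simp [mul_assoc]

theorem bilip_decomp (n d : ℕ) (f : Eu n → Eu d) (K : ℝ≥0) (hf : LipschitzWith K f) :
    ∃ S : ℕ → Set (Eu n), (∀ i, ∃ c : ℝ≥0, ∀ u ∈ S i, ∀ v ∈ S i, dist u v ≤ c * dist (f u) (f v)) ∧
      μH[(n:ℝ)] (range f \ ⋃ i, f '' S i) = 0 := by
  classical
  set s := {u | DifferentiableAt ℝ f u} with hs
  have hr : ∀ A : Eu n →L[ℝ] Eu d, ∃ c : ℝ≥0, c ≠ 0 ∧ (Function.Injective A → ∀ w, 2 * c * ‖w‖ ≤ ‖A w‖) := by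
    intro A
    by_cases h : Function.Injective A
    · obtain ⟨c, hc, hA⟩ := LinearMap.exists_antilipschitzWith (A : Eu n →ₗ[ℝ] Eu d) (LinearMap.ker_eq_bot.2 h)
      refine ⟨c⁻¹/2, by positivity, fun _ w => ?_⟩
      have := hA.le_mul_dist w 0
      simp at this
      push_cast
      have hc' : (0:ℝ) < c := hc
      rw [mul_div_cancel₀ _ (by norm_num), inv_mul_le_iff₀ hc']
      exact this
    · exact ⟨1, one_ne_zero, fun h' => absurd h' h⟩
  choose ρ hρ0 hρ using hr
  have hpart : ∀ m : ℕ, ∃ (t : ℕ → Set (Eu n)) (A : ℕ → Eu n →L[ℝ] Eu d),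
      Pairwise (Function.onFun Disjoint t) ∧ (∀ i, MeasurableSet (t i)) ∧ (s ⊆ ⋃ i, t i) ∧
      (∀ i, ApproximatesLinearOn f (A i) (s ∩ t i)
        (if Function.Injective (A i) then ρ (A i) else 1/((m:ℝ≥0)+1))) ∧
      (s.Nonempty → ∀ i, ∃ y ∈ s, A i = fderiv ℝ f y) := by
    intro m
    apply exists_partition_approximatesLinearOn_of_hasFDerivWithinAt f s (fderiv ℝ f)
      (fun x hx => (DifferentiableAt.hasFDerivAt hx).hasFDerivWithinAt)
      (fun A => if Function.Injective A then ρ A else 1/((m:ℝ≥0)+1))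
    intro A
    split_ifs
    · exact hρ0 A
    · positivity
  choose t A hdis hmeas hcov happ hfd using hpart
  set S0 : ℕ × ℕ → Set (Eu n) := fun p => if Function.Injective (A p.1 p.2) then s ∩ t p.1 p.2 else ∅ with hS0
  refine ⟨fun i => S0 (Nat.unpair i), ?_, ?_⟩
  · suffices hp : ∀ p, ∃ c : ℝ≥0, ∀ u ∈ S0 p, ∀ v ∈ S0 p, dist u v ≤ c * dist (f u) (f v) from fun i => hp _
    intro p
    by_cases h : Function.Injective (A p.1 p.2)
    · refine ⟨(ρ (A p.1 p.2))⁻¹, ?_⟩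
      simp only [hS0, h, if_true]
      intro u hu v hv
      have h1 := happ p.1 p.2 u hu v hv
      simp only [h, if_true] at h1
      have h2 := hρ (A p.1 p.2) h (u - v)
      have h3 : ‖A p.1 p.2 (u-v)‖ ≤ ‖f u - f v‖ + ‖f u - f v - A p.1 p.2 (u-v)‖ := by
        have := norm_sub_le (f u - f v) (f u - f v - A p.1 p.2 (u-v))
        simpa using this
      have h0 : (0:ℝ) < ρ (A p.1 p.2) := by have := hρ0 (A p.1 p.2); positivity
      rw [dist_eq_norm, dist_eq_norm]
      push_cast
      rw [le_inv_mul_iff₀ h0]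
      linarith
    · exact ⟨1, by simp [hS0, h]⟩
  · have hun : ⋃ i, f '' S0 (Nat.unpair i) = ⋃ p, f '' S0 p := by
      apply Nat.pairEquiv.symm.surjective.iUnion_comp (fun p => f '' S0 p)
    rw [hun]
    have hnd : μH[(n:ℝ)] (f '' sᶜ) = 0 := by
      have h0 : μH[(n:ℝ)] sᶜ = 0 := hf.ae_differentiableAt
      have := hf.hausdorffMeasure_image_le (d := (n:ℝ)) (by positivity) sᶜ
      rw [h0, mul_zero] at this
      exact le_antisymm this bot_le
    have hdg : ∀ R : ℕ, μH[(n:ℝ)] (f '' (s ∩ ball 0 R) \ ⋃ p, f '' S0 p) = 0 := by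
      intro R
      have hfinR : μH[(n:ℝ)] (ball (0 : Eu n) R) ≠ ⊤ := measure_ball_lt_top.ne
      have hb : ∀ m : ℕ, μH[(n:ℝ)] (f '' (s ∩ ball 0 R) \ ⋃ p, f '' S0 p) ≤
          ((K+1)^n * μH[(n:ℝ)] (ball (0 : Eu n) R)) * (((m:ℝ≥0∞)+1)⁻¹) := by
        intro m
        have hsub : f '' (s ∩ ball 0 R) \ ⋃ p, f '' S0 p ⊆
            ⋃ i, (if Function.Injective (A m i) then ∅ else f '' (s ∩ t m i ∩ ball 0 R)) := by
          rintro _ ⟨⟨u, ⟨hus, huR⟩, rfl⟩, hnot⟩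
          obtain ⟨i, hi⟩ := mem_iUnion.1 (hcov m hus)
          refine mem_iUnion.2 ⟨i, ?_⟩
          split_ifs with h
          · exfalso
            apply hnot
            refine mem_iUnion.2 ⟨(m, i), u, ?_, rfl⟩
            simp only [hS0, h, if_true]
            exact ⟨hus, hi⟩
          · exact ⟨u, ⟨⟨hus, hi⟩, huR⟩, rfl⟩
        calc _ ≤ ∑' i, μH[(n:ℝ)] (if Function.Injective (A m i) then ∅ else f '' (s ∩ t m i ∩ ball 0 R)) :=
              (measure_mono hsub).trans (measure_iUnion_le _)
          _ ≤ ∑' i, (K+1)^n * ((m:ℝ≥0∞)+1)⁻¹ * μH[(n:ℝ)] (t m i ∩ ball 0 R) := by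
              apply ENNReal.tsum_le_tsum
              intro i
              split_ifs with h
              · simp
              · rcases s.eq_empty_or_nonempty with he | hne
                · simp [he]
                obtain ⟨y, _, hy⟩ := hfd m hne i
                have h1 := happ m i
                simp only [h, if_false] at h1
                have h2 := degenerate_image n d f (A m i) K (1/((m:ℝ≥0)+1))
                  (by rw [hy]; exact norm_fderiv_le_of_lipschitz ℝ hf) h (by positivity)
                  (by rw [div_le_one (by positivity)]; simp) _ (h1.mono_set (s := s ∩ t m i ∩ ball 0 R) inter_subset_left)
                refine h2.trans ?_
                gcongr
                · rw [ENNReal.coe_div (by positivity)]; simp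
                · exact inter_subset_right
          _ = (K+1)^n * ((m:ℝ≥0∞)+1)⁻¹ * ∑' i, μH[(n:ℝ)] (t m i ∩ ball 0 R) := ENNReal.tsum_mul_left
          _ ≤ (K+1)^n * ((m:ℝ≥0∞)+1)⁻¹ * μH[(n:ℝ)] (ball (0 : Eu n) R) := by
              gcongr
              rw [← measure_iUnion]
              · apply measure_mono
                exact iUnion_subset fun i => inter_subset_right
              · intro i j hij
                exact (hdis m hij).mono inter_subset_left inter_subset_left
              · exact fun i => (hmeas m i).inter measurableSet_ball
          _ = _ := by ring
      have hlim : Tendsto (fun m : ℕ => ((K+1)^n * μH[(n:ℝ)] (ball (0 : Eu n) R)) * (((m:ℝ≥0∞)+1)⁻¹)) atTop (nhds 0) := by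
        have h1 : Tendsto (fun m : ℕ => (((m:ℝ≥0∞)+1)⁻¹)) atTop (nhds 0) := by
          have := (tendsto_add_atTop_iff_nat 1).2 ENNReal.tendsto_inv_nat_nhds_zero
          simpa using this
        have h2 := ENNReal.Tendsto.const_mul (a := ((K+1)^n * μH[(n:ℝ)] (ball (0 : Eu n) R))) h1
          (Or.inr (ENNReal.mul_ne_top (by finiteness) hfinR))
        simpa using h2
      exact le_antisymm (ge_of_tendsto' hlim hb) bot_le
    refine measure_mono_null (t := (f '' sᶜ) ∪ ⋃ R : ℕ, (f '' (s ∩ ball 0 R) \ ⋃ p, f '' S0 p)) ?_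
      (measure_union_null hnd (measure_iUnion_null hdg))
    rintro _ ⟨⟨u, rfl⟩, hu⟩
    by_cases hus : u ∈ s
    · right
      obtain ⟨R, hR⟩ := exists_nat_gt (dist u 0)
      exact mem_iUnion.2 ⟨R, ⟨⟨u, ⟨hus, hR⟩, rfl⟩, hu⟩⟩
    · left
      exact ⟨u, hus, rfl⟩

end

section

/-- squared norm as an extended real -/
noncomputable def sqn {d : ℕ} (x : Eu d) : ℝ≥0∞ := ENNReal.ofReal (‖x‖^2)

theorem sqn_meas {d : ℕ} {α : Type*} [MeasurableSpace α] {f : α → Eu d} (hf : Measurable f) :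
    Measurable (fun a => sqn (f a)) := by
  unfold sqn
  exact ENNReal.measurable_ofReal.comp (hf.norm.pow_const 2)

theorem sqn_le_of {d : ℕ} {x : Eu d} {r : ℝ} (h : ‖x‖ ≤ r) : sqn x ≤ ENNReal.ofReal (r^2) := by
  unfold sqn; gcongr

theorem sqn_zero {d : ℕ} : sqn (0 : Eu d) = 0 := by simp [sqn]

theorem sqn_neg {d : ℕ} (x : Eu d) : sqn (-x) = sqn x := by simp [sqn]

theorem two_ofReal (z : ℝ) : 2 * ENNReal.ofReal z = ENNReal.ofReal (2 * z) := by
  rw [ENNReal.ofReal_mul (by norm_num)]; simp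

theorem sqn_par {d : ℕ} (a b c : Eu d) :
    sqn (a - (2:ℝ) • b + c) + sqn (c - a) = 2 * sqn (c - b) + 2 * sqn (b - a) := by
  unfold sqn
  rw [← ENNReal.ofReal_add (by positivity) (by positivity)]
  rw [two_ofReal, two_ofReal, ← ENNReal.ofReal_add (by positivity) (by positivity)]
  congr 1
  have h := parallelogram_law_with_norm ℝ (c - b) (b - a)
  have e1 : a - (2:ℝ) • b + c = (c - b) - (b - a) := by module
  have e2 : c - a = (c - b) + (b - a) := by abel
  rw [e1, e2]
  nlinarith

section energy
variable {n d : ℕ} (g : Eu n → Eu d) (L : ℝ≥0) (hg : LipschitzWith L g) (R : ℝ)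
  (hsupp : ∀ u, R ≤ ‖u‖ → g u = 0)

theorem q_bound (g : Eu n → Eu d) (L : ℝ≥0) (hg : LipschitzWith L g) (R : ℝ)
    (hsupp : ∀ u, R ≤ ‖u‖ → g u = 0) (ρ : ℝ) (h : Eu n) (hh : ‖h‖ ≤ ρ) :
    ∫⁻ u, sqn (g (u + h) - g u) ∂μH[(n:ℝ)] ≤
      ENNReal.ofReal (L^2 * ‖h‖^2) * μH[(n:ℝ)] (ball (0 : Eu n) (R + ρ)) := by
  have hρ : 0 ≤ ρ := (norm_nonneg _).trans hh
  calc _ ≤ ∫⁻ u, (ball (0 : Eu n) (R+ρ)).indicator (fun _ => ENNReal.ofReal (L^2 * ‖h‖^2)) u ∂μH[(n:ℝ)] := by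
        apply lintegral_mono
        intro u
        by_cases hu : u ∈ ball (0 : Eu n) (R+ρ)
        · rw [indicator_of_mem hu]
          rw [← mul_pow]
          apply sqn_le_of
          have := hg.dist_le_mul (u+h) u
          simpa [dist_eq_norm] using this
        · rw [indicator_of_notMem hu]
          rw [mem_ball_zero_iff, not_lt] at hu
          have h2 : ‖u‖ ≤ ‖u + h‖ + ‖h‖ := by
            have := norm_sub_le (u+h) h; simpa using this
          beta_reduce
          rw [hsupp u (by linarith), hsupp (u+h) (by linarith)]
          simp [sqn]
    _ = _ := by rw [lintegral_indicator_const measurableSet_ball]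

theorem q_tele (g : Eu n → Eu d) (hg : Continuous g) (h : Eu n) :
    ∫⁻ u, sqn (g u - (2:ℝ) • g (u + h) + g (u + (2:ℝ) • h)) ∂μH[(n:ℝ)] +
     ∫⁻ u, sqn (g (u + (2:ℝ) • h) - g u) ∂μH[(n:ℝ)] = 4 * ∫⁻ u, sqn (g (u + h) - g u) ∂μH[(n:ℝ)] := by
  rw [← lintegral_add_left (sqn_meas (by fun_prop))]
  simp_rw [sqn_par]
  rw [lintegral_add_left ((sqn_meas (by fun_prop)).const_mul _), lintegral_const_mul _ (sqn_meas (by fun_prop)),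
    lintegral_const_mul _ (sqn_meas (by fun_prop))]
  have h1 : ∫⁻ u, sqn (g (u + (2:ℝ) • h) - g (u + h)) ∂μH[(n:ℝ)] = ∫⁻ u, sqn (g (u + h) - g u) ∂μH[(n:ℝ)] := by
    rw [← lintegral_add_right_eq_self (fun u => sqn (g (u + h) - g u)) h]
    simp only [two_smul, add_assoc]
  rw [h1]; ring

theorem energy_bound (g : Eu n → Eu d) (L : ℝ≥0) (hg : LipschitzWith L g) (R : ℝ)
    (hsupp : ∀ u, R ≤ ‖u‖ → g u = 0) (ρ : ℝ) :
    ∃ C : ℝ≥0∞, C ≠ ⊤ ∧ ∀ e : Eu n, ‖e‖ ≤ ρ → ∀ m : ℕ, ∀ b : Eu n,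
      ∑ k ∈ Finset.range m, 4^k * ∫⁻ u, sqn (g (u + ((1/2:ℝ)^k) • b) - (2:ℝ) • g (u + ((1/2:ℝ)^k) • (b + e))
        + g (u + ((1/2:ℝ)^k) • (b + (2:ℝ) • e))) ∂μH[(n:ℝ)] ≤ C := by
  refine ⟨ENNReal.ofReal (4 * (L^2 * ρ^2)) * μH[(n:ℝ)] (ball (0 : Eu n) (R + 2 * ρ)),
    ENNReal.mul_ne_top ENNReal.ofReal_ne_top measure_ball_lt_top.ne, ?_⟩
  intro e he m b
  have hshift : ∀ k : ℕ, ∫⁻ u, sqn (g (u + ((1/2:ℝ)^k) • b) - (2:ℝ) • g (u + ((1/2:ℝ)^k) • (b + e))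
        + g (u + ((1/2:ℝ)^k) • (b + (2:ℝ) • e))) ∂μH[(n:ℝ)] =
      ∫⁻ u, sqn (g u - (2:ℝ) • g (u + ((1/2:ℝ)^k) • e) + g (u + (2:ℝ) • ((1/2:ℝ)^k) • e)) ∂μH[(n:ℝ)] := by
    intro k
    rw [← lintegral_add_right_eq_self (fun u => sqn (g u - (2:ℝ) • g (u + ((1/2:ℝ)^k) • e)
      + g (u + (2:ℝ) • ((1/2:ℝ)^k) • e))) (((1/2:ℝ)^k) • b)]
    refine lintegral_congr fun u => ?_
    have e1 : u + ((1/2:ℝ)^k) • (b + e) = u + ((1/2:ℝ)^k) • b + ((1/2:ℝ)^k) • e := by module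
    have e2 : u + ((1/2:ℝ)^k) • (b + (2:ℝ) • e) = u + ((1/2:ℝ)^k) • b + (2:ℝ) • ((1/2:ℝ)^k) • e := by module
    rw [e1, e2]
  simp_rw [hshift]
  have htele : ∀ m : ℕ, ∑ k ∈ Finset.range m, 4^k * ∫⁻ u, sqn (g u - (2:ℝ) • g (u + ((1/2:ℝ)^k) • e)
      + g (u + (2:ℝ) • ((1/2:ℝ)^k) • e)) ∂μH[(n:ℝ)] + ∫⁻ u, sqn (g (u + (2:ℝ) • e) - g u) ∂μH[(n:ℝ)]
      = 4^m * ∫⁻ u, sqn (g (u + (2:ℝ) • ((1/2:ℝ)^m) • e) - g u) ∂μH[(n:ℝ)] := by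
    intro m
    induction m with
    | zero => simp
    | succ m ih =>
      rw [Finset.sum_range_succ, add_right_comm, ih, ← mul_add, add_comm, q_tele g hg.continuous]
      rw [pow_succ, mul_assoc]
      congr 4
      ext u
      congr 4
      rw [pow_succ, smul_smul]
      congr 2
      ring
  refine (le_self_add.trans (htele m).le).trans ?_
  have hpow : (1/2:ℝ)^m ≤ 1 := pow_le_one₀ (by norm_num) (by norm_num)
  have hρ : 0 ≤ ρ := (norm_nonneg _).trans he
  have hnorm : ‖(2:ℝ) • ((1/2:ℝ)^m) • e‖ = 2 * (1/2:ℝ)^m * ‖e‖ := by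
    rw [norm_smul, norm_smul]; simp [mul_assoc]
  refine (mul_le_mul_right (q_bound g L hg R hsupp (2*ρ) ((2:ℝ) • ((1/2:ℝ)^m) • e) ?_) _).trans ?_
  · rw [hnorm]; nlinarith [norm_nonneg e]
  · rw [← mul_assoc]
    gcongr
    rw [show (4:ℝ≥0∞)^m = ENNReal.ofReal (4^m) by rw [ENNReal.ofReal_pow (by norm_num)]; simp,
      ← ENNReal.ofReal_mul (by positivity)]
    apply ENNReal.ofReal_le_ofReal
    rw [hnorm]
    have h4 : (4:ℝ)^m * ((1/2:ℝ)^m)^2 = 1 := by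
      rw [← pow_mul, mul_comm m 2, pow_mul, ← mul_pow]; norm_num
    calc (4:ℝ)^m * (L^2 * (2 * (1/2:ℝ)^m * ‖e‖)^2) = 4 * (L^2 * ‖e‖^2) * ((4:ℝ)^m * ((1/2:ℝ)^m)^2) := by ring
      _ = 4 * (L^2 * ‖e‖^2) := by rw [h4, mul_one]
      _ ≤ _ := by gcongr

end energy

end

section

theorem sqn_add_le {d : ℕ} (x y : Eu d) : sqn (x + y) ≤ 2 * sqn x + 2 * sqn y := by
  unfold sqn
  rw [two_ofReal, two_ofReal, ← ENNReal.ofReal_add (by positivity) (by positivity)]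
  apply ENNReal.ofReal_le_ofReal
  have h := norm_add_le x y
  nlinarith [norm_nonneg (x+y), norm_nonneg x, norm_nonneg y, sq_nonneg (‖x‖ - ‖y‖)]

theorem sqn_add_le2 {d : ℕ} (x y : Eu d) : sqn (x + y) ≤ ENNReal.ofReal (3/2) * sqn x + 3 * sqn y := by
  unfold sqn
  rw [show (3:ℝ≥0∞) = ENNReal.ofReal 3 by simp, ← ENNReal.ofReal_mul (by norm_num),
    ← ENNReal.ofReal_mul (by norm_num), ← ENNReal.ofReal_add (by positivity) (by positivity)]
  apply ENNReal.ofReal_le_ofReal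
  have h := norm_add_le x y
  nlinarith [norm_nonneg (x+y), norm_nonneg x, norm_nonneg y, sq_nonneg (‖x‖ - 2 * ‖y‖)]

theorem sqn_smul {d : ℕ} (c : ℝ) (x : Eu d) : sqn (c • x) = ENNReal.ofReal (c^2) * sqn x := by
  unfold sqn
  rw [norm_smul, mul_pow, ENNReal.ofReal_mul (by positivity)]; simp

/-- the multi-scale energy -/
noncomputable def En {n d : ℕ} (m : ℕ) (φ : ℕ → Eu n → Eu d) : ℝ≥0∞ :=
  ∑ k ∈ Finset.range m, 4^k * ∫⁻ u, sqn (φ k u) ∂μH[(n:ℝ)]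

theorem En_le {n d : ℕ} (m : ℕ) (φ ψ χ : ℕ → Eu n → Eu d) (a b : ℝ≥0∞)
    (hψ : ∀ k, Measurable (ψ k)) (hχ : ∀ k, Measurable (χ k))
    (h : ∀ k u, sqn (φ k u) ≤ a * sqn (ψ k u) + b * sqn (χ k u)) :
    En m φ ≤ a * En m ψ + b * En m χ := by
  unfold En
  rw [Finset.mul_sum, Finset.mul_sum, ← Finset.sum_add_distrib]
  apply Finset.sum_le_sum
  intro k _
  calc _ ≤ 4^k * ∫⁻ u, a * sqn (ψ k u) + b * sqn (χ k u) ∂μH[(n:ℝ)] := by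
        gcongr; exact h k _
    _ = _ := by
        rw [lintegral_add_left ((sqn_meas (hψ k)).const_mul _), lintegral_const_mul _ (sqn_meas (hψ k)),
          lintegral_const_mul _ (sqn_meas (hχ k))]
        ring

section dor
variable {n d : ℕ}

/-- first difference -/
noncomputable def Fd (g : Eu n → Eu d) (w : Eu n) (k : ℕ) (u : Eu n) : Eu d :=
  g (u + ((1/2:ℝ)^k) • w) - g u

/-- coordinate vector -/
noncomputable def ev (i : Fin n) : Eu n := EuclideanSpace.single i (1:ℝ)

/-- affine defect -/
noncomputable def Dd (g : Eu n → Eu d) (K : ℝ) (w : Eu n) (k : ℕ) (u : Eu n) : Eu d :=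
  Fd g w k u - ∑ i, (w i / K) • Fd g (K • ev i) k u

/-- mixed second difference -/
noncomputable def Xd (g : Eu n → Eu d) (w w' : Eu n) (k : ℕ) (u : Eu n) : Eu d :=
  g (u + ((1/2:ℝ)^k) • (w + w')) - g (u + ((1/2:ℝ)^k) • w) - g (u + ((1/2:ℝ)^k) • w') + g u

/-- second difference -/
noncomputable def Sd (g : Eu n → Eu d) (b e : Eu n) (k : ℕ) (u : Eu n) : Eu d :=
  g (u + ((1/2:ℝ)^k) • b) - (2:ℝ) • g (u + ((1/2:ℝ)^k) • (b + e))
        + g (u + ((1/2:ℝ)^k) • (b + (2:ℝ) • e))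

theorem Fd_cont (g : Eu n → Eu d) (hg : Continuous g) (w : Eu n) (k : ℕ) : Continuous (Fd g w k) := by
  unfold Fd; fun_prop
theorem Dd_cont (g : Eu n → Eu d) (hg : Continuous g) (K : ℝ) (w : Eu n) (k : ℕ) : Continuous (Dd g K w k) := by
  unfold Dd Fd; fun_prop
theorem Xd_cont (g : Eu n → Eu d) (hg : Continuous g) (w w' : Eu n) (k : ℕ) : Continuous (Xd g w w' k) := by
  unfold Xd; fun_prop
theorem Sd_cont (g : Eu n → Eu d) (hg : Continuous g) (w w' : Eu n) (k : ℕ) : Continuous (Sd g w w' k) := by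
  unfold Sd; fun_prop

theorem Dd_add (g : Eu n → Eu d) (K : ℝ) (w w' : Eu n) (k : ℕ) (u : Eu n) :
    Dd g K (w + w') k u = Dd g K w k u + (Dd g K w' k u + Xd g w w' k u) := by
  unfold Dd
  have : ∑ i, ((w + w') i / K) • Fd g (K • ev i) k u =
      ∑ i, (w i / K) • Fd g (K • ev i) k u + ∑ i, (w' i / K) • Fd g (K • ev i) k u := by
    rw [← Finset.sum_add_distrib]
    refine Finset.sum_congr rfl fun i _ => ?_
    rw [← add_smul]; congr 1; simp [add_div]
  rw [this]
  unfold Fd Xd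
  abel

theorem Dd_half (g : Eu n → Eu d) (K : ℝ) (w : Eu n) (k : ℕ) (u : Eu n) :
    Dd g K w k u = (1/2:ℝ) • (Dd g K ((2:ℝ) • w) k u + (-1:ℝ) • Sd g 0 w k u) := by
  have : ∑ i, (((2:ℝ) • w) i / K) • Fd g (K • ev i) k u =
      (2:ℝ) • ∑ i, (w i / K) • Fd g (K • ev i) k u := by
    rw [Finset.smul_sum]
    refine Finset.sum_congr rfl fun i _ => ?_
    rw [smul_smul]; congr 1; simp [mul_div_assoc]
  unfold Dd
  rw [this]
  unfold Fd Sd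
  simp only [smul_zero, add_zero, zero_add]
  module

theorem Xd_eq (g : Eu n → Eu d) (w w' : Eu n) (k : ℕ) (u : Eu n) :
    Xd g w w' k u = Sd g 0 ((1/2:ℝ) • (w + w')) k u + (-1:ℝ) • Sd g w ((1/2:ℝ) • (w' - w)) k u := by
  unfold Xd Sd
  have e1 : (0:Eu n) + (2:ℝ) • ((1/2:ℝ) • (w + w')) = w + w' := by module
  have e2 : w + (2:ℝ) • ((1/2:ℝ) • (w' - w)) = w' := by module
  have e3 : w + ((1/2:ℝ) • (w' - w)) = (1/2:ℝ) • (w + w') := by module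
  rw [e1, e2, e3]
  simp only [smul_zero, add_zero, zero_add]
  module

theorem ev_apply (i j : Fin n) : (ev i : Eu n) j = if j = i then 1 else 0 := by
  simp [ev]

theorem sum_ev (w : Eu n) : w = ∑ i, w i • ev i := by
  ext j
  simp [ev_apply]

theorem ev_norm (i : Fin n) : ‖(ev i : Eu n)‖ = 1 := by simp [ev]

theorem norm_le_box (w : Eu n) (K : ℝ) (hw : ∀ i, |w i| ≤ K) : ‖w‖ ≤ n * K := by
  conv_lhs => rw [sum_ev w]
  refine (norm_sum_le _ _).trans ?_
  calc _ ≤ ∑ i : Fin n, K := by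
        apply Finset.sum_le_sum
        intro i _
        rw [norm_smul, ev_norm, mul_one]; exact hw i
    _ = _ := by simp

theorem Dd_ev (g : Eu n → Eu d) (K : ℝ) (hK : 0 < K) (i : Fin n) (k : ℕ) (u : Eu n) :
    Dd g K (K • ev i) k u = 0 := by
  unfold Dd
  rw [Finset.sum_eq_single i]
  · simp [ev_apply, hK.ne']
  · intro j _ hj
    simp [ev_apply, hj]
  · simp

theorem Dd_zero (g : Eu n → Eu d) (K : ℝ) (k : ℕ) (u : Eu n) : Dd g K 0 k u = 0 := by
  simp [Dd, Fd]

theorem Dd_neg (g : Eu n → Eu d) (K : ℝ) (hK : 0 < K) (i : Fin n) (k : ℕ) (u : Eu n) :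
    Dd g K (-(K • ev i)) k u = - Xd g (K • ev i) (-(K • ev i)) k u := by
  have h := Dd_add g K (K • ev i) (-(K • ev i)) k u
  rw [add_neg_cancel, Dd_zero, Dd_ev g K hK, zero_add] at h
  exact eq_neg_of_add_eq_zero_left h.symm

theorem Xd_energy (g : Eu n → Eu d) (L : ℝ≥0) (hg : LipschitzWith L g) (R : ℝ)
    (hsupp : ∀ u, R ≤ ‖u‖ → g u = 0) (ρ : ℝ) :
    ∃ C : ℝ≥0∞, C ≠ ⊤ ∧ ∀ w w' : Eu n, ‖w‖ ≤ ρ → ‖w'‖ ≤ ρ → ∀ m,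
      En m (Xd g w w') ≤ C ∧ En m (Sd g 0 w) ≤ C := by
  obtain ⟨C, hC, h⟩ := energy_bound g L hg R hsupp ρ
  refine ⟨4 * C, by finiteness, ?_⟩
  intro w w' hw hw' m
  have h1 : ∀ b e : Eu n, ‖e‖ ≤ ρ → En m (Sd g b e) ≤ C := fun b e he => h e he m b
  constructor
  · refine (En_le m _ (Sd g 0 ((1/2:ℝ) • (w + w'))) (Sd g w ((1/2:ℝ) • (w' - w))) 2 2
      (fun k => (Sd_cont g hg.continuous _ _ k).measurable)
      (fun k => (Sd_cont g hg.continuous _ _ k).measurable) ?_).trans ?_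
    · intro k u
      rw [Xd_eq]
      refine (sqn_add_le _ _).trans ?_
      rw [sqn_smul]; simp
    · calc _ ≤ 2 * C + 2 * C := by
            gcongr
            · apply h1
              rw [norm_smul]
              have := norm_add_le w w'
              norm_num; linarith
            · apply h1
              rw [norm_smul]
              have := norm_sub_le w' w
              norm_num; linarith
        _ = 4 * C := by ring
  · calc _ ≤ 1 * C := by rw [one_mul]; exact h1 _ _ hw
      _ ≤ _ := by gcongr; norm_num

theorem En_congr_zero (m : ℕ) (φ : ℕ → Eu n → Eu d) (h : ∀ k u, φ k u = 0) : En m φ = 0 := by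
  simp [En, h, sqn_zero]

theorem corner_energy (g : Eu n → Eu d) (L : ℝ≥0) (hg : LipschitzWith L g) (R : ℝ)
    (hsupp : ∀ u, R ≤ ‖u‖ → g u = 0) (K : ℝ) (hK : 0 < K) (s : Finset (Fin n)) :
    ∃ C : ℝ≥0∞, C ≠ ⊤ ∧ ∀ σ : Fin n → ℝ, (∀ i, σ i = 0 ∨ σ i = 1 ∨ σ i = -1) → ∀ m,
      En m (Dd g K (∑ i ∈ s, σ i • (K • ev i))) ≤ C := by
  classical
  have hnorm : ∀ σ : Fin n → ℝ, (∀ i, σ i = 0 ∨ σ i = 1 ∨ σ i = -1) → ∀ s : Finset (Fin n),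
      ‖∑ i ∈ s, σ i • (K • ev i : Eu n)‖ ≤ n * K + K := by
    intro σ hσ s
    refine (norm_sum_le _ _).trans ?_
    calc _ ≤ ∑ i ∈ s, K := by
          apply Finset.sum_le_sum
          intro i _
          rw [norm_smul, norm_smul, ev_norm, mul_one]
          rcases hσ i with h | h | h <;> simp [h, abs_of_pos hK, hK.le]
      _ ≤ _ := by
          have : (s.card : ℝ) ≤ n := by
            have := Finset.card_le_univ s
            simpa using this
          simp; nlinarith
  obtain ⟨C0, hC0, hX⟩ := Xd_energy g L hg R hsupp (n * K + K)
  have hsing : ∀ i (t : ℝ), (t = 0 ∨ t = 1 ∨ t = -1) → ∀ m, En m (Dd g K (t • (K • ev i))) ≤ C0 := by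
    intro i t ht m
    have hn : ‖K • (ev i : Eu n)‖ ≤ n * K + K := by
      rw [norm_smul, ev_norm, Real.norm_eq_abs, abs_of_pos hK]
      have : 0 ≤ n * K := by positivity
      linarith
    rcases ht with h | h | h
    · rw [En_congr_zero]; · exact bot_le
      intro k u; rw [h, zero_smul, Dd_zero]
    · rw [En_congr_zero]; · exact bot_le
      intro k u; rw [h, one_smul, Dd_ev g K hK]
    · rw [h, neg_one_smul]
      have : En m (Dd g K (-(K • ev i))) = En m (Xd g (K • ev i) (-(K • ev i))) := by
        unfold En
        simp only [Dd_neg g K hK, sqn_neg]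
      rw [this]
      exact (hX _ _ hn (by rwa [norm_neg]) m).1
  induction s using Finset.induction_on with
  | empty =>
    refine ⟨0, by simp, ?_⟩
    intro σ _ m
    rw [En_congr_zero]
    intro k u
    simp [Dd_zero]
  | insert i s hi ih =>
    obtain ⟨C, hC, h⟩ := ih
    refine ⟨2 * C0 + 2 * (2 * C + 2 * C0), by finiteness, ?_⟩
    intro σ hσ m
    rw [Finset.sum_insert hi]
    set v := ∑ i ∈ s, σ i • (K • ev i : Eu n)
    have h1 : En m (fun k u => Dd g K v k u + Xd g (σ i • (K • ev i)) v k u) ≤ 2 * C + 2 * C0 := by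
      refine (En_le m _ (Dd g K v) (Xd g (σ i • (K • ev i)) v) 2 2
        (fun k => (Dd_cont g hg.continuous _ _ k).measurable)
        (fun k => (Xd_cont g hg.continuous _ _ k).measurable) fun k u => sqn_add_le _ _).trans ?_
      gcongr
      · exact h σ hσ m
      · refine (hX _ _ ?_ (hnorm σ hσ s) m).1
        have := hnorm σ hσ {i}
        simpa using this
    refine (En_le m _ (Dd g K (σ i • (K • ev i))) (fun k u => Dd g K v k u + Xd g (σ i • (K • ev i)) v k u) 2 2
        (fun k => (Dd_cont g hg.continuous _ _ k).measurable)
        (fun k => ((Dd_cont g hg.continuous _ _ k).add (Xd_cont g hg.continuous _ _ k)).measurable) ?_).trans ?_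
    · intro k u
      rw [Dd_add]
      exact sqn_add_le _ _
    · gcongr
      exact hsing i _ (hσ i) m

theorem apriori (g : Eu n → Eu d) (L : ℝ≥0) (hg : LipschitzWith L g) (R : ℝ)
    (hsupp : ∀ u, R ≤ ‖u‖ → g u = 0) (K : ℝ) (hK : 0 < K) (m : ℕ) :
    ∃ C : ℝ≥0∞, C ≠ ⊤ ∧ ∀ w : Eu n, (∀ i, |w i| ≤ K) → En m (Dd g K w) ≤ C := by
  set B : ℝ := L * (n * K) + n * (L * K)
  have hF : ∀ k u w, ‖Fd g w k u‖ ≤ L * ‖w‖ := by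
    intro k u w
    have := hg.dist_le_mul (u + ((1/2:ℝ)^k) • w) u
    rw [dist_eq_norm, dist_eq_norm, add_sub_cancel_left, norm_smul] at this
    refine this.trans ?_
    gcongr
    have : ‖(1/2:ℝ)^k‖ ≤ 1 := by
      rw [norm_pow]; apply pow_le_one₀ (by positivity); norm_num
    nlinarith [norm_nonneg w]
  have hF0 : ∀ k u w, R + ‖w‖ ≤ ‖u‖ → Fd g w k u = 0 := by
    intro k u w h
    have h1 : ‖((1/2:ℝ)^k) • w‖ ≤ ‖w‖ := by
      rw [norm_smul]
      have : ‖(1/2:ℝ)^k‖ ≤ 1 := by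
        rw [norm_pow]; apply pow_le_one₀ (by positivity); norm_num
      nlinarith [norm_nonneg w]
    have h2 : ‖u‖ ≤ ‖u + ((1/2:ℝ)^k) • w‖ + ‖((1/2:ℝ)^k) • w‖ := by
      have := norm_sub_le (u+((1/2:ℝ)^k) • w) (((1/2:ℝ)^k) • w); simpa using this
    unfold Fd
    rw [hsupp u (by linarith [norm_nonneg w]), hsupp _ (by linarith), sub_zero]
  refine ⟨∑ k ∈ Finset.range m, 4^k * (ENNReal.ofReal (B^2) * μH[(n:ℝ)] (ball (0 : Eu n) (R + (n * K + K)))), ?_, ?_⟩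
  · have : μH[(n:ℝ)] (ball (0 : Eu n) (R + (n * K + K))) ≠ ⊤ := measure_ball_lt_top.ne
    apply ENNReal.sum_ne_top.2
    intro k _
    finiteness
  · intro w hw
    apply Finset.sum_le_sum
    intro k _
    gcongr
    rw [← lintegral_indicator_const measurableSet_ball]
    apply lintegral_mono
    intro u
    have hwn := norm_le_box w K hw
    have hev : ∀ i : Fin n, ‖K • (ev i : Eu n)‖ = K := by
      intro i; rw [norm_smul, ev_norm, Real.norm_eq_abs, abs_of_pos hK, mul_one]
    have hq : ∀ i, |w i / K| ≤ 1 := by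
      intro i; rw [abs_div, abs_of_pos hK, div_le_one hK]; exact hw i
    by_cases hu : u ∈ ball (0 : Eu n) (R + (n * K + K))
    · rw [indicator_of_mem hu]
      apply sqn_le_of
      unfold Dd
      refine (norm_sub_le _ _).trans ?_
      apply add_le_add
      · exact (hF _ _ _).trans (by gcongr)
      · refine (norm_sum_le _ _).trans ?_
        calc _ ≤ ∑ i : Fin n, (L * K : ℝ) := by
              apply Finset.sum_le_sum
              intro i _
              rw [norm_smul]
              have h1 := hF k u (K • ev i)
              rw [hev] at h1
              have := hq i
              calc _ ≤ 1 * (L * K) := by gcongr; exact hq i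
                _ = _ := one_mul _
          _ = _ := by simp
    · rw [indicator_of_notMem hu]
      rw [mem_ball_zero_iff, not_lt] at hu
      have hnK : 0 ≤ n * K := by positivity
      beta_reduce
      unfold Dd
      rw [hF0 k u w (by linarith)]
      rw [Finset.sum_eq_zero]
      · simp [sqn_zero]
      · intro i _
        rw [hF0 k u _ (by rw [hev]; linarith), smul_zero]

theorem Dd_energy (g : Eu n → Eu d) (L : ℝ≥0) (hg : LipschitzWith L g) (R : ℝ)
    (hsupp : ∀ u, R ≤ ‖u‖ → g u = 0) (K : ℝ) (hK : 0 < K) :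
    ∃ C : ℝ≥0∞, C ≠ ⊤ ∧ ∀ w : Eu n, (∀ i, |w i| ≤ K) → ∀ m, En m (Dd g K w) ≤ C := by
  classical
  obtain ⟨C1, hC1, h1⟩ := corner_energy g L hg R hsupp K hK Finset.univ
  obtain ⟨C2, hC2, h2⟩ := Xd_energy g L hg R hsupp (n * K)
  set C : ℝ≥0∞ := 3 * C1 + 3 * C2 + C2
  refine ⟨4 * C, by finiteness, ?_⟩
  intro w0 hw0 m
  obtain ⟨Cm, hCm, hm⟩ := apriori g L hg R hsupp K hK m
  set S : ℝ≥0∞ := ⨆ w : {w : Eu n // ∀ i, |w i| ≤ K}, En m (Dd g K w.1) with hS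
  have hSfin : S ≠ ⊤ := ne_top_of_le_ne_top hCm (iSup_le fun w => hm w.1 w.2)
  have key : ∀ w : Eu n, (∀ i, |w i| ≤ K) → En m (Dd g K w) ≤ ENNReal.ofReal (3/4) * S + C := by
    intro w hw
    set σ : Fin n → ℝ := fun i => if K < 2 * w i then 1 else if 2 * w i < -K then -1 else 0 with hσ
    have hσ3 : ∀ i, σ i = 0 ∨ σ i = 1 ∨ σ i = -1 := by
      intro i; simp only [hσ]; split_ifs <;> simp
    set v : Eu n := ∑ i, σ i • (K • ev i) with hv
    have hvi : ∀ i, v i = σ i * K := by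
      intro i
      simp [hv, ev_apply]
    set v' : Eu n := (2:ℝ) • w - v with hv'
    have hv'b : ∀ i, |v' i| ≤ K := by
      intro i
      have hwi := abs_le.1 (hw i)
      have : v' i = 2 * w i - σ i * K := by simp [hv', hvi]
      rw [this, abs_le]
      simp only [hσ]
      split_ifs <;> constructor <;> linarith
    have hvb : ∀ i, |v i| ≤ K := by
      intro i
      rw [hvi, abs_mul, abs_of_pos hK]
      rcases hσ3 i with h | h | h <;> simp [h, hK.le]
    have h2w : (2:ℝ) • w = v' + v := by simp [hv']
    have hX := (h2 v' v (norm_le_box _ _ hv'b) (norm_le_box _ _ hvb) m).1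
    have hSd := (h2 w w (norm_le_box _ _ hw) (norm_le_box _ _ hw) m).2
    have hV := h1 σ hσ3 m
    have mD : ∀ w k, Measurable (Dd g K w k) := fun w k => (Dd_cont g hg.continuous _ _ k).measurable
    have mX : ∀ w w' k, Measurable (Xd g w w' k) := fun w w' k => (Xd_cont g hg.continuous _ _ k).measurable
    have mS : ∀ w w' k, Measurable (Sd g w w' k) := fun w w' k => (Sd_cont g hg.continuous _ _ k).measurable
    have s1 : En m (fun k u => Dd g K v k u + Xd g v' v k u) ≤ 2 * C1 + 2 * C2 := by
      refine (En_le m _ (Dd g K v) (Xd g v' v) 2 2 (mD v) (mX _ _) fun k u => sqn_add_le _ _).trans ?_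
      gcongr
    have s2 : En m (Dd g K ((2:ℝ) • w)) ≤ ENNReal.ofReal (3/2) * S + 3 * (2 * C1 + 2 * C2) := by
      refine (En_le m _ (Dd g K v') (fun k u => Dd g K v k u + Xd g v' v k u) (ENNReal.ofReal (3/2)) 3 (mD v')
        (fun k => (mD v k).add (mX _ _ k)) fun k u => ?_).trans ?_
      · rw [h2w, Dd_add]; exact sqn_add_le2 _ _
      · gcongr
        exact le_iSup (fun w : {w : Eu n // ∀ i, |w i| ≤ K} => En m (Dd g K w.1)) ⟨v', hv'b⟩
    have hhalf : ENNReal.ofReal ((1/2:ℝ)^2) * 2 = ENNReal.ofReal (1/2) := by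
      rw [mul_comm, two_ofReal]; norm_num
    have s3 : En m (Dd g K w) ≤ ENNReal.ofReal (1/2) * En m (Dd g K ((2:ℝ) • w)) + ENNReal.ofReal (1/2) * En m (Sd g 0 w) := by
      refine En_le m _ _ _ _ _ (mD _) (mS _ _) fun k u => ?_
      rw [Dd_half, sqn_smul]
      calc _ ≤ ENNReal.ofReal ((1/2:ℝ)^2) * (2 * sqn (Dd g K ((2:ℝ) • w) k u) + 2 * sqn ((-1:ℝ) • Sd g 0 w k u)) := by
            gcongr; exact sqn_add_le _ _
        _ = _ := by
            rw [sqn_smul, mul_add, ← mul_assoc, ← mul_assoc, hhalf]; simp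
    calc _ ≤ ENNReal.ofReal (1/2) * (ENNReal.ofReal (3/2) * S + 3 * (2 * C1 + 2 * C2)) + ENNReal.ofReal (1/2) * C2 := by
          refine s3.trans ?_
          gcongr
      _ ≤ ENNReal.ofReal (3/4) * S + (3 * C1 + 3 * C2) + 1 * C2 := by
          rw [mul_add, ← mul_assoc, ← ENNReal.ofReal_mul (by norm_num)]
          gcongr
          · norm_num
          · have : ENNReal.ofReal (1/2) * (3 * (2 * C1 + 2 * C2)) = (2 * ENNReal.ofReal (1/2)) * (3 * C1 + 3 * C2) := by ring
            rw [this, two_ofReal]; norm_num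
          · rw [ENNReal.ofReal_le_one]; norm_num
      _ = _ := by simp only [C, one_mul]; ring
  have hSle : S ≤ ENNReal.ofReal (3/4) * S + C := iSup_le fun w => key w.1 w.2
  have hfin : S ≤ 4 * C := by
    have hCf : C ≠ ⊤ := by finiteness
    rw [← ENNReal.ofReal_toReal hSfin, ← ENNReal.ofReal_toReal hCf, ← ENNReal.ofReal_mul (by norm_num),
      ← ENNReal.ofReal_add (by positivity) (by positivity)] at hSle
    have h3 := (ENNReal.ofReal_le_ofReal_iff (by positivity)).1 hSle
    rw [← ENNReal.ofReal_toReal hSfin, ← ENNReal.ofReal_toReal hCf,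
      show (4:ℝ≥0∞) = ENNReal.ofReal 4 by simp, ← ENNReal.ofReal_mul (by norm_num)]
    apply ENNReal.ofReal_le_ofReal
    linarith
  exact (le_iSup (fun w : {w : Eu n // ∀ i, |w i| ≤ K} => En m (Dd g K w.1)) ⟨w0, hw0⟩).trans hfin

end dor

end

section

section dor2
variable {n d : ℕ}

theorem Dd_cont2 (g : Eu n → Eu d) (hg : Continuous g) (K : ℝ) (k : ℕ) :
    Continuous (fun p : Eu n × Eu n => Dd g K p.1 k p.2) := by
  unfold Dd Fd
  fun_prop

/-- defect at a point, relative to the affine map attached to `u` and the scale `2^-k` -/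
noncomputable def Hd (g : Eu n → Eu d) (K : ℝ) (k : ℕ) (u v : Eu n) : Eu d :=
  Dd g K (((2:ℝ)^k) • (v - u)) k u

theorem Hd_cont2 (g : Eu n → Eu d) (hg : Continuous g) (K : ℝ) (k : ℕ) :
    Continuous (fun p : Eu n × Eu n => Hd g K k p.1 p.2) := by
  unfold Hd Dd Fd
  fun_prop

theorem scale_int (u : Eu n) (K : ℝ) (k : ℕ) (φ : Eu n → ℝ≥0∞) (hφ : Measurable φ) :
    2^(k*n) * ∫⁻ v in closedBall u (K * (1/2)^k), φ v ∂μH[(n:ℝ)] =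
      ∫⁻ w in closedBall 0 K, φ (u + ((1/2:ℝ)^k) • w) ∂μH[(n:ℝ)] := by
  set r : ℝ := (1/2)^k with hr
  have hr0 : 0 < r := by positivity
  set F : Eu n → ℝ≥0∞ := (closedBall (0 : Eu n) (K * r)).indicator (fun z => φ (u + z)) with hF
  have hFm : Measurable F := (hφ.comp (measurable_const_add u)).indicator measurableSet_closedBall
  have h1 : ∫⁻ w in closedBall 0 K, φ (u + r • w) ∂μH[(n:ℝ)] = ∫⁻ w, F (r • w) ∂μH[(n:ℝ)] := by
    rw [← lintegral_indicator measurableSet_closedBall]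
    refine lintegral_congr fun w => ?_
    have : (w ∈ closedBall (0 : Eu n) K) ↔ (r • w ∈ closedBall (0 : Eu n) (K * r)) := by
      rw [mem_closedBall_zero_iff, mem_closedBall_zero_iff, norm_smul, Real.norm_eq_abs, abs_of_pos hr0,
        mul_comm r, mul_le_mul_iff_left₀ hr0]
    by_cases hw : w ∈ closedBall (0 : Eu n) K
    · rw [hF, indicator_of_mem hw, indicator_of_mem (this.1 hw)]
    · rw [hF, indicator_of_notMem hw, indicator_of_notMem (fun h => hw (this.2 h))]
  have h2 : ∫⁻ w, F (r • w) ∂μH[(n:ℝ)] = 2^(k*n) * ∫⁻ z, F z ∂μH[(n:ℝ)] := by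
    rw [← lintegral_map hFm (measurable_const_smul r), Measure.map_addHaar_smul _ hr0.ne', lintegral_smul_measure]
    congr 1
    simp only [finrank_euclideanSpace, Fintype.card_fin]
    rw [abs_of_pos (by positivity), hr, ← pow_mul, ← inv_pow]
    rw [ENNReal.ofReal_pow (by norm_num)]
    norm_num
  rw [h1, h2]
  congr 1
  rw [← lintegral_indicator measurableSet_closedBall,
    ← lintegral_add_left_eq_self (fun v => (closedBall u (K * r)).indicator φ v) u]
  refine lintegral_congr fun z => ?_
  have : (u + z ∈ closedBall u (K * r)) ↔ (z ∈ closedBall (0 : Eu n) (K * r)) := by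
    simp [mem_closedBall, dist_eq_norm]
  by_cases hz : z ∈ closedBall (0 : Eu n) (K * r)
  · rw [hF, indicator_of_mem hz, indicator_of_mem (this.2 hz)]
  · rw [hF, indicator_of_notMem hz, indicator_of_notMem (fun h => hz (this.1 h))]

theorem abs_coord_le (w : Eu n) (i : Fin n) : |w i| ≤ ‖w‖ := by
  have := PiLp.norm_apply_le w i
  simpa using this

theorem Dor_int (g : Eu n → Eu d) (L : ℝ≥0) (hg : LipschitzWith L g) (R : ℝ)
    (hsupp : ∀ u, R ≤ ‖u‖ → g u = 0) (K : ℝ) (hK : 0 < K) :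
    ∃ C : ℝ≥0∞, C ≠ ⊤ ∧ ∑' k : ℕ, ∫⁻ u, (4^k * 2^(k*n)) *
      ∫⁻ v in closedBall u (K * (1/2)^k), sqn (Hd g K k u v) ∂μH[(n:ℝ)] ∂μH[(n:ℝ)] ≤ C := by
  obtain ⟨C, hC, h⟩ := Dd_energy g L hg R hsupp K hK
  refine ⟨C * μH[(n:ℝ)] (closedBall (0 : Eu n) K), ENNReal.mul_ne_top hC measure_closedBall_lt_top.ne, ?_⟩
  rw [ENNReal.tsum_eq_iSup_nat]
  refine iSup_le fun m => ?_
  have hk : ∀ k : ℕ, ∫⁻ u, (4^k * 2^(k*n)) *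
      ∫⁻ v in closedBall u (K * (1/2)^k), sqn (Hd g K k u v) ∂μH[(n:ℝ)] ∂μH[(n:ℝ)] =
      ∫⁻ w in closedBall 0 K, 4^k * ∫⁻ u, sqn (Dd g K w k u) ∂μH[(n:ℝ)] ∂μH[(n:ℝ)] := by
    intro k
    have hm : Measurable (fun p : Eu n × Eu n => sqn (Dd g K p.1 k p.2)) := sqn_meas (Dd_cont2 g hg.continuous K k).measurable
    rw [lintegral_const_mul _ hm.lintegral_prod_right']
    rw [lintegral_lintegral_swap (hm.aemeasurable)]
    rw [← lintegral_const_mul _ hm.lintegral_prod_left']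
    refine lintegral_congr fun u => ?_
    rw [mul_assoc, scale_int u K k (fun v => sqn (Hd g K k u v)) (sqn_meas ((Hd_cont2 g hg.continuous K k).comp (Continuous.prodMk_right u)).measurable)]
    congr 1
    refine lintegral_congr fun w => ?_
    unfold Hd
    rw [add_sub_cancel_left, smul_smul, ← mul_pow]
    norm_num
  simp_rw [hk]
  rw [← lintegral_finsetSum]
  · calc _ ≤ ∫⁻ w in closedBall (0 : Eu n) K, C ∂μH[(n:ℝ)] := by
          apply setLIntegral_mono measurable_const
          intro w hw
          exact h w (fun i => (abs_coord_le w i).trans (mem_closedBall_zero_iff.1 hw)) m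
      _ = _ := by simp
  · intro k _
    have hm : Measurable (fun p : Eu n × Eu n => sqn (Dd g K p.1 k p.2)) := sqn_meas (Dd_cont2 g hg.continuous K k).measurable
    exact (hm.lintegral_prod_right').const_mul _

theorem restrict_le_haus (ν : Measure (Eu n)) (G : Set (Eu n)) (hGc : IsClosed G) (lam : ℝ≥0) (hlam : 0 < lam)
    (hG : ∀ u ∈ G, ∀ r : ℝ, 0 < r → ν (closedBall u r) ≤ lam * ENNReal.ofReal (r^n)) :
    ν.restrict G ≤ (lam : ℝ≥0∞) • (μH[(n:ℝ)] : Measure (Eu n)) := by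
  have hl : (lam : ℝ≥0∞) ≠ 0 := by simpa using hlam.ne'
  have h : (lam : ℝ≥0∞)⁻¹ • ν.restrict G ≤ μH[(n:ℝ)] := by
    apply Measure.le_hausdorffMeasure _ _ 1 one_pos
    intro s hs
    have hfin : ediam s ≠ ⊤ := ne_top_of_le_ne_top ENNReal.one_ne_top hs
    rw [Measure.smul_apply, Measure.restrict_apply' hGc.measurableSet, smul_eq_mul,
      ENNReal.inv_mul_le_iff hl ENNReal.coe_ne_top]
    rcases (s ∩ G).eq_empty_or_nonempty with he | ⟨x, hxs, hxG⟩
    · simp [he]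
    have hsub : s ∩ G ⊆ closedBall x (ediam s).toReal := by
      rintro y ⟨hy, _⟩
      rw [mem_closedBall, dist_edist]
      exact ENNReal.toReal_mono hfin (edist_le_ediam_of_mem hy hxs)
    have hlim : ∀ η : ℝ, 0 < η → ν (s ∩ G) ≤ lam * ENNReal.ofReal (((ediam s).toReal + η)^n) := by
      intro η hη
      refine (measure_mono (hsub.trans (closedBall_subset_closedBall (by linarith)))).trans (hG x hxG ((ediam s).toReal + η) (by positivity))
    have ht : Tendsto (fun η : ℝ => lam * ENNReal.ofReal (((ediam s).toReal + η)^n)) (nhdsWithin 0 (Ioi 0))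
        (nhds (lam * ENNReal.ofReal (((ediam s).toReal + 0)^n))) := by
      apply ENNReal.Tendsto.const_mul _ (Or.inr ENNReal.coe_ne_top)
      apply ENNReal.tendsto_ofReal
      apply tendsto_nhdsWithin_of_tendsto_nhds
      exact Continuous.tendsto (by fun_prop) _
    have := ge_of_tendsto ht (by filter_upwards [self_mem_nhdsWithin] with η hη using hlim η hη)
    rwa [add_zero, ENNReal.ofReal_pow ENNReal.toReal_nonneg, ENNReal.ofReal_toReal hfin, ← ENNReal.rpow_natCast] at this
  intro s
  have := h s
  rw [Measure.smul_apply, smul_eq_mul, ENNReal.inv_mul_le_iff hl ENNReal.coe_ne_top] at this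
  simpa using this

theorem geo_sum (t C : ℝ) (ht : 0 ≤ t) (hC : 0 ≤ C) :
    ∑' k : ℕ, (if t ≤ C * (1/2)^k then 4^k * ENNReal.ofReal (t^2) else 0) ≤ ENNReal.ofReal (2 * C^2) := by
  have h4 : ∀ k : ℕ, (4:ℝ≥0∞)^k = ENNReal.ofReal (4^k) := by
    intro k; rw [ENNReal.ofReal_pow (by norm_num)]; simp
  rw [ENNReal.tsum_eq_iSup_nat]
  refine iSup_le fun m => ?_
  have hreal : ∀ m : ℕ, ∑ k ∈ Finset.range m, (if t ≤ C * (1/2)^k then 4^k * t^2 else 0) ≤ 2 * C^2 := by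
    intro m
    induction m with
    | zero => simp; positivity
    | succ m ih =>
      by_cases hm : t ≤ C * (1/2)^m
      · have hs : ∀ m : ℕ, ∑ k ∈ Finset.range m, (4:ℝ)^k * t^2 ≤ 4^m * t^2 := by
          intro m
          induction m with
          | zero => simp; positivity
          | succ m ih => rw [Finset.sum_range_succ, pow_succ (4:ℝ) m]; nlinarith [show 0 ≤ (4:ℝ)^m * t^2 by positivity]
        have h1 : (4:ℝ)^m * t^2 ≤ C^2 := by
          have h2 : (2:ℝ)^m * t ≤ C := by
            calc (2:ℝ)^m * t ≤ 2^m * (C * (1/2)^m) := by gcongr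
              _ = C * (2 * (1/2))^m := by rw [mul_pow]; ring
              _ = C := by norm_num
          calc (4:ℝ)^m * t^2 = (2^m * t)^2 := by rw [mul_pow, ← pow_mul, mul_comm m 2, pow_mul]; norm_num
            _ ≤ C^2 := by gcongr
        rw [Finset.sum_range_succ, if_pos hm]
        have h3 : ∑ k ∈ Finset.range m, (if t ≤ C * (1/2)^k then 4^k * t^2 else 0) ≤ ∑ k ∈ Finset.range m, (4:ℝ)^k * t^2 := by
          apply Finset.sum_le_sum
          intro k _
          split_ifs
          · exact le_rfl
          · positivity
        linarith [hs m]
      · rw [Finset.sum_range_succ, if_neg hm, add_zero]; exact ih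
  calc _ = ENNReal.ofReal (∑ k ∈ Finset.range m, (if t ≤ C * (1/2)^k then 4^k * t^2 else 0)) := by
        rw [ENNReal.ofReal_sum_of_nonneg]
        · refine Finset.sum_congr rfl fun k _ => ?_
          split_ifs
          · rw [h4, ENNReal.ofReal_mul (by positivity)]
          · simp
        · intro k _
          split_ifs <;> positivity
    _ ≤ _ := ENNReal.ofReal_le_ofReal (hreal m)

end dor2

end

section

section propD
variable {n d : ℕ}

theorem half_two_pow (k : ℕ) : ((1/2:ℝ)^k) * 2^k = 1 := by
  rw [← mul_pow]; norm_num

theorem Hd_lip (g : Eu n → Eu d) (L : ℝ≥0) (hg : LipschitzWith L g) (K : ℝ) (hK : 0 < K) (k : ℕ) (u v v' : Eu n) :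
    ‖Hd g K k u v - Hd g K k u v'‖ ≤ (L + n * L) * ‖v - v'‖ := by
  have h1 : Hd g K k u v - Hd g K k u v' = (g v - g v') -
      ∑ i, ((2^k * (v - v') i) / K) • Fd g (K • ev i) k u := by
    unfold Hd Dd
    have e : ∀ w : Eu n, Fd g ((2:ℝ)^k • (w - u)) k u = g w - g u := by
      intro w
      unfold Fd
      rw [smul_smul, half_two_pow, one_smul, add_sub_cancel]
    rw [e, e]
    have : ∀ i : Fin n, ((2^k * (v - v') i) / K) • Fd g (K • ev i) k u =
       (((2:ℝ)^k • (v - u)) i / K) • Fd g (K • ev i) k u - (((2:ℝ)^k • (v' - u)) i / K) • Fd g (K • ev i) k u := by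
      intro i
      rw [← sub_smul]
      congr 1
      simp only [PiLp.smul_apply, PiLp.sub_apply, smul_eq_mul]
      ring
    simp_rw [this, Finset.sum_sub_distrib]
    abel
  rw [h1]
  refine (norm_sub_le _ _).trans ?_
  rw [add_mul]
  gcongr
  · have := hg.dist_le_mul v v'
    rwa [dist_eq_norm, dist_eq_norm] at this
  · refine (norm_sum_le _ _).trans ?_
    calc _ ≤ ∑ i : Fin n, L * ‖v - v'‖ := by
          apply Finset.sum_le_sum
          intro i _
          rw [norm_smul, Real.norm_eq_abs, abs_div, abs_mul, abs_of_pos hK, abs_of_pos (show (0:ℝ) < 2^k by positivity)]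
          have hF : ‖Fd g (K • ev i) k u‖ ≤ L * ((1/2)^k * K) := by
            unfold Fd
            have := hg.dist_le_mul (u + ((1/2:ℝ)^k) • (K • ev i)) u
            rw [dist_eq_norm, dist_eq_norm, add_sub_cancel_left, norm_smul, norm_smul, ev_norm] at this
            simpa [abs_of_pos hK] using this
          calc _ ≤ 2^k * ‖v - v'‖ / K * (L * ((1/2)^k * K)) := by
                gcongr
                exact abs_coord_le _ _
            _ = L * ‖v - v'‖ * (((1/2)^k) * 2^k) := by field_simp
            _ = _ := by rw [half_two_pow, mul_one]
      _ = _ := by simp [mul_assoc]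

/-- normalised ball volume -/
noncomputable def c1 (n : ℕ) : ℝ≥0∞ := (μH[(n:ℝ)] : Measure (Eu n)) (closedBall 0 1)

theorem c1_pos (n : ℕ) : c1 n ≠ 0 := (measure_closedBall_pos _ _ one_pos).ne'
theorem c1_top (n : ℕ) : c1 n ≠ ⊤ := measure_closedBall_lt_top.ne

theorem vol_ball (x : Eu n) (r : ℝ) (hr : 0 ≤ r) :
    (μH[(n:ℝ)] : Measure (Eu n)) (closedBall x r) = ENNReal.ofReal (r^n) * c1 n := by
  rw [Measure.addHaar_closedBall' _ x hr]
  simp [c1]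

theorem Hd_avg (g : Eu n → Eu d) (L : ℝ≥0) (hg : LipschitzWith L g) (K : ℝ) (hK : 0 < K) (k : ℕ) (u v : Eu n)
    (t : ℝ) (ht : 0 < t) :
    sqn (Hd g K k u v) ≤ (ENNReal.ofReal (t^n) * c1 n)⁻¹ * (∫⁻ v' in closedBall v t, 2 * sqn (Hd g K k u v') ∂μH[(n:ℝ)])
      + 2 * ENNReal.ofReal (((L + n * L) * t)^2) := by
  set A := ENNReal.ofReal (t^n) * c1 n with hA
  have hA0 : A ≠ 0 := mul_ne_zero (by simpa using by positivity) (c1_pos n)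
  have hAt : A ≠ ⊤ := ENNReal.mul_ne_top ENNReal.ofReal_ne_top (c1_top n)
  have hvol := vol_ball (n := n) v t ht.le
  have h1 : ∫⁻ v' in closedBall v t, sqn (Hd g K k u v) ∂μH[(n:ℝ)] ≤
      ∫⁻ v' in closedBall v t, (2 * sqn (Hd g K k u v') + 2 * ENNReal.ofReal (((L + n * L) * t)^2)) ∂μH[(n:ℝ)] := by
    apply setLIntegral_mono' measurableSet_closedBall
    intro v' hv'
    have e : Hd g K k u v = Hd g K k u v' + (Hd g K k u v - Hd g K k u v') := by abel
    rw [e]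
    refine (sqn_add_le _ _).trans ?_
    gcongr
    apply sqn_le_of
    refine (Hd_lip g L hg K hK k u v v').trans ?_
    gcongr
    rw [mem_closedBall, dist_comm, dist_eq_norm] at hv'
    exact hv'
  rw [lintegral_add_right _ measurable_const, setLIntegral_const, setLIntegral_const, hvol, ← hA] at h1
  have h2 : sqn (Hd g K k u v) = A⁻¹ * (sqn (Hd g K k u v) * A) := by
    rw [mul_comm (sqn _), ← mul_assoc, ENNReal.inv_mul_cancel hA0 hAt, one_mul]
  rw [h2]
  calc _ ≤ A⁻¹ * (∫⁻ a in closedBall v t, 2 * sqn (Hd g K k u a) ∂μH[(n:ℝ)] + 2 * ENNReal.ofReal (((L + n * L) * t) ^ 2) * A) := by gcongr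
    _ = _ := by
      rw [mul_add, mul_comm _ A, ← mul_assoc A⁻¹ A, ENNReal.inv_mul_cancel hA0 hAt, one_mul]

theorem W_bound (ν : Measure (Eu n)) (G : Set (Eu n)) (hGc : IsClosed G) (hGn : G.Nonempty) (lam : ℝ≥0)
    (hG : ∀ u ∈ G, ∀ r : ℝ, 0 < r → ν (closedBall u r) ≤ lam * ENNReal.ofReal (r^n)) (v' : Eu n) :
    ∫⁻ v in Gᶜ, {v | dist v' v ≤ infDist v G / 4}.indicator
      (fun v => (ENNReal.ofReal ((infDist v G / 4)^n) * c1 n)⁻¹) v ∂ν ≤ lam * ENNReal.ofReal (15^n) * (c1 n)⁻¹ := by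
  have hmeas : MeasurableSet {v | dist v' v ≤ infDist v G / 4} :=
    measurableSet_le (by fun_prop) (by fun_prop)
  by_cases hD : 0 < infDist v' G
  swap
  · have : ∀ v ∈ Gᶜ, {v | dist v' v ≤ infDist v G / 4}.indicator
      (fun v => (ENNReal.ofReal ((infDist v G / 4)^n) * c1 n)⁻¹) v = 0 := by
      intro v hv
      apply indicator_of_notMem
      intro h
      change dist v' v ≤ infDist v G / 4 at h
      have h1 : 0 < infDist v G := (hGc.notMem_iff_infDist_pos hGn).1 hv
      have h2 := infDist_le_infDist_add_dist (s := G) (x := v) (y := v')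
      rw [dist_comm] at h
      linarith
    rw [setLIntegral_congr_fun hGc.measurableSet.compl this]
    simp
  set D := infDist v' G with hDd
  obtain ⟨p, hpG, hp⟩ := (infDist_lt_iff hGn).1 (show infDist v' G < 2 * D by linarith)
  set B : ℝ≥0∞ := (ENNReal.ofReal ((D / 5)^n) * c1 n)⁻¹ with hB
  calc _ ≤ ∫⁻ v in Gᶜ, (closedBall p (3 * D)).indicator (fun _ => B) v ∂ν := by
        apply setLIntegral_mono' hGc.measurableSet.compl
        intro v hv
        by_cases h : dist v' v ≤ infDist v G / 4
        · rw [indicator_of_mem (show v ∈ {v | dist v' v ≤ infDist v G / 4} from h)]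
          have h2 := infDist_le_infDist_add_dist (s := G) (x := v) (y := v')
          have h3 := infDist_le_infDist_add_dist (s := G) (x := v') (y := v)
          have h4 : v ∈ closedBall p (3 * D) := by
            rw [mem_closedBall]
            have := dist_triangle v v' p
            rw [dist_comm v v'] at this h2
            linarith
          rw [indicator_of_mem h4, hB]
          have h5 : D / 5 ≤ infDist v G / 4 := by linarith
          gcongr
        · rw [indicator_of_notMem (show v ∉ {v | dist v' v ≤ infDist v G / 4} from h)]
          exact zero_le
    _ ≤ ∫⁻ v, (closedBall p (3 * D)).indicator (fun _ => B) v ∂ν := setLIntegral_le_lintegral _ _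
    _ = B * ν (closedBall p (3 * D)) := by rw [lintegral_indicator_const measurableSet_closedBall]
    _ ≤ B * (lam * ENNReal.ofReal ((3 * D)^n)) := by gcongr; exact hG p hpG _ (by positivity)
    _ = _ := by
      rw [hB, ENNReal.mul_inv (Or.inr (c1_top n)) (Or.inr (c1_pos n))]
      rw [show (3 * D)^n = (D/5)^n * 15^n by rw [← mul_pow]; congr 1; ring, ENNReal.ofReal_mul (by positivity)]
      have hz : ENNReal.ofReal ((D/5)^n) ≠ 0 := by simpa using by positivity
      calc _ = ((ENNReal.ofReal ((D/5)^n))⁻¹ * ENNReal.ofReal ((D/5)^n)) * (lam * ENNReal.ofReal (15^n) * (c1 n)⁻¹) := by ring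
        _ = _ := by rw [ENNReal.inv_mul_cancel hz ENNReal.ofReal_ne_top, one_mul]


theorem meas_ball (ν : Measure (Eu n)) [SFinite ν] (r : ℝ) (f : Eu n × Eu n → ℝ≥0∞) (hf : Measurable f) :
    Measurable (fun u => ∫⁻ v in closedBall u r, f (u, v) ∂ν) := by
  have hm : MeasurableSet {p : Eu n × Eu n | dist p.2 p.1 ≤ r} := measurableSet_le (by fun_prop) (by fun_prop)
  have : (fun u => ∫⁻ v in closedBall u r, f (u, v) ∂ν) =
      fun u => ∫⁻ v, ({p : Eu n × Eu n | dist p.2 p.1 ≤ r}.indicator f) (u, v) ∂ν := by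
    funext u
    rw [← lintegral_indicator measurableSet_closedBall]
    rfl
  rw [this]
  exact (hf.indicator hm).lintegral_prod_right'

theorem propD_pt (g : Eu n → Eu d) (L : ℝ≥0) (hg : LipschitzWith L g) (K : ℝ) (hK : 0 < K)
    (ν : Measure (Eu n)) [IsFiniteMeasure ν] (G : Set (Eu n)) (hGc : IsClosed G) (lam : ℝ≥0) (hlam : 0 < lam)
    (hG : ∀ u ∈ G, ∀ r : ℝ, 0 < r → ν (closedBall u r) ≤ lam * ENNReal.ofReal (r^n)) (k : ℕ) (u : Eu n) (hu : u ∈ G) :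
    ∫⁻ v in closedBall u (K * (1/2)^k), sqn (Hd g (2*K) k u v) ∂ν ≤
      (lam + 2 * (lam * ENNReal.ofReal (15^n) * (c1 n)⁻¹)) *
        (∫⁻ v in closedBall u ((2 * K) * (1/2)^k), sqn (Hd g (2*K) k u v) ∂μH[(n:ℝ)])
      + ∫⁻ v in closedBall u (K * (1/2)^k), (if infDist v G ≤ K * (1/2)^k then
          2 * ENNReal.ofReal (((L + n * L) * (infDist v G / 4))^2) else 0) ∂ν := by
  have hGn : G.Nonempty := ⟨u, hu⟩
  set r : ℝ := K * (1/2)^k with hr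
  have hr0 : 0 < r := by positivity
  have hf : Measurable (fun v => sqn (Hd g (2*K) k u v)) :=
    sqn_meas ((Hd_cont2 g hg.continuous (2*K) k).comp (Continuous.prodMk_right u)).measurable
  have hrr : (2 * K) * (1/2)^k = 2 * r := by rw [hr]; ring
  rw [hrr]
  have hd : ∀ v ∈ closedBall u r, infDist v G ≤ r := fun v hv => (infDist_le_dist_of_mem hu).trans hv
  rw [← lintegral_inter_add_sdiff (μ := ν) (fun v => sqn (Hd g (2*K) k u v)) (closedBall u r) hGc.measurableSet]
  rw [add_mul, add_assoc]
  gcongr ?_ + ?_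
  · rw [← Measure.restrict_restrict measurableSet_closedBall]
    calc _ ≤ ∫⁻ v in closedBall u r, sqn (Hd g (2*K) k u v) ∂((lam : ℝ≥0∞) • (μH[(n:ℝ)] : Measure (Eu n))) := by
          apply lintegral_mono' _ le_rfl
          exact Measure.restrict_mono le_rfl (restrict_le_haus ν G hGc lam hlam hG)
      _ = lam * ∫⁻ v in closedBall u r, sqn (Hd g (2*K) k u v) ∂μH[(n:ℝ)] := by
          rw [Measure.restrict_smul, lintegral_smul_measure]; rfl
      _ ≤ _ := by
          gcongr
          linarith
  · have hmS : MeasurableSet {p : Eu n × Eu n | dist p.2 p.1 ≤ infDist p.1 G / 4} :=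
      measurableSet_le (by fun_prop) (by fun_prop)
    set Φ : Eu n × Eu n → ℝ≥0∞ := {p : Eu n × Eu n | dist p.2 p.1 ≤ infDist p.1 G / 4}.indicator
      (fun p => (ENNReal.ofReal ((infDist p.1 G / 4)^n) * c1 n)⁻¹ * (2 * sqn (Hd g (2*K) k u p.2))) with hΦ
    have hΦm : Measurable Φ := by
      apply Measurable.indicator _ hmS
      apply Measurable.mul
      · apply Measurable.inv
        apply Measurable.mul_const
        fun_prop
      · exact (hf.comp measurable_snd).const_mul 2
    have hmd : MeasurableSet (closedBall u r \ G) := measurableSet_closedBall.diff hGc.measurableSet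
    calc _ ≤ ∫⁻ v in closedBall u r \ G, ((∫⁻ v' in closedBall u (2 * r), Φ (v, v') ∂μH[(n:ℝ)]) +
           (if infDist v G ≤ r then 2 * ENNReal.ofReal (((L + n * L) * (infDist v G / 4))^2) else 0)) ∂ν := by
          apply setLIntegral_mono' hmd
          intro v hv
          have hpos : 0 < infDist v G := (hGc.notMem_iff_infDist_pos hGn).1 hv.2
          refine (Hd_avg g L hg (2*K) (by positivity) k u v (infDist v G / 4) (by positivity)).trans ?_
          rw [if_pos (hd v hv.1)]
          gcongr
          rw [← lintegral_const_mul _ (hf.const_mul 2), ← lintegral_indicator measurableSet_closedBall,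
            ← lintegral_indicator measurableSet_closedBall]
          apply lintegral_mono
          intro v'
          by_cases h : v' ∈ closedBall v (infDist v G / 4)
          · have h2 : v' ∈ closedBall u (2 * r) := by
              rw [mem_closedBall] at h ⊢
              have := dist_triangle v' v u
              have h3 := hd v hv.1
              have h4 : dist v u ≤ r := hv.1
              linarith
            beta_reduce
            rw [indicator_of_mem h, indicator_of_mem h2, hΦ, indicator_of_mem (by exact h)]
          · beta_reduce
            rw [indicator_of_notMem h]; exact zero_le
      _ = (∫⁻ v in closedBall u r \ G, ∫⁻ v' in closedBall u (2 * r), Φ (v, v') ∂μH[(n:ℝ)] ∂ν) +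
          ∫⁻ v in closedBall u r \ G, (if infDist v G ≤ r then 2 * ENNReal.ofReal (((L + n * L) * (infDist v G / 4))^2) else 0) ∂ν := by
          rw [lintegral_add_left hΦm.lintegral_prod_right']
      _ ≤ _ := by
          gcongr ?_ + ?_
          · rw [lintegral_lintegral_swap (f := fun a b => Φ (a, b)) hΦm.aemeasurable]
            rw [← lintegral_const_mul _ hf]
            apply lintegral_mono
            intro v'
            beta_reduce
            calc _ ≤ ∫⁻ v in Gᶜ, Φ (v, v') ∂ν := by
                  apply lintegral_mono_set
                  exact fun v hv => hv.2
              _ = ∫⁻ v in Gᶜ, {v | dist v' v ≤ infDist v G / 4}.indicator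
                   (fun v => (ENNReal.ofReal ((infDist v G / 4)^n) * c1 n)⁻¹) v * (2 * sqn (Hd g (2*K) k u v')) ∂ν := by
                  refine lintegral_congr fun v => ?_
                  rw [hΦ]
                  by_cases h : dist v' v ≤ infDist v G / 4
                  · rw [indicator_of_mem (by exact h), indicator_of_mem (by exact h)]
                  · rw [indicator_of_notMem (by exact h), indicator_of_notMem (by exact h), zero_mul]
              _ ≤ (lam * ENNReal.ofReal (15^n) * (c1 n)⁻¹) * (2 * sqn (Hd g (2*K) k u v')) := by
                  rw [lintegral_mul_const]
                  · gcongr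
                    exact W_bound ν G hGc hGn lam hG v'
                  · apply Measurable.indicator
                    · apply Measurable.inv
                      apply Measurable.mul_const
                      fun_prop
                    · exact measurableSet_le (by fun_prop) (by fun_prop)
              _ = _ := by ring
          · exact lintegral_mono_set sdiff_subset

theorem propD (g : Eu n → Eu d) (L : ℝ≥0) (hg : LipschitzWith L g) (R : ℝ)
    (hsupp : ∀ u, R ≤ ‖u‖ → g u = 0) (K : ℝ) (hK : 0 < K)
    (ν : Measure (Eu n)) [IsFiniteMeasure ν] (G : Set (Eu n)) (hGc : IsClosed G) (lam : ℝ≥0) (hlam : 0 < lam)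
    (hG : ∀ u ∈ G, ∀ r : ℝ, 0 < r → ν (closedBall u r) ≤ lam * ENNReal.ofReal (r^n)) :
    ∫⁻ u in G, ∑' k : ℕ, (4^k * 2^(k*n)) *
      ∫⁻ v in closedBall u (K * (1/2)^k), sqn (Hd g (2*K) k u v) ∂ν ∂μH[(n:ℝ)] ≠ ⊤ := by
  obtain ⟨C, hC, hDor⟩ := Dor_int g L hg R hsupp (2*K) (by positivity)
  have hf : ∀ k, Measurable (fun p : Eu n × Eu n => sqn (Hd g (2*K) k p.1 p.2)) := fun k =>
    sqn_meas (Hd_cont2 g hg.continuous (2*K) k).measurable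
  rw [lintegral_tsum (fun k => ((meas_ball ν _ _ (hf k)).const_mul _).aemeasurable)]
  set A : ℝ≥0∞ := (lam + 2 * (lam * ENNReal.ofReal (15^n) * (c1 n)⁻¹)) with hA
  have hAt : A ≠ ⊤ := by
    have := c1_pos n
    rw [hA]; finiteness
  set e : ℕ → Eu n → ℝ≥0∞ := fun k v => (if infDist v G ≤ K * (1/2)^k then
          2 * ENNReal.ofReal (((L + n * L) * (infDist v G / 4))^2) else 0) with he
  have hem : ∀ k, Measurable (e k) := fun k =>
    Measurable.ite (measurableSet_le (by fun_prop) (by fun_prop)) (by fun_prop) (by fun_prop)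
  have h1 : ∀ k, ∫⁻ u in G, (4^k * 2^(k*n)) *
      ∫⁻ v in closedBall u (K * (1/2)^k), sqn (Hd g (2*K) k u v) ∂ν ∂μH[(n:ℝ)] ≤
      A * (∫⁻ u, (4^k * 2^(k*n)) *
      ∫⁻ v in closedBall u (2 * K * (1/2)^k), sqn (Hd g (2*K) k u v) ∂μH[(n:ℝ)] ∂μH[(n:ℝ)]) +
      ∫⁻ u, (4^k * 2^(k*n)) * ∫⁻ v in closedBall u (K * (1/2)^k), e k v ∂ν ∂μH[(n:ℝ)] := by
    intro k
    rw [← lintegral_const_mul _ ((meas_ball _ _ _ (hf k)).const_mul _), ← lintegral_add_left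
      (((meas_ball _ _ _ (hf k)).const_mul _).const_mul _)]
    refine le_trans ?_ (setLIntegral_le_lintegral G _)
    apply setLIntegral_mono' hGc.measurableSet
    intro u hu
    rw [mul_left_comm, ← mul_add]
    gcongr
    exact propD_pt g L hg K hK ν G hGc lam hlam hG k u hu
  have h2 : ∀ k, ∫⁻ u, (4^k * 2^(k*n)) * ∫⁻ v in closedBall u (K * (1/2)^k), e k v ∂ν ∂μH[(n:ℝ)] =
      ∫⁻ v, (ENNReal.ofReal (K^n) * c1 n * (2 * ENNReal.ofReal (((L + n * L)/4)^2))) *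
       (if infDist v G ≤ K * (1/2)^k then 4^k * ENNReal.ofReal ((infDist v G)^2) else 0) ∂ν := by
    intro k
    have hm : MeasurableSet {p : Eu n × Eu n | dist p.2 p.1 ≤ K * (1/2)^k} := measurableSet_le (by fun_prop) (by fun_prop)
    have hmm : Measurable ({p : Eu n × Eu n | dist p.2 p.1 ≤ K * (1/2)^k}.indicator (fun p => e k p.2)) :=
      ((hem k).comp measurable_snd).indicator hm
    have : ∀ u, ∫⁻ v in closedBall u (K * (1/2)^k), e k v ∂ν =
       ∫⁻ v, ({p : Eu n × Eu n | dist p.2 p.1 ≤ K * (1/2)^k}.indicator (fun p => e k p.2)) (u, v) ∂ν := by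
      intro u
      rw [← lintegral_indicator measurableSet_closedBall]
      rfl
    simp_rw [this]
    rw [lintegral_const_mul _ hmm.lintegral_prod_right', lintegral_lintegral_swap (f := fun a b => ({p : Eu n × Eu n | dist p.2 p.1 ≤ K * (1/2)^k}.indicator (fun p => e k p.2)) (a, b)) hmm.aemeasurable,
      ← lintegral_const_mul _ hmm.lintegral_prod_left']
    refine lintegral_congr fun v => ?_
    have e2 : ∀ u, ({p : Eu n × Eu n | dist p.2 p.1 ≤ K * (1/2)^k}.indicator (fun p => e k p.2)) (u, v) =
       (closedBall v (K * (1/2)^k)).indicator (fun _ => e k v) u := by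
      intro u
      by_cases h : dist u v ≤ K * (1/2)^k
      · rw [indicator_of_mem (by rw [dist_comm] at h; exact h), indicator_of_mem (by exact h)]
      · rw [indicator_of_notMem (by rw [dist_comm] at h; exact h), indicator_of_notMem (by exact h)]
    simp_rw [e2]
    rw [lintegral_indicator_const measurableSet_closedBall, vol_ball _ _ (by positivity), he]
    beta_reduce
    split_ifs
    · have e3 : (2:ℝ≥0∞)^(k*n) * ENNReal.ofReal ((K * (1/2)^k)^n) = ENNReal.ofReal (K^n) := by
        rw [show (2:ℝ≥0∞)^(k*n) = ENNReal.ofReal (2^(k*n)) by rw [ENNReal.ofReal_pow (by norm_num)]; simp,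
          ← ENNReal.ofReal_mul (by positivity), mul_pow, pow_mul]
        congr 1
        calc _ = K^n * (((1/2)^k) * 2^k)^n := by rw [mul_pow ((1/2:ℝ)^k)]; ring
          _ = _ := by rw [half_two_pow]; simp
      have e4 : ((L + n * L) * (infDist v G / 4))^2 = ((L + n * L)/4)^2 * (infDist v G)^2 := by ring
      rw [e4, ENNReal.ofReal_mul (by positivity)]
      calc _ = ((2:ℝ≥0∞)^(k*n) * ENNReal.ofReal ((K * (1/2)^k)^n)) * 4^k * c1 n *
              (2 * (ENNReal.ofReal (((L + n * L)/4)^2) * ENNReal.ofReal ((infDist v G)^2))) := by ring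
        _ = _ := by rw [e3]; ring
    · simp
  have h3 : ∑' k, ∫⁻ u, (4^k * 2^(k*n)) * ∫⁻ v in closedBall u (K * (1/2)^k), e k v ∂ν ∂μH[(n:ℝ)] ≤
      (ENNReal.ofReal (K^n) * c1 n * (2 * ENNReal.ofReal (((L + n * L)/4)^2))) * (ENNReal.ofReal (2 * K^2) * ν univ) := by
    simp_rw [h2]
    have hmk : ∀ k : ℕ, Measurable (fun v => (if infDist v G ≤ K * (1/2)^k then 4^k * ENNReal.ofReal ((infDist v G)^2) else 0)) :=
      fun k => Measurable.ite (measurableSet_le (by fun_prop) (by fun_prop)) (by fun_prop) (by fun_prop)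
    rw [← lintegral_tsum (fun k => ((hmk k).const_mul _).aemeasurable)]
    simp_rw [ENNReal.tsum_mul_left]
    rw [lintegral_const_mul _ (Measurable.tsum hmk)]
    gcongr
    calc _ ≤ ∫⁻ v, ENNReal.ofReal (2 * K^2) ∂ν := lintegral_mono fun v => geo_sum _ _ infDist_nonneg hK.le
      _ = _ := by simp
  refine ne_top_of_le_ne_top ?_ (ENNReal.tsum_le_tsum h1)
  rw [ENNReal.tsum_add, ENNReal.tsum_mul_left]
  refine ENNReal.add_ne_top.2 ⟨ENNReal.mul_ne_top hAt (ne_top_of_le_ne_top hC hDor), ne_top_of_le_ne_top ?_ h3⟩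
  have := c1_top n
  finiteness

end propD

end

section

section dir1
variable {n d : ℕ}

theorem propD_ae (g : Eu n → Eu d) (L : ℝ≥0) (hg : LipschitzWith L g) (R : ℝ)
    (hsupp : ∀ u, R ≤ ‖u‖ → g u = 0) (K : ℝ) (hK : 0 < K)
    (ν : Measure (Eu n)) [IsFiniteMeasure ν] :
    ∀ᵐ u ∂(μH[(n:ℝ)] : Measure (Eu n)), ∑' k : ℕ, (4^k * 2^(k*n)) *
      ∫⁻ v in closedBall u (K * (1/2)^k), sqn (Hd g (2*K) k u v) ∂ν < ⊤ := by
  set G : ℕ → Set (Eu n) := fun M => {u | ∀ r : ℝ, 0 < r → ν (closedBall u r) ≤ (((M:ℝ≥0) + 1 : ℝ≥0) : ℝ≥0∞) * ENNReal.ofReal (r^n)} with hGdef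
  have hGc : ∀ M, IsClosed (G M) := by
    intro M
    rw [← closure_subset_iff_isClosed]
    intro u hu r hr
    have hlim : ∀ η : ℝ, 0 < η → ν (closedBall u r) ≤ (((M:ℝ≥0) + 1 : ℝ≥0) : ℝ≥0∞) * ENNReal.ofReal ((r + η)^n) := by
      intro η hη
      obtain ⟨w, hw, hwu⟩ := Metric.mem_closure_iff.1 hu η hη
      refine (measure_mono (closedBall_subset_closedBall' ?_)).trans (hw (r + η) (by positivity))
      linarith
    have ht : Tendsto (fun η : ℝ => (((M:ℝ≥0) + 1 : ℝ≥0) : ℝ≥0∞) * ENNReal.ofReal ((r + η)^n)) (nhdsWithin 0 (Ioi 0))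
        (nhds ((((M:ℝ≥0) + 1 : ℝ≥0) : ℝ≥0∞) * ENNReal.ofReal ((r + 0)^n))) := by
      apply ENNReal.Tendsto.const_mul _ (Or.inr ENNReal.coe_ne_top)
      apply ENNReal.tendsto_ofReal
      apply tendsto_nhdsWithin_of_tendsto_nhds
      exact Continuous.tendsto (by fun_prop) _
    have := ge_of_tendsto ht (by filter_upwards [self_mem_nhdsWithin] with η hη using hlim η hη)
    simpa using this
  have hf : ∀ k, Measurable (fun p : Eu n × Eu n => sqn (Hd g (2*K) k p.1 p.2)) := fun k =>
    sqn_meas (Hd_cont2 g hg.continuous (2*K) k).measurable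
  have hmeas : Measurable (fun u => ∑' k : ℕ, (4^k * 2^(k*n)) *
      ∫⁻ v in closedBall u (K * (1/2)^k), sqn (Hd g (2*K) k u v) ∂ν) :=
    Measurable.tsum fun k => (meas_ball ν _ _ (hf k)).const_mul _
  have hall : ∀ M, ∀ᵐ u ∂(μH[(n:ℝ)] : Measure (Eu n)), u ∈ G M → ∑' k : ℕ, (4^k * 2^(k*n)) *
      ∫⁻ v in closedBall u (K * (1/2)^k), sqn (Hd g (2*K) k u v) ∂ν < ⊤ := by
    intro M
    rw [← ae_restrict_iff' (hGc M).measurableSet]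
    exact ae_lt_top hmeas (propD g L hg R hsupp K hK ν (G M) (hGc M) ((M:ℝ≥0) + 1) (by positivity) (fun u hu => hu))
  filter_upwards [ae_all_iff.2 hall, density_fin_ae n n ν] with u hu ⟨N, hN⟩
  obtain ⟨M, hM⟩ := exists_nat_ge (max (N:ℝ) ((ν univ).toReal * ((N:ℝ)+1)^n))
  apply hu M
  intro r hr
  by_cases hrN : r < 1/((N:ℝ)+1)
  · refine (hN r hr hrN).trans ?_
    gcongr
    have : (N:ℝ) ≤ M := (le_max_left _ _).trans hM
    have : N ≤ M := by exact_mod_cast this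
    calc (N:ℝ≥0∞) ≤ M := by exact_mod_cast this
      _ ≤ _ := by push_cast; exact le_self_add
  · push Not at hrN
    have h1 : (ν univ).toReal ≤ ((M:ℝ)+1) * r^n := by
      have h2 : (ν univ).toReal * ((N:ℝ)+1)^n ≤ M := (le_max_right _ _).trans hM
      have h3 : (1/((N:ℝ)+1))^n ≤ r^n := by gcongr
      calc (ν univ).toReal = ((ν univ).toReal * ((N:ℝ)+1)^n) * (1/((N:ℝ)+1))^n := by
            rw [mul_assoc, ← mul_pow, mul_one_div_cancel (by positivity)]; simp
        _ ≤ ((M:ℝ)+1) * r^n := by gcongr; linarith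
    calc ν (closedBall u r) ≤ ν univ := measure_mono (subset_univ _)
      _ = ENNReal.ofReal ((ν univ).toReal) := (ENNReal.ofReal_toReal (measure_ne_top _ _)).symm
      _ ≤ ENNReal.ofReal (((M:ℝ)+1) * r^n) := ENNReal.ofReal_le_ofReal h1
      _ = _ := by
        rw [ENNReal.ofReal_mul (by positivity)]
        congr 1
        rw [ENNReal.ofReal_add (by positivity) (by norm_num)]
        simp

theorem beta_mono (n d : ℕ) (μ : Measure (Eu d)) (x : Eu d) (r R : ℝ) (hr : 0 < r) (h1 : r ≤ R) (h2 : R ≤ 2 * r) :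
    beta2sq n d μ x r ≤ 2^(n+2) * beta2sq n d μ x R := by
  unfold beta2sq
  rw [ENNReal.mul_iInf_of_ne (by simp) (by finiteness)]
  refine iInf_mono fun L => ?_
  rw [ENNReal.div_le_iff (by simpa using by positivity) ENNReal.ofReal_ne_top]
  have hR : 0 < R := by linarith
  have e1 : ∫⁻ y in closedBall x r, ENNReal.ofReal ((infDist y (L.1 : Set (Eu d)) / r) ^ 2) ∂μ ≤
     4 * ∫⁻ y in closedBall x R, ENNReal.ofReal ((infDist y (L.1 : Set (Eu d)) / R) ^ 2) ∂μ := by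
    rw [← lintegral_const_mul _ (by fun_prop)]
    refine (lintegral_mono_set (closedBall_subset_closedBall h1)).trans ?_
    apply lintegral_mono
    intro y
    beta_reduce
    rw [show (4:ℝ≥0∞) = ENNReal.ofReal 4 by simp, ← ENNReal.ofReal_mul (by norm_num)]
    apply ENNReal.ofReal_le_ofReal
    have h3 : infDist y (L.1 : Set (Eu d)) / r ≤ 2 * (infDist y (L.1 : Set (Eu d)) / R) := by
      rw [div_le_iff₀ hr]
      have h4 : infDist y (L.1 : Set (Eu d)) = infDist y (L.1 : Set (Eu d)) / R * R := by field_simp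
      have h5 : 0 ≤ infDist y (L.1 : Set (Eu d)) / R := div_nonneg infDist_nonneg hR.le
      nlinarith
    have h5 : 0 ≤ infDist y (L.1 : Set (Eu d)) / r := div_nonneg infDist_nonneg hr.le
    nlinarith
  refine e1.trans ?_
  set I := ∫⁻ y in closedBall x R, ENNReal.ofReal ((infDist y (L.1 : Set (Eu d)) / R) ^ 2) ∂μ
  have e2 : I = I / ENNReal.ofReal (R^n) * ENNReal.ofReal (R^n) :=
    (ENNReal.div_mul_cancel (by simpa using by positivity) ENNReal.ofReal_ne_top).symm
  have e3 : ENNReal.ofReal (R^n) ≤ 2^n * ENNReal.ofReal (r^n) := by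
    rw [show (2:ℝ≥0∞)^n = ENNReal.ofReal (2^n) by rw [ENNReal.ofReal_pow (by norm_num)]; simp,
      ← ENNReal.ofReal_mul (by positivity), ← mul_pow]
    apply ENNReal.ofReal_le_ofReal
    gcongr
  calc 4 * I = 4 * (I / ENNReal.ofReal (R^n) * ENNReal.ofReal (R^n)) := by rw [← e2]
    _ ≤ 4 * (I / ENNReal.ofReal (R^n) * (2^n * ENNReal.ofReal (r^n))) := by gcongr
    _ = _ := by rw [pow_add]; ring

theorem beta_sum (n d : ℕ) (μ : Measure (Eu d)) (x : Eu d) :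
    ∫⁻ r in Ioo (0:ℝ) 1, beta2sq n d μ x r / ENNReal.ofReal r ≤ 2^(n+2) * ∑' k : ℕ, beta2sq n d μ x ((1/2)^k) := by
  have hsub : Ioo (0:ℝ) 1 ⊆ ⋃ k : ℕ, Ioc ((1/2:ℝ)^(k+1)) ((1/2)^k) := by
    intro r hr
    obtain ⟨k, hk1, hk2⟩ := exists_nat_pow_near_of_lt_one hr.1 hr.2.le (by norm_num : (0:ℝ) < 1/2) (by norm_num)
    exact mem_iUnion.2 ⟨k, hk1, hk2⟩
  refine (lintegral_mono_set hsub).trans ((lintegral_iUnion_le _ _).trans ?_)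
  rw [← ENNReal.tsum_mul_left]
  refine ENNReal.tsum_le_tsum fun k => ?_
  calc _ ≤ ∫⁻ r in Ioc ((1/2:ℝ)^(k+1)) ((1/2)^k), (2^(n+2) * beta2sq n d μ x ((1/2)^k)) / ENNReal.ofReal ((1/2)^(k+1)) := by
        apply setLIntegral_mono' measurableSet_Ioc
        intro r hr
        have h0 : (0:ℝ) < (1/2)^(k+1) := by positivity
        gcongr
        · apply beta_mono n d μ x r ((1/2)^k) (h0.trans hr.1) hr.2
          have := hr.1
          rw [pow_succ] at this
          linarith
        · exact hr.1.le
    _ = _ := by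
      rw [setLIntegral_const, Real.volume_Ioc]
      have : (1/2:ℝ)^k - (1/2)^(k+1) = (1/2)^(k+1) := by rw [pow_succ]; ring
      rw [this, ENNReal.div_mul_cancel (by simpa using by positivity) ENNReal.ofReal_ne_top]

theorem exists_sub (V : Submodule ℝ (Eu d)) (m : ℕ) (h1 : Module.finrank ℝ V ≤ m) (h2 : m ≤ d) :
    ∃ V' : Submodule ℝ (Eu d), V ≤ V' ∧ Module.finrank ℝ V' = m := by
  induction m with
  | zero => exact ⟨V, le_rfl, by omega⟩
  | succ m ih =>
    by_cases h : Module.finrank ℝ V = m + 1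
    · exact ⟨V, le_rfl, h⟩
    obtain ⟨W, hW1, hW2⟩ := ih (by omega) (by omega)
    have hlt : W < ⊤ := by
      rw [lt_top_iff_ne_top]
      rintro rfl
      simp at hW2
      omega
    obtain ⟨x, -, hx⟩ := SetLike.exists_of_lt hlt
    refine ⟨W ⊔ Submodule.span ℝ {x}, hW1.trans le_sup_left, ?_⟩
    have h3 := Submodule.finrank_sup_add_finrank_inf_eq W (Submodule.span ℝ {x})
    have h4 := finrank_span_le_card (R := ℝ) ({x} : Set (Eu d))
    simp at h4
    have h5 : W < W ⊔ Submodule.span ℝ {x} := by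
      refine lt_of_le_of_ne le_sup_left fun he => hx ?_
      rw [he]
      exact Submodule.mem_sup_right (Submodule.mem_span_singleton_self x)
    have h6 := Submodule.finrank_lt_finrank_of_lt h5
    omega

end dir1

end

section

section dir1b
variable {n d : ℕ}

theorem T1_ae (μ : Measure (Eu d)) [IsFiniteMeasure μ] (s : Eu d → Eu n) (hs : Measurable s) (Y : Eu d → ℝ)
    (hY : Measurable Y) (hY0 : ∀ y, 0 ≤ Y y) (K C : ℝ) (hK : 0 < K) (hC : 0 < C) :
    ∀ᵐ u ∂(μH[(n:ℝ)] : Measure (Eu n)), ∑' k : ℕ, (4^k * 2^(k*n)) *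
      ∫⁻ y in {y | dist (s y) u ≤ K * (1/2)^k}, (if Y y ≤ C * (1/2)^k then ENNReal.ofReal ((Y y)^2) else 0) ∂μ < ⊤ := by
  set e : ℕ → Eu d → ℝ≥0∞ := fun k y => (if Y y ≤ C * (1/2)^k then ENNReal.ofReal ((Y y)^2) else 0) with he
  have hem : ∀ k, Measurable (e k) := fun k =>
    Measurable.ite (measurableSet_le (by fun_prop) (by fun_prop)) (by fun_prop) (by fun_prop)
  set Φ : ℕ → Eu n × Eu d → ℝ≥0∞ := fun k => {p : Eu n × Eu d | dist (s p.2) p.1 ≤ K * (1/2)^k}.indicator (fun p => e k p.2) with hΦ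
  have hΦm : ∀ k, Measurable (Φ k) := fun k => by
    apply ((hem k).comp measurable_snd).indicator
    exact measurableSet_le (by fun_prop) (by fun_prop)
  have hm1 : ∀ (k : ℕ) (u : Eu n), MeasurableSet {y | dist (s y) u ≤ K * (1/2)^k} := fun k u =>
    measurableSet_le (by fun_prop) (by fun_prop)
  have h1 : ∀ (k : ℕ) (u : Eu n), ∫⁻ y in {y | dist (s y) u ≤ K * (1/2)^k}, e k y ∂μ = ∫⁻ y, Φ k (u, y) ∂μ := by
    intro k u
    rw [← lintegral_indicator (hm1 k u)]
    rfl
  have hmk : ∀ k, Measurable (fun u => ∫⁻ y, Φ k (u, y) ∂μ) := fun k => (hΦm k).lintegral_prod_right'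
  have goal : ∀ᵐ u ∂(μH[(n:ℝ)] : Measure (Eu n)), ∑' k : ℕ, (4^k * 2^(k*n)) * ∫⁻ y, Φ k (u, y) ∂μ < ⊤ := by
    apply ae_lt_top (Measurable.tsum fun k => (hmk k).const_mul _)
    rw [lintegral_tsum (fun k => ((hmk k).const_mul _).aemeasurable)]
    have h2 : ∀ k : ℕ, ∫⁻ u, (4^k * 2^(k*n)) * ∫⁻ y, Φ k (u, y) ∂μ ∂(μH[(n:ℝ)] : Measure (Eu n)) =
        ∫⁻ y, (ENNReal.ofReal (K^n) * c1 n) * (if Y y ≤ C * (1/2)^k then 4^k * ENNReal.ofReal ((Y y)^2) else 0) ∂μ := by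
      intro k
      rw [lintegral_const_mul _ (hmk k), lintegral_lintegral_swap (f := fun a b => Φ k (a, b)) (hΦm k).aemeasurable,
        ← lintegral_const_mul _ (hΦm k).lintegral_prod_left']
      refine lintegral_congr fun y => ?_
      have e2 : ∀ u, Φ k (u, y) = (closedBall (s y) (K * (1/2)^k)).indicator (fun _ => e k y) u := by
        intro u
        by_cases h : dist u (s y) ≤ K * (1/2)^k
        · rw [hΦ, indicator_of_mem (by exact h)]; exact indicator_of_mem (by rw [dist_comm] at h; exact h) _
        · rw [hΦ, indicator_of_notMem (by exact h)]; exact indicator_of_notMem (by rw [dist_comm] at h; exact h) _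
      simp_rw [e2]
      rw [lintegral_indicator_const measurableSet_closedBall, vol_ball _ _ (by positivity), he]
      beta_reduce
      split_ifs
      · have e3 : (2:ℝ≥0∞)^(k*n) * ENNReal.ofReal ((K * (1/2)^k)^n) = ENNReal.ofReal (K^n) := by
          rw [show (2:ℝ≥0∞)^(k*n) = ENNReal.ofReal (2^(k*n)) by rw [ENNReal.ofReal_pow (by norm_num)]; simp,
            ← ENNReal.ofReal_mul (by positivity), mul_pow, pow_mul]
          congr 1
          calc _ = K^n * (((1/2)^k) * 2^k)^n := by rw [mul_pow ((1/2:ℝ)^k)]; ring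
            _ = _ := by rw [half_two_pow]; simp
        calc _ = ((2:ℝ≥0∞)^(k*n) * ENNReal.ofReal ((K * (1/2)^k)^n)) * 4^k * c1 n * ENNReal.ofReal ((Y y)^2) := by ring
          _ = _ := by rw [e3]; ring
      · simp
    simp_rw [h2]
    have hmk2 : ∀ k : ℕ, Measurable (fun y => (if Y y ≤ C * (1/2)^k then 4^k * ENNReal.ofReal ((Y y)^2) else 0)) :=
      fun k => Measurable.ite (measurableSet_le (by fun_prop) (by fun_prop)) (by fun_prop) (by fun_prop)
    rw [← lintegral_tsum (fun k => ((hmk2 k).const_mul _).aemeasurable)]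
    simp_rw [ENNReal.tsum_mul_left]
    rw [lintegral_const_mul _ (Measurable.tsum hmk2)]
    have : ∫⁻ y, ∑' k : ℕ, (if Y y ≤ C * (1/2)^k then 4^k * ENNReal.ofReal ((Y y)^2) else 0) ∂μ ≤ ENNReal.ofReal (2 * C^2) * μ univ := by
      calc _ ≤ ∫⁻ v, ENNReal.ofReal (2 * C^2) ∂μ := lintegral_mono fun v => geo_sum _ _ (hY0 v) hC.le
        _ = _ := by simp
    have h3 : ENNReal.ofReal (2 * C^2) * μ univ ≠ ⊤ := by finiteness
    exact ENNReal.mul_ne_top (ENNReal.mul_ne_top ENNReal.ofReal_ne_top (c1_top n)) (ne_top_of_le_ne_top h3 this)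
  filter_upwards [goal] with u hu
  refine lt_of_eq_of_lt ?_ hu
  refine tsum_congr fun k => ?_
  rw [← h1]

theorem D1_piece (hnd : n ≤ d) (μ : Measure (Eu d)) [IsFiniteMeasure μ] (g : Eu n → Eu d) (L : ℝ≥0)
    (hg : LipschitzWith L g) (R : ℝ) (hsupp : ∀ u, R ≤ ‖u‖ → g u = 0) (S : Set (Eu n)) (c : ℝ≥0)
    (hS : ∀ u ∈ S, ∀ v ∈ S, dist u v ≤ c * dist (g u) (g v)) :
    ∀ᵐ u ∂(μH[(n:ℝ)] : Measure (Eu n)), u ∈ S →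
      ∫⁻ r in Ioo (0:ℝ) 1, beta2sq n d μ (g u) r / ENNReal.ofReal r < ⊤ := by
  -- Lipschitz left inverse
  have hinj : InjOn g S := by
    intro u hu v hv h
    have := hS u hu v hv
    rw [h, dist_self, mul_zero] at this
    exact dist_le_zero.1 this
  have hLs : LipschitzOnWith c (Function.invFunOn g S) (g '' S) := by
    apply LipschitzOnWith.of_dist_le_mul
    rintro _ ⟨u, hu, rfl⟩ _ ⟨v, hv, rfl⟩
    rw [hinj.leftInvOn_invFunOn hu, hinj.leftInvOn_invFunOn hv]
    exact hS u hu v hv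
  obtain ⟨s, hsL, hse⟩ := hLs.extend_finite_dimension
  set Ls : ℝ≥0 := lipschitzExtensionConstant (Eu n) * c with hLsd
  have hsu : ∀ u ∈ S, s (g u) = u := by
    intro u hu
    rw [← hse (mem_image_of_mem g hu), hinj.leftInvOn_invFunOn hu]
  set K : ℝ := Ls + 1 with hKd
  have hK : 0 < K := by positivity
  set C : ℝ := 1 + L * Ls with hCd
  have hC : 0 < C := by positivity
  set Y : Eu d → ℝ := fun y => ‖y - g (s y)‖ with hYd
  have hYm : Measurable Y := by
    have : Continuous Y := by
      have h1 := hg.continuous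
      have h2 := hsL.continuous
      fun_prop
    exact this.measurable
  have hsm : Measurable s := hsL.continuous.measurable
  filter_upwards [T1_ae (n := n) μ s hsm Y hYm (fun y => norm_nonneg _) K C hK hC,
    propD_ae g L hg R hsupp K hK (μ.map s)] with u hT1 hT2 huS
  refine (beta_sum n d μ (g u)).trans_lt ?_
  refine ENNReal.mul_lt_top (by finiteness) ?_
  have key : ∀ k : ℕ, beta2sq n d μ (g u) ((1/2)^k) ≤
      2 * ((4^k * 2^(k*n)) *
      ∫⁻ y in {y | dist (s y) u ≤ K * (1/2)^k}, (if Y y ≤ C * (1/2)^k then ENNReal.ofReal ((Y y)^2) else 0) ∂μ) +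
      2 * ((4^k * 2^(k*n)) * ∫⁻ v in closedBall u (K * (1/2)^k), sqn (Hd g (2*K) k u v) ∂(μ.map s)) := by
    intro k
    set t : ℝ := (1/2)^k with ht
    have ht0 : 0 < t := by positivity
    -- the plane
    obtain ⟨V, hV1, hV2⟩ := exists_sub (d := d) (Submodule.span ℝ (range fun i : Fin n => Fd g ((2*K) • ev i) k u)) n
      ((finrank_range_le_card (R := ℝ) _).trans (by simp)) hnd
    set Lp : AffineSubspace ℝ (Eu d) := AffineSubspace.mk' (g u) V with hLp
    have hLd : Module.finrank ℝ Lp.direction = n := by rw [hLp, AffineSubspace.direction_mk', hV2]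
    have hmem : ∀ v : Eu n, g v - Hd g (2*K) k u v ∈ Lp := by
      intro v
      rw [hLp, AffineSubspace.mem_mk']
      have : g v - Hd g (2*K) k u v -ᵥ g u = ∑ i, ((((2:ℝ)^k) • (v - u)) i / (2*K)) • Fd g ((2*K) • ev i) k u := by
        unfold Hd Dd
        have e : Fd g ((2:ℝ)^k • (v - u)) k u = g v - g u := by
          unfold Fd
          rw [smul_smul, half_two_pow, one_smul, add_sub_cancel]
        rw [e, vsub_eq_sub]
        abel
      rw [this]
      exact Submodule.sum_mem _ fun i _ => Submodule.smul_mem _ _ (hV1 (Submodule.subset_span ⟨i, rfl⟩))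
    have hdist : ∀ y, ENNReal.ofReal ((infDist y (Lp : Set (Eu d)))^2) ≤
        2 * ENNReal.ofReal ((Y y)^2) + 2 * sqn (Hd g (2*K) k u (s y)) := by
      intro y
      have h1 : infDist y (Lp : Set (Eu d)) ≤ ‖(y - g (s y)) + Hd g (2*K) k u (s y)‖ := by
        refine (infDist_le_dist_of_mem (hmem (s y))).trans_eq ?_
        rw [dist_eq_norm]
        congr 1
        abel
      calc _ ≤ sqn ((y - g (s y)) + Hd g (2*K) k u (s y)) := by
            unfold sqn
            have := infDist_nonneg (x := y) (s := (Lp : Set (Eu d)))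
            gcongr
        _ ≤ _ := sqn_add_le _ _
    have hHm : Measurable (fun v => sqn (Hd g (2*K) k u v)) :=
      sqn_meas ((Hd_cont2 g hg.continuous (2*K) k).comp (Continuous.prodMk_right u)).measurable
    have hin : ∀ y ∈ closedBall (g u) t, dist (s y) u ≤ K * t ∧ Y y ≤ C * t := by
      intro y hy
      rw [mem_closedBall] at hy
      have h1 : dist (s y) u ≤ Ls * dist y (g u) := by
        have := hsL.dist_le_mul y (g u)
        rwa [hsu u huS] at this
      constructor
      · calc _ ≤ _ := h1
          _ ≤ K * t := by rw [hKd]; gcongr; linarith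
      · rw [hYd]
        beta_reduce
        rw [← dist_eq_norm]
        calc _ ≤ dist y (g u) + dist (g u) (g (s y)) := dist_triangle _ _ _
          _ ≤ t + L * (Ls * t) := by
              gcongr
              refine (hg.dist_le_mul _ _).trans ?_
              rw [dist_comm]
              gcongr
              exact h1.trans (by gcongr)
          _ = C * t := by rw [hCd]; ring
    calc beta2sq n d μ (g u) t ≤ (∫⁻ y in closedBall (g u) t,
          ENNReal.ofReal ((infDist y (Lp : Set (Eu d)) / t) ^ 2) ∂μ) / ENNReal.ofReal (t ^ n) := by
          unfold beta2sq
          exact iInf_le_of_le ⟨Lp, hLd⟩ le_rfl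
      _ = (4^k * 2^(k*n)) * ∫⁻ y in closedBall (g u) t, ENNReal.ofReal ((infDist y (Lp : Set (Eu d))) ^ 2) ∂μ := by
          have e1 : ∀ y, ENNReal.ofReal ((infDist y (Lp : Set (Eu d)) / t) ^ 2) = 4^k * ENNReal.ofReal ((infDist y (Lp : Set (Eu d))) ^ 2) := by
            intro y
            rw [show (4:ℝ≥0∞)^k = ENNReal.ofReal (4^k) by rw [ENNReal.ofReal_pow (by norm_num)]; simp,
              ← ENNReal.ofReal_mul (by positivity)]
            congr 1
            have : (4:ℝ)^k = (t⁻¹)^2 := by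
              rw [ht, ← inv_pow, ← pow_mul, mul_comm k 2, pow_mul]; norm_num
            rw [this, div_eq_mul_inv, mul_pow]
            ring
          simp_rw [e1]
          rw [lintegral_const_mul _ (by fun_prop), ENNReal.div_eq_inv_mul]
          have : (ENNReal.ofReal (t^n))⁻¹ = 2^(k*n) := by
            rw [← ENNReal.ofReal_inv_of_pos (by positivity), ht, ← pow_mul, ← inv_pow, ENNReal.ofReal_pow (by norm_num)]
            norm_num
          rw [this]; ring
      _ ≤ (4^k * 2^(k*n)) * ∫⁻ y in closedBall (g u) t, (2 * (if Y y ≤ C * t then ENNReal.ofReal ((Y y)^2) else 0) +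
            2 * sqn (Hd g (2*K) k u (s y))) ∂μ := by
          refine mul_le_mul_right ?_ _
          apply setLIntegral_mono' measurableSet_closedBall
          intro y hy
          rw [if_pos (hin y hy).2]
          exact hdist y
      _ ≤ (4^k * 2^(k*n)) * ∫⁻ y in {y | dist (s y) u ≤ K * t}, (2 * (if Y y ≤ C * t then ENNReal.ofReal ((Y y)^2) else 0) +
            2 * sqn (Hd g (2*K) k u (s y))) ∂μ := by
          refine mul_le_mul_right ?_ _
          exact lintegral_mono_set fun y hy => (hin y hy).1
      _ = _ := by
          have hm : Measurable (fun y => (if Y y ≤ C * t then ENNReal.ofReal ((Y y)^2) else 0)) :=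
            Measurable.ite (measurableSet_le (by fun_prop) (by fun_prop)) (by fun_prop) (by fun_prop)
          rw [lintegral_add_left (hm.const_mul 2), lintegral_const_mul _ hm, lintegral_const_mul 2 (show Measurable (fun y => sqn (Hd g (2*K) k u (s y))) from hHm.comp hsm)]
          rw [setLIntegral_map measurableSet_closedBall hHm hsm]
          have : s ⁻¹' closedBall u (K * t) = {y | dist (s y) u ≤ K * t} := rfl
          rw [this]
          ring
  refine (ENNReal.tsum_le_tsum key).trans_lt ?_
  rw [ENNReal.tsum_add, ENNReal.tsum_mul_left, ENNReal.tsum_mul_left]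
  exact ENNReal.add_lt_top.2 ⟨ENNReal.mul_lt_top (by simp) hT1, ENNReal.mul_lt_top (by simp) hT2⟩

theorem cpt_ext (f : Eu n → Eu d) (K : ℝ≥0) (hf : LipschitzWith K f) (R : ℕ) :
    ∃ (g : Eu n → Eu d) (L : ℝ≥0), LipschitzWith L g ∧ (∀ u, ((R:ℝ)+1) ≤ ‖u‖ → g u = 0) ∧ ∀ u, ‖u‖ ≤ R → g u = f u := by
  classical
  set M : ℝ≥0 := ‖f 0‖₊ + K * R with hM
  have hMb : ∀ u : Eu n, ‖u‖ ≤ R → ‖f u‖ ≤ M := by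
    intro u hu
    have := hf.dist_le_mul u 0
    rw [dist_eq_norm, dist_zero_right] at this
    have h2 : f u = (f u - f 0) + f 0 := by abel
    rw [h2]
    refine (norm_add_le _ _).trans ?_
    rw [hM]; push_cast
    have h3 : (K:ℝ) * ‖u‖ ≤ K * R := by gcongr
    linarith
  set h : Eu n → Eu d := fun u => if ‖u‖ ≤ R then f u else 0 with hh
  have hL : LipschitzOnWith (K + M) h {u | ‖u‖ ≤ R ∨ (R:ℝ)+1 ≤ ‖u‖} := by
    apply LipschitzOnWith.of_dist_le_mul
    have hmix : ∀ u v : Eu n, ‖u‖ ≤ R → (R:ℝ)+1 ≤ ‖v‖ → dist (h u) (h v) ≤ ((K + M : ℝ≥0):ℝ) * dist u v := by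
      intro u v hu hv
      rw [hh]; beta_reduce
      rw [if_pos hu, if_neg (by linarith), dist_zero_right]
      have h1 : 1 ≤ dist u v := by
        have := norm_sub_norm_le v u
        rw [dist_comm, dist_eq_norm]; linarith
      calc ‖f u‖ ≤ M * 1 := by rw [mul_one]; exact hMb u hu
        _ ≤ _ := by gcongr; push_cast; simp
    rintro u (hu | hu) v (hv | hv)
    · rw [hh]; beta_reduce
      rw [if_pos hu, if_pos hv]
      refine (hf.dist_le_mul u v).trans ?_
      gcongr; simp
    · exact hmix u v hu hv
    · rw [dist_comm, dist_comm u v]; exact hmix v u hv hu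
    · rw [hh]; beta_reduce
      rw [if_neg (by linarith), if_neg (by linarith), dist_self]
      positivity
  obtain ⟨g, hg, hge⟩ := hL.extend_finite_dimension
  refine ⟨g, _, hg, fun u hu => ?_, fun u hu => ?_⟩
  · rw [← hge (Or.inr hu), hh]; beta_reduce
    rw [if_neg (by linarith)]
  · rw [← hge (Or.inl hu), hh]; beta_reduce
    rw [if_pos hu]

theorem dir1 (hnd : n ≤ d) (E : Set (Eu d)) (hE : MeasurableSet E) (hfin : μH[(n:ℝ)] E < ⊤)
    (f : ℕ → Eu n → Eu d) (hf : ∀ i, ∃ K : ℝ≥0, LipschitzWith K (f i))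
    (h0 : μH[(n:ℝ)] (E \ ⋃ i, range (f i)) = 0) :
    ∀ᵐ x ∂((μH[(n:ℝ)] : Measure (Eu d)).restrict E),
        (∫⁻ r in Set.Ioo (0 : ℝ) 1, beta2sq n d (μH[(n:ℝ)].restrict E) x r / ENNReal.ofReal r) < ⊤ := by
  set μ : Measure (Eu d) := (μH[(n:ℝ)] : Measure (Eu d)).restrict E with hμ
  haveI : IsFiniteMeasure μ := ⟨by rw [hμ, Measure.restrict_apply_univ]; exact hfin⟩
  set P : Eu d → Prop := fun x => (∫⁻ r in Set.Ioo (0 : ℝ) 1, beta2sq n d μ x r / ENNReal.ofReal r) < ⊤ with hP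
  have hrange : ∀ i, (μH[(n:ℝ)] : Measure (Eu d)) {x | x ∈ range (f i) ∧ ¬ P x} = 0 := by
    intro i
    obtain ⟨K, hK⟩ := hf i
    choose g L hgL hgs hge using cpt_ext (f i) K hK
    have hR : ∀ R : ℕ, (μH[(n:ℝ)] : Measure (Eu d)) {x | x ∈ range (g R) ∧ ¬ P x} = 0 := by
      intro R
      obtain ⟨S, hS, hS0⟩ := bilip_decomp n d (g R) (L R) (hgL R)
      have hpc : ∀ j, (μH[(n:ℝ)] : Measure (Eu d)) (g R '' {u | ¬ (u ∈ S j → P (g R u))}) = 0 := by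
        intro j
        obtain ⟨c, hc⟩ := hS j
        have := D1_piece hnd μ (g R) (L R) (hgL R) _ (hgs R) (S j) c hc
        rw [ae_iff] at this
        have h2 := (hgL R).hausdorffMeasure_image_le (d := (n:ℝ)) (by positivity) {u | ¬ (u ∈ S j → P (g R u))}
        rw [this, mul_zero] at h2
        exact le_antisymm h2 zero_le
      refine measure_mono_null (t := (range (g R) \ ⋃ j, g R '' S j) ∪ ⋃ j, (g R '' {u | ¬ (u ∈ S j → P (g R u))})) ?_
        (measure_union_null hS0 (measure_iUnion_null hpc))
      rintro x ⟨hx, hPx⟩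
      by_cases hxS : x ∈ ⋃ j, g R '' S j
      · obtain ⟨j, u, hu, rfl⟩ := mem_iUnion.1 hxS
        refine Or.inr (mem_iUnion.2 ⟨j, u, ?_, rfl⟩)
        exact fun h => hPx (h hu)
      · exact Or.inl ⟨hx, hxS⟩
    refine measure_mono_null (t := ⋃ R, {x | x ∈ range (g R) ∧ ¬ P x}) ?_ (measure_iUnion_null hR)
    rintro x ⟨⟨u, rfl⟩, hx⟩
    obtain ⟨R, hRu⟩ := exists_nat_ge ‖u‖
    exact mem_iUnion.2 ⟨R, ⟨u, hge R u hRu⟩, hx⟩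
  rw [hμ, ae_restrict_iff' hE, ae_iff]
  refine measure_mono_null (t := (E \ ⋃ i, range (f i)) ∪ ⋃ i, {x | x ∈ range (f i) ∧ ¬ P x}) ?_
    (measure_union_null h0 (measure_iUnion_null hrange))
  intro x hx
  have hx' : ¬ (x ∈ E → P x) := hx
  push Not at hx'
  by_cases h : x ∈ ⋃ i, range (f i)
  · obtain ⟨i, hi⟩ := mem_iUnion.1 h
    exact Or.inr (mem_iUnion.2 ⟨i, hi, hx'.2⟩)
  · exact Or.inl ⟨hx'.1, h⟩

end dir1b

end

section

/-- Vitali-type covering lemma on projected balls. -/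
theorem lemV {n d : ℕ} (m : Measure (Eu d)) (P : Eu d → Eu n) (S : Set (Eu d))
    (r : Eu d → ℝ) (R : ℝ) (hr : ∀ x ∈ S, 0 < r x ∧ r x ≤ R) (φ : Eu n → ℝ≥0∞)
    (h : ∀ x0 ∈ S, ∃ c : ℝ≥0∞,
      m (S ∩ {x | ‖P x - P x0‖ ≤ 3 * r x0 ∧ r x ≤ 2 * r x0})
        ≤ c * μH[(n : ℝ)] (closedBall (P x0) (r x0)) ∧
      ∀ p ∈ closedBall (P x0) (r x0), c ≤ φ p) :
    m S ≤ ∫⁻ p, φ p ∂μH[(n : ℝ)] := by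
  obtain ⟨u, huS, hdis, hcov⟩ := Vitali.exists_disjoint_subfamily_covering_enlargement
    (fun x : Eu d => closedBall (P x) (r x)) S r 2 (by norm_num) (fun x hx => (hr x hx).1.le)
    R (fun x hx => (hr x hx).2) (fun x hx => ⟨P x, mem_closedBall_self (hr x hx).1.le⟩)
  have hcount : u.Countable := by
    apply hdis.countable_of_nonempty_interior
    intro x hx
    refine ⟨P x, ?_⟩
    exact ball_subset_interior_closedBall (mem_ball_self (hr x (huS hx)).1)
  have hsub : S ⊆ ⋃ x0 ∈ u, (S ∩ {x | ‖P x - P x0‖ ≤ 3 * r x0 ∧ r x ≤ 2 * r x0}) := by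
    intro x hx
    obtain ⟨b, hb, ⟨q, hq1, hq2⟩, hle⟩ := hcov x hx
    refine mem_iUnion₂.2 ⟨b, hb, hx, ?_, hle⟩
    have h1 : dist q (P x) ≤ r x := hq1
    have h2 : dist q (P b) ≤ r b := hq2
    have h3 := dist_triangle_left (P x) (P b) q
    rw [← dist_eq_norm]
    linarith
  calc m S ≤ m (⋃ x0 ∈ u, (S ∩ {x | ‖P x - P x0‖ ≤ 3 * r x0 ∧ r x ≤ 2 * r x0})) :=
        measure_mono hsub
    _ ≤ ∑' x0 : u, m (S ∩ {x | ‖P x - P x0‖ ≤ 3 * r x0 ∧ r x ≤ 2 * r x0}) :=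
        measure_biUnion_le m hcount _
    _ ≤ ∑' x0 : u, ∫⁻ p in closedBall (P x0) (r x0), φ p ∂μH[(n : ℝ)] := by
        refine ENNReal.tsum_le_tsum fun x0 => ?_
        obtain ⟨c, h1, h2⟩ := h x0 (huS x0.2)
        refine h1.trans ?_
        rw [← setLIntegral_const]
        exact setLIntegral_mono' isClosed_closedBall.measurableSet fun p hp => h2 p hp
    _ = ∫⁻ p in ⋃ x0 ∈ u, closedBall (P x0) (r x0), φ p ∂μH[(n : ℝ)] := by
        rw [lintegral_biUnion hcount (fun x _ => isClosed_closedBall.measurableSet) hdis]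
    _ ≤ _ := setLIntegral_le_lintegral _ _

/-- Packing lemma. -/
theorem packing (d : ℕ) (ρ : ℝ) (hρ : 0 < ρ) : ∃ N : ℕ, ∀ (m : Measure (Eu d)) (S : Set (Eu d))
    (x : Eu d) (R : ℝ) (A : ℝ≥0∞), 0 < R → S ⊆ closedBall x R →
    (∀ y ∈ S, m (closedBall y (ρ * R)) ≤ A) → m S ≤ N * A := by
  obtain ⟨t, -, htf, ht⟩ := (isCompact_closedBall (0 : Eu d) 1).finite_cover_balls
    (e := ρ / 2) (by positivity)
  refine ⟨htf.toFinset.card, fun m S x R A hR hS hA => ?_⟩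
  have hsub : S ⊆ ⋃ c ∈ htf.toFinset, (S ∩ closedBall (x + R • c) (ρ / 2 * R)) := by
    intro y hy
    have h1 : R⁻¹ • (y - x) ∈ closedBall (0 : Eu d) 1 := by
      have := hS hy
      rw [mem_closedBall, dist_eq_norm] at this
      rw [mem_closedBall_zero_iff, norm_smul, Real.norm_of_nonneg (by positivity)]
      rw [inv_mul_le_iff₀ hR]; simpa using this
    obtain ⟨c, hc, hyc⟩ := mem_iUnion₂.1 (ht h1)
    refine mem_iUnion₂.2 ⟨c, by simpa using hc, hy, ?_⟩
    rw [mem_ball, dist_eq_norm] at hyc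
    rw [mem_closedBall, dist_eq_norm]
    have : y - (x + R • c) = R • (R⁻¹ • (y - x) - c) := by
      rw [smul_sub, smul_smul, mul_inv_cancel₀ hR.ne', one_smul]; abel
    rw [this, norm_smul, Real.norm_of_nonneg hR.le, mul_comm]
    gcongr
  calc m S ≤ m (⋃ c ∈ htf.toFinset, (S ∩ closedBall (x + R • c) (ρ / 2 * R))) := measure_mono hsub
    _ ≤ ∑ c ∈ htf.toFinset, m (S ∩ closedBall (x + R • c) (ρ / 2 * R)) :=
        measure_biUnion_finset_le _ _
    _ ≤ ∑ c ∈ htf.toFinset, A := by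
        refine Finset.sum_le_sum fun c _ => ?_
        by_cases hne : (S ∩ closedBall (x + R • c) (ρ / 2 * R)).Nonempty
        · obtain ⟨y, hy, hyc⟩ := hne
          refine (measure_mono ?_).trans (hA y hy)
          intro z hz
          have h1 := hz.2
          rw [mem_closedBall] at h1 hyc ⊢
          have := dist_triangle_right z y (x + R • c)
          linarith
        · rw [not_nonempty_iff_eq_empty.1 hne]; simp
    _ = _ := by simp

/-- The data of the main proposition of direction 2. -/
structure Cfg (n d : ℕ) (lam eps : ℝ) where
  m : Measure (Eu d)
  F : Set (Eu d)
  P : Eu d →L[ℝ] Eu n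
  io : Eu n →L[ℝ] Eu d
  hP : ∀ x, ‖P x‖ ≤ ‖x‖
  hio : ∀ p, ‖io p‖ = ‖p‖
  hPi : ∀ p, P (io p) = p
  HF : ∀ S, MeasurableSet S → m S = m (F ∩ S)
  H1 : ∀ x ∈ F, ∀ r : ℝ, 0 < r → r ≤ 1 → m (closedBall x r) ≤ ENNReal.ofReal (lam * r ^ n)
  L : Eu d → ℕ → AffineSubspace ℝ (Eu d)
  hL : ∀ x ∈ F, ∀ k, Module.finrank ℝ (L x k).direction = n
  b : Eu d → ℕ → ℝ
  hb0 : ∀ x k, 0 ≤ b x k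
  hbs : ∀ x ∈ F, ∀ N, ∑ k ∈ Finset.range N, b x k ^ 2 ≤ eps
  H2 : ∀ x ∈ F, ∀ k, ∀ s : ℝ, 0 < s →
    m {y | y ∈ closedBall x ((1 / 2 : ℝ) ^ k) ∧ s < infDist y (L x k : Set (Eu d))} ≤
      ENNReal.ofReal (b x k ^ 2 * ((1 / 2 : ℝ) ^ k) ^ (n + 2) / s ^ 2)
  c : Eu d
  hc : P c = 0
  H3 : ∀ s : ℝ, 0 < s →
    m {y | y ∈ closedBall 0 2 ∧ s < ‖y - (c + io (P y))‖} ≤ ENNReal.ofReal (eps / s ^ 2)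
  H4 : ENNReal.ofReal (((1 / 2 : ℝ) ^ 16) ^ n / 2) ≤ m (closedBall 0 ((1 / 2 : ℝ) ^ 16))

/-- Evaluate the affine map with data `a`. -/
def ap {n d : ℕ} (a : Eu d × (Eu n →L[ℝ] Eu d)) (p : Eu n) : Eu d := a.1 + a.2 p

theorem ap_sub {n d : ℕ} (a : Eu d × (Eu n →L[ℝ] Eu d)) (p q : Eu n) :
    ap a p - ap a q = a.2 (p - q) := by
  simp [ap]

theorem ap_cont {n d : ℕ} (a : Eu d × (Eu n →L[ℝ] Eu d)) : Continuous (ap a) := by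
  unfold ap; fun_prop

namespace Cfg

variable {n d : ℕ} {lam eps : ℝ} (C : Cfg n d lam eps)

/-- Weak `L²` closeness of the measure to the graph of `a`. -/
def W (x : Eu d) (t : ℝ) (a : Eu d × (Eu n →L[ℝ] Eu d)) (b : ℝ) : Prop :=
  ∀ s : ℝ, 0 < s → C.m {y | y ∈ closedBall x t ∧ s < ‖y - ap a (C.P y)‖} ≤
    ENNReal.ofReal (b ^ 2 * t ^ (n + 2) / s ^ 2)

/-- `a` is a section of `P`. -/
def Sec (a : Eu d × (Eu n →L[ℝ] Eu d)) : Prop := C.P a.1 = 0 ∧ ∀ p, C.P (a.2 p) = p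

/-- slope of `a`. -/
noncomputable def sl (a : Eu d × (Eu n →L[ℝ] Eu d)) : ℝ := ‖a.2 - C.io‖

theorem io_norm : ‖C.io‖ ≤ 1 :=
  C.io.opNorm_le_bound zero_le_one fun p => by rw [C.hio, one_mul]

theorem norm_of_sl {a : Eu d × (Eu n →L[ℝ] Eu d)} {s : ℝ} (h : C.sl a ≤ s) : ‖a.2‖ ≤ 1 + s := by
  have h1 : a.2 = C.io + (a.2 - C.io) := by abel
  rw [h1]
  refine (norm_add_le _ _).trans ?_
  exact add_le_add C.io_norm h

theorem P_norm : ‖C.P‖ ≤ 1 :=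
  C.P.opNorm_le_bound zero_le_one fun p => by rw [one_mul]; exact C.hP p

theorem W_mono {x x' : Eu d} {t t' : ℝ} {a : Eu d × (Eu n →L[ℝ] Eu d)} {b b' : ℝ}
    (h : C.W x t a b) (hsub : closedBall x' t' ⊆ closedBall x t)
    (hb : b ^ 2 * t ^ (n + 2) ≤ b' ^ 2 * t' ^ (n + 2)) : C.W x' t' a b' := by
  intro s hs
  refine (measure_mono ?_).trans ((h s hs).trans ?_)
  · intro y hy; exact ⟨hsub hy.1, hy.2⟩
  · gcongr

theorem hpm (a : Eu d × (Eu n →L[ℝ] Eu d)) : Continuous (fun y => ap a (C.P y)) :=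
  (ap_cont a).comp C.P.continuous

end Cfg

end

section

namespace Cfg

variable {n d : ℕ} {lam eps : ℝ} (C : Cfg n d lam eps)

theorem slab_vol (A : Set (Eu n)) (hA : MeasurableSet A) (x : Eu n) (N : ℕ) (hN : 0 < N) (t S : ℝ)
    (ht : 0 < t) (hS : 0 < S)
    (D : Eu n →L[ℝ] Eu d) (D0 : Eu d) (e : Eu n) (he : ‖e‖ < 1) (hDe : S / (4 * t) < ‖D e‖)
    (hAx : A ⊆ closedBall x (2 * t))
    (hAD : ∀ p ∈ A, ‖D0 + D p‖ ≤ 2 * (1 / (17 * N)) * S) :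
    N * μH[(n : ℝ)] A ≤ ENNReal.ofReal ((3 * t) ^ n) * c1 n := by
  have hN' : (0 : ℝ) < N := by exact_mod_cast hN
  set η : ℝ := t / N with hη
  have hη0 : 0 < η := by positivity
  set T : ℕ → Set (Eu n) := fun i => (fun p => p + -((i * η) • e)) ⁻¹' A with hT
  have hdis : ((Finset.range N : Finset ℕ) : Set ℕ).PairwiseDisjoint T := by
    intro i _ j _ hij
    rw [Function.onFun, Set.disjoint_left]
    intro p hpi hpj
    have h1 := hAD _ hpi
    have h2 := hAD _ hpj
    have h3 : ((j : ℝ) * η - i * η) • D e =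
        (D0 + D (p + -((i * η) • e))) - (D0 + D (p + -((j * η) • e))) := by
      simp only [map_add, map_neg, map_smul]; module
    have h4 : ‖((j : ℝ) * η - i * η) • D e‖ ≤ 4 * (1 / (17 * N)) * S := by
      rw [h3]; refine (norm_sub_le _ _).trans ?_; linarith
    rw [norm_smul, ← sub_mul, norm_mul, Real.norm_of_nonneg hη0.le] at h4
    have h5 : (1 : ℝ) ≤ ‖(j : ℝ) - i‖ := by
      have : (1 : ℤ) ≤ |(j : ℤ) - i| := Int.one_le_abs (by omega)
      rw [Real.norm_eq_abs]; exact_mod_cast this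
    have h6 : η * (S / (4 * t)) < 4 * (1 / (17 * N)) * S := by
      refine lt_of_lt_of_le ?_ h4
      calc η * (S / (4 * t)) < η * ‖D e‖ := by gcongr
        _ ≤ ‖(j : ℝ) - i‖ * η * ‖D e‖ := by
          gcongr; exact le_mul_of_one_le_left hη0.le h5
    have h7 : η * (S / (4 * t)) = (1 / 4) * (S / N) := by rw [hη]; field_simp
    have h8 : 4 * (1 / (17 * (N : ℝ))) * S = (4 / 17) * (S / N) := by field_simp
    rw [h7, h8] at h6
    have : 0 < S / N := by positivity
    linarith
  have hTm : ∀ i, MeasurableSet (T i) := fun i => (measurable_add_const _) hA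
  have hTv : ∀ i, μH[(n : ℝ)] (T i) = μH[(n : ℝ)] A := fun i => measure_preimage_add_right _ _ _
  have hsub : (⋃ i ∈ Finset.range N, T i) ⊆ closedBall x (3 * t) := by
    intro p hp
    obtain ⟨i, hi, hp⟩ := mem_iUnion₂.1 hp
    have h1 := hAx hp
    rw [mem_closedBall, dist_eq_norm] at h1 ⊢
    have h2 : p - x = (p + -((i * η) • e) - x) + (i * η) • e := by module
    rw [h2]
    refine (norm_add_le _ _).trans ?_
    have h3 : ‖((i : ℝ) * η) • e‖ ≤ t := by
      rw [norm_smul, Real.norm_of_nonneg (by positivity)]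
      have hi' : (i : ℝ) ≤ N := by exact_mod_cast (Finset.mem_range.1 hi).le
      calc (i : ℝ) * η * ‖e‖ ≤ N * η * 1 := by gcongr
        _ = t := by rw [hη]; field_simp
    linarith
  calc N * μH[(n : ℝ)] A = ∑ i ∈ Finset.range N, μH[(n : ℝ)] (T i) := by simp [hTv]
    _ = μH[(n : ℝ)] (⋃ i ∈ Finset.range N, T i) :=
        (measure_biUnion_finset hdis fun i _ => hTm i).symm
    _ ≤ μH[(n : ℝ)] (closedBall x (3 * t)) := measure_mono hsub
    _ = _ := vol_ball _ _ (by positivity)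

theorem slab (hlam : 0 ≤ lam) (x : Eu d) (t : ℝ) (ht : 0 < t) (ht2 : t ≤ 2) (N : ℕ) (hN : 0 < N)
    (a D : Eu d × (Eu n →L[ℝ] Eu d)) (ha : ‖a.2‖ ≤ 2) (S : ℝ) (hS : 0 < S)
    (hSe : S = ‖ap D (C.P x)‖ + ‖D.2‖ * t) :
    C.m {y | y ∈ closedBall x t ∧ ‖y - ap a (C.P y)‖ ≤ 1 / (17 * N) * t ∧
      ‖ap D (C.P y)‖ ≤ 1 / (17 * N) * S} ≤ ENNReal.ofReal (lam * 30 ^ n * t ^ n / N) := by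
  have hN' : (1 : ℝ) ≤ N := by exact_mod_cast hN
  have hN0 : (0 : ℝ) < N := by linarith
  set ρ : ℝ := 1 / (17 * N) with hρ
  have hρ0 : 0 < ρ := by positivity
  have hρ1 : ρ ≤ 1 / 17 := by
    rw [hρ]; apply one_div_le_one_div_of_le <;> linarith
  set Y := {y | y ∈ closedBall x t ∧ ‖y - ap a (C.P y)‖ ≤ ρ * t ∧ ‖ap D (C.P y)‖ ≤ ρ * S} with hY
  have hYm : MeasurableSet Y := by
    apply MeasurableSet.inter isClosed_closedBall.measurableSet
    apply MeasurableSet.inter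
    · exact (isClosed_le ((continuous_id.sub (C.hpm a)).norm) continuous_const).measurableSet
    · exact (isClosed_le ((C.hpm D).norm) continuous_const).measurableSet
  have hPx : ∀ y ∈ Y, ‖C.P y - C.P x‖ ≤ t := by
    intro y hy
    rw [← map_sub]; refine (C.hP _).trans ?_
    rw [← dist_eq_norm]; exact hy.1
  by_cases hcase : ‖D.2‖ * t ≤ S / 4
  · have : Y = ∅ := by
      rw [eq_empty_iff_forall_notMem]
      intro y hy
      have h1 := hPx y hy
      have h2 := ap_sub D (C.P y) (C.P x)
      have h3 : ‖ap D (C.P x)‖ ≤ ‖ap D (C.P y)‖ + ‖D.2 (C.P y - C.P x)‖ := by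
        rw [← h2]; have := norm_sub_le (ap D (C.P y)) (ap D (C.P y) - ap D (C.P x))
        simpa using this
      have h4 : ‖D.2 (C.P y - C.P x)‖ ≤ ‖D.2‖ * t :=
        (D.2.le_opNorm _).trans (by gcongr)
      have h5 := hy.2.2
      nlinarith
    rw [this]; simp
  · push Not at hcase
    obtain ⟨e, he, hDe⟩ := D.2.exists_lt_apply_of_lt_opNorm (r := S / (4 * t)) (by
      rw [div_lt_iff₀ (by positivity)]; linarith)
    set A := Metric.thickening (ρ * t) (C.P '' Y) with hA
    have hAm : MeasurableSet A := isOpen_thickening.measurableSet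
    have hvA := slab_vol (n := n) (d := d) A hAm (C.P x) N hN t S ht hS D.2 D.1 e he hDe (by
      intro p hp
      obtain ⟨q, ⟨y, hy, rfl⟩, hq⟩ := Metric.mem_thickening_iff.1 hp
      have := hPx y hy
      rw [← dist_eq_norm] at this
      rw [mem_closedBall]
      have h3 := dist_triangle p (C.P y) (C.P x)
      nlinarith) (by
      intro p hp
      obtain ⟨q, ⟨y, hy, rfl⟩, hq⟩ := Metric.mem_thickening_iff.1 hp
      have h2 := ap_sub D p (C.P y)
      change ‖ap D p‖ ≤ 2 * ρ * S
      have h3 : ‖ap D p‖ ≤ ‖ap D (C.P y)‖ + ‖D.2 (p - C.P y)‖ := by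
        rw [← h2]; have := norm_add_le (ap D (C.P y)) (ap D p - ap D (C.P y))
        simpa using this
      have h4 : ‖D.2 (p - C.P y)‖ ≤ ‖D.2‖ * (ρ * t) :=
        (D.2.le_opNorm _).trans (by rw [dist_eq_norm] at hq; gcongr)
      have h5 := hy.2.2
      have h6 : ‖D.2‖ * t ≤ S := by rw [hSe]; linarith [norm_nonneg (ap D (C.P x))]
      nlinarith)
    set κ : ℝ≥0∞ := ENNReal.ofReal (lam * 10 ^ n) / c1 n with hκ
    have hV := lemV C.m (fun y => C.P y) (C.F ∩ Y) (fun _ => ρ * t / 2) (ρ * t / 2)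
      (fun _ _ => ⟨by positivity, le_rfl⟩) (A.indicator fun _ => κ) (by
      rintro x0 ⟨hx0F, hx0⟩
      refine ⟨κ, ?_, ?_⟩
      · rw [vol_ball _ _ (by positivity)]
        calc C.m _ ≤ C.m (closedBall x0 (5 * ρ * t)) := by
              apply measure_mono
              rintro y ⟨⟨-, hy⟩, hy1, -⟩
              rw [mem_closedBall, dist_eq_norm]
              have h1 : y - x0 = (y - ap a (C.P y)) - (x0 - ap a (C.P x0))
                  + a.2 (C.P y - C.P x0) := by rw [← ap_sub]; abel
              have h2 : ‖a.2 (C.P y - C.P x0)‖ ≤ 2 * (3 * (ρ * t / 2)) :=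
                (a.2.le_opNorm _).trans (by gcongr)
              have h3 := hy.2.1
              have h4 := hx0.2.1
              have h5 := norm_add_le ((y - ap a (C.P y)) - (x0 - ap a (C.P x0)))
                (a.2 (C.P y - C.P x0))
              have h6 := norm_sub_le (y - ap a (C.P y)) (x0 - ap a (C.P x0))
              rw [h1]; linarith
          _ ≤ ENNReal.ofReal (lam * (5 * ρ * t) ^ n) :=
              C.H1 x0 hx0F _ (by positivity) (by nlinarith)
          _ = κ * (ENNReal.ofReal ((ρ * t / 2) ^ n) * c1 n) := by
              rw [hκ, mul_comm (ENNReal.ofReal ((ρ * t / 2) ^ n)), ← mul_assoc,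
                ENNReal.div_mul_cancel (c1_pos n) (c1_top n),
                ← ENNReal.ofReal_mul (by positivity)]
              congr 1
              rw [mul_assoc lam (10 ^ n), ← mul_pow]; congr 2; ring
      · intro p hp
        have : p ∈ A := by
          refine Metric.mem_thickening_iff.2 ⟨C.P x0, ⟨x0, hx0, rfl⟩, ?_⟩
          rw [mem_closedBall] at hp
          have : 0 < ρ * t := by positivity
          linarith
        rw [indicator_of_mem this])
    rw [C.HF Y hYm]
    refine hV.trans ?_
    rw [lintegral_indicator hAm, setLIntegral_const]
    have hNt : (N : ℝ≥0∞) ≠ ⊤ := by simp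
    have hN00 : (N : ℝ≥0∞) ≠ 0 := by exact_mod_cast hN.ne'
    have hvA' : μH[(n : ℝ)] A ≤ ENNReal.ofReal ((3 * t) ^ n) * c1 n / N := by
      rw [ENNReal.le_div_iff_mul_le (Or.inl hN00) (Or.inl hNt), mul_comm]; exact hvA
    calc κ * μH[(n : ℝ)] A ≤ κ * (ENNReal.ofReal ((3 * t) ^ n) * c1 n / N) :=
          mul_le_mul_right hvA' _
      _ = κ * c1 n * (ENNReal.ofReal ((3 * t) ^ n) / N) := by
          simp only [div_eq_mul_inv]; ring
      _ = _ := by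
          rw [hκ, ENNReal.div_mul_cancel (c1_pos n) (c1_top n),
            ← ENNReal.ofReal_natCast, ← ENNReal.ofReal_div_of_pos hN0,
            ← ENNReal.ofReal_mul (by positivity)]
          congr 1
          rw [show (30 : ℝ) = 10 * 3 by norm_num, mul_pow, mul_pow]; ring


theorem compare (n : ℕ) (lam δ : ℝ) (hlam : 0 ≤ lam) (hδ : 0 < δ) :
    ∃ K b0 : ℝ, 0 < K ∧ 0 < b0 ∧ ∀ (d : ℕ) (eps : ℝ) (C : Cfg n d lam eps) (x : Eu d) (t : ℝ)
      (a a' : Eu d × (Eu n →L[ℝ] Eu d)) (b b' : ℝ), 0 < t → t ≤ 2 → ‖a.2‖ ≤ 2 →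
      C.W x t a b → C.W x t a' b' → ENNReal.ofReal (δ * t ^ n) ≤ C.m (closedBall x t) →
      0 ≤ b → b ≤ b0 → 0 ≤ b' →
      ‖ap a (C.P x) - ap a' (C.P x)‖ + ‖a.2 - a'.2‖ * t ≤ K * (b + b') * t := by
  obtain ⟨N, hN⟩ := exists_nat_gt (4 * lam * 30 ^ n / δ)
  have hN0 : (0 : ℝ) < N := lt_of_le_of_lt (by positivity) hN
  have hNp : 0 < N := by exact_mod_cast hN0
  set ρ : ℝ := 1 / (17 * N) with hρ
  have hρ0 : 0 < ρ := by positivity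
  refine ⟨Real.sqrt (8 / δ) / ρ, Real.sqrt (δ / 4) * ρ, by positivity, by positivity, ?_⟩
  intro d eps C x t a a' b b' ht ht2 ha hW hW' hm hb hb0 hb'
  set D : Eu d × (Eu n →L[ℝ] Eu d) := (a.1 - a'.1, a.2 - a'.2) with hD
  have hapD : ∀ p, ap D p = ap a p - ap a' p := fun p => by simp [ap, hD]; abel
  set S : ℝ := ‖ap D (C.P x)‖ + ‖D.2‖ * t with hS
  have hgoal : ‖ap a (C.P x) - ap a' (C.P x)‖ + ‖a.2 - a'.2‖ * t = S := by
    rw [hS, hapD]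
  rw [hgoal]
  have hS0 : 0 ≤ S := by positivity
  rcases hS0.eq_or_lt with h0 | hSp
  · rw [← h0]; positivity
  have hsl := C.slab hlam x t ht ht2 N hNp a D ha S hSp hS
  have h1 := hW (ρ * t) (by positivity)
  have h2 := hW (ρ * S / 2) (by positivity)
  have h3 := hW' (ρ * S / 2) (by positivity)
  have hcov : closedBall x t ⊆
      ({y | y ∈ closedBall x t ∧ ‖y - ap a (C.P y)‖ ≤ ρ * t ∧ ‖ap D (C.P y)‖ ≤ ρ * S} ∪
      {y | y ∈ closedBall x t ∧ ρ * t < ‖y - ap a (C.P y)‖}) ∪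
      ({y | y ∈ closedBall x t ∧ ρ * S / 2 < ‖y - ap a (C.P y)‖} ∪
      {y | y ∈ closedBall x t ∧ ρ * S / 2 < ‖y - ap a' (C.P y)‖}) := by
    intro y hy
    by_cases c1 : ρ * t < ‖y - ap a (C.P y)‖
    · exact Or.inl (Or.inr ⟨hy, c1⟩)
    by_cases c2 : ρ * S / 2 < ‖y - ap a (C.P y)‖
    · exact Or.inr (Or.inl ⟨hy, c2⟩)
    by_cases c3 : ρ * S / 2 < ‖y - ap a' (C.P y)‖
    · exact Or.inr (Or.inr ⟨hy, c3⟩)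
    push Not at c1 c2 c3
    refine Or.inl (Or.inl ⟨hy, c1, ?_⟩)
    have : ap D (C.P y) = (y - ap a' (C.P y)) - (y - ap a (C.P y)) := by rw [hapD]; abel
    rw [this]; refine (norm_sub_le _ _).trans ?_; linarith
  have hsum : ENNReal.ofReal (δ * t ^ n) ≤ ENNReal.ofReal (lam * 30 ^ n * t ^ n / N +
      b ^ 2 * t ^ (n + 2) / (ρ * t) ^ 2 + (b ^ 2 * t ^ (n + 2) / (ρ * S / 2) ^ 2 +
      b' ^ 2 * t ^ (n + 2) / (ρ * S / 2) ^ 2)) := by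
    rw [ENNReal.ofReal_add (by positivity) (by positivity),
      ENNReal.ofReal_add (by positivity) (by positivity),
      ENNReal.ofReal_add (by positivity) (by positivity)]
    refine hm.trans ((measure_mono hcov).trans ?_)
    refine (measure_union_le _ _).trans (add_le_add ?_ ?_)
    · exact (measure_union_le _ _).trans (add_le_add hsl h1)
    · exact (measure_union_le _ _).trans (add_le_add h2 h3)
  rw [ENNReal.ofReal_le_ofReal_iff (by positivity)] at hsum
  have e1 : lam * 30 ^ n * t ^ n / N ≤ δ / 4 * t ^ n := by
    rw [div_lt_iff₀ hδ] at hN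
    rw [div_le_iff₀ hN0]
    have : 0 < t ^ n := by positivity
    nlinarith
  have e2 : b ^ 2 * t ^ (n + 2) / (ρ * t) ^ 2 ≤ δ / 4 * t ^ n := by
    have hb2 : b ^ 2 ≤ δ / 4 * ρ ^ 2 := by
      calc b ^ 2 ≤ (Real.sqrt (δ / 4) * ρ) ^ 2 := by gcongr
        _ = δ / 4 * ρ ^ 2 := by rw [mul_pow, Real.sq_sqrt (by positivity)]
    rw [div_le_iff₀ (by positivity)]
    calc b ^ 2 * t ^ (n + 2) ≤ δ / 4 * ρ ^ 2 * t ^ (n + 2) := by gcongr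
      _ = _ := by ring
  have e3 : (b ^ 2 * t ^ (n + 2) / (ρ * S / 2) ^ 2 +
      b' ^ 2 * t ^ (n + 2) / (ρ * S / 2) ^ 2) ≤ (b + b') ^ 2 * t ^ (n + 2) * 4 / (ρ ^ 2 * S ^ 2) := by
    rw [← add_div, ← add_mul]
    calc (b ^ 2 + b' ^ 2) * t ^ (n + 2) / (ρ * S / 2) ^ 2
        = (b ^ 2 + b' ^ 2) * t ^ (n + 2) * 4 / (ρ ^ 2 * S ^ 2) := by field_simp; ring
      _ ≤ _ := by gcongr; nlinarith
  have e4 : δ / 2 * t ^ n ≤ (b + b') ^ 2 * t ^ (n + 2) * 4 / (ρ ^ 2 * S ^ 2) := by linarith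
  rw [le_div_iff₀ (by positivity)] at e4
  have e5 : S ^ 2 ≤ (Real.sqrt (8 / δ) / ρ * (b + b') * t) ^ 2 := by
    rw [mul_pow, mul_pow, div_pow, Real.sq_sqrt (by positivity)]
    have htn : 0 < t ^ n := by positivity
    have e6 : δ / 2 * (ρ ^ 2 * S ^ 2) ≤ (b + b') ^ 2 * t ^ 2 * 4 := by
      refine le_of_mul_le_mul_left ?_ htn
      calc t ^ n * (δ / 2 * (ρ ^ 2 * S ^ 2)) = δ / 2 * t ^ n * (ρ ^ 2 * S ^ 2) := by ring
        _ ≤ _ := e4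
        _ = _ := by ring
    rw [show 8 / δ / ρ ^ 2 * (b + b') ^ 2 * t ^ 2 = (8 * ((b + b') ^ 2 * t ^ 2)) / (δ * ρ ^ 2) by
      field_simp]
    rw [le_div_iff₀ (by positivity)]
    nlinarith
  exact le_of_sq_le_sq e5 (by positivity)

end Cfg

end

section

theorem graph_lin {n d : ℕ} (P : Eu d →L[ℝ] Eu n) (hP : ‖P‖ ≤ 1) (T T2 : Eu n →L[ℝ] Eu d)
    (hPT : ∀ p, P (T p) = p) (hT : ‖T‖ ≤ 2) (V : Submodule ℝ (Eu d))
    (hV : Module.finrank ℝ V = n) (hT2 : ∀ p, T2 p ∈ V) (η : ℝ) (hη : η ≤ 1 / 6)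
    (hTT : ‖T2 - T‖ ≤ η) :
    ∃ T' : Eu n →L[ℝ] Eu d, (∀ p, T' p ∈ V) ∧ (∀ p, P (T' p) = p) ∧ ‖T' - T‖ ≤ 4 * η ∧
      ‖T'‖ ≤ 3 ∧ ∀ v ∈ V, T' (P v) = v := by
  have hη0 : 0 ≤ η := (norm_nonneg _).trans hTT
  set Q : Eu n →L[ℝ] Eu n := P.comp T2 with hQ
  have hPT' : P.comp T = 1 := by ext p; simp [hPT]
  have h1Q : ‖1 - Q‖ ≤ η := by
    have : 1 - Q = P.comp (T - T2) := by rw [ContinuousLinearMap.comp_sub, hPT', hQ]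
    rw [this]
    refine (ContinuousLinearMap.opNorm_comp_le _ _).trans ?_
    rw [norm_sub_rev]
    calc ‖P‖ * ‖T2 - T‖ ≤ 1 * η := by gcongr
      _ = η := one_mul _
  set u := Units.oneSub (1 - Q) (by linarith) with hu
  have huQ : (u : Eu n →L[ℝ] Eu n) = Q := by rw [hu, Units.val_oneSub]; abel
  set R : Eu n →L[ℝ] Eu n := ((u⁻¹ : (Eu n →L[ℝ] Eu n)ˣ) : Eu n →L[ℝ] Eu n) with hR
  have hQR : Q * R = 1 := by rw [← huQ, hR]; exact u.mul_inv
  have hRn : ‖R‖ ≤ 6 / 5 := by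
    have h1 : R = 1 + (1 - Q) * R := by rw [sub_mul, hQR]; simp
    have h2 : ‖R‖ ≤ ‖(1 : Eu n →L[ℝ] Eu n)‖ + ‖(1 - Q) * R‖ := by
      conv_lhs => rw [h1]
      exact norm_add_le _ _
    have h3 : ‖(1 : Eu n →L[ℝ] Eu n)‖ ≤ 1 := ContinuousLinearMap.norm_id_le
    have h4 : ‖(1 - Q) * R‖ ≤ 1 / 6 * ‖R‖ := (norm_mul_le _ _).trans (by gcongr; linarith)
    linarith
  have hT2n : ‖T2‖ ≤ 2 + η := by
    have := norm_add_le T (T2 - T); simp at this; linarith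
  refine ⟨T2.comp R, fun p => hT2 _, ?_, ?_, ?_, ?_⟩
  · intro p
    have := congrArg (fun f : Eu n →L[ℝ] Eu n => f p) hQR
    simpa [hQ] using this
  · have h1 : T2.comp R - T = ((T2 - T) + T.comp (1 - Q)).comp R := by
      have h2 : (T.comp (1 - Q)).comp R = T.comp R - T := by
        have : (1 - Q).comp R = R - 1 := by
          change (1 - Q) * R = R - 1
          rw [sub_mul, hQR, one_mul]
        rw [ContinuousLinearMap.comp_assoc, this]; ext p; simp
      rw [ContinuousLinearMap.add_comp, h2, ContinuousLinearMap.sub_comp]; abel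
    rw [h1]
    refine (ContinuousLinearMap.opNorm_comp_le _ _).trans ?_
    have h3 : ‖(T2 - T) + T.comp (1 - Q)‖ ≤ η + 2 * η := by
      refine (norm_add_le _ _).trans (add_le_add hTT ?_)
      refine (ContinuousLinearMap.opNorm_comp_le _ _).trans ?_
      gcongr
    calc _ ≤ (η + 2 * η) * (6 / 5) := by gcongr
      _ ≤ 4 * η := by linarith
  · refine (ContinuousLinearMap.opNorm_comp_le _ _).trans ?_
    calc ‖T2‖ * ‖R‖ ≤ (2 + 1 / 6) * (6 / 5) := by gcongr; linarith
      _ ≤ 3 := by norm_num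
  · have hid : ∀ p, P (T2.comp R p) = p := by
      intro p
      have := congrArg (fun f : Eu n →L[ℝ] Eu n => f p) hQR
      simpa [hQ] using this
    have hinj : Function.Injective (T2.comp R : Eu n →ₗ[ℝ] Eu d) := by
      intro p q hpq
      have := congrArg P hpq
      simp only [ContinuousLinearMap.coe_coe] at this
      rwa [hid, hid] at this
    have hr : LinearMap.range (T2.comp R : Eu n →ₗ[ℝ] Eu d) = V := by
      apply Submodule.eq_of_le_of_finrank_eq
      · rintro _ ⟨p, rfl⟩; exact hT2 _
      · rw [LinearMap.finrank_range_of_inj hinj, hV]; simp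
    intro v hv
    rw [← hr] at hv
    obtain ⟨p, rfl⟩ := hv
    simp only [ContinuousLinearMap.coe_coe]
    rw [hid]

/-- Projection onto an affine plane through `q0` with direction `V`. -/
theorem plane_dist {d : ℕ} (L : AffineSubspace ℝ (Eu d)) (q0 : Eu d) (hq : q0 ∈ L) (y : Eu d) :
    ‖y - (q0 + L.direction.starProjection (y - q0))‖ ≤ infDist y (L : Set (Eu d)) := by
  rw [Metric.infDist_eq_iInf]
  have : Nonempty (L : Set (Eu d)) := ⟨⟨q0, hq⟩⟩
  refine le_ciInf fun q => ?_
  obtain ⟨q, hqL⟩ := q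
  have hv : q - q0 ∈ L.direction := AffineSubspace.vsub_mem_direction hqL hq
  have h1 : y - (q0 + L.direction.starProjection (y - q0)) =
      L.directionᗮ.starProjection (y - q) := by
    rw [Submodule.starProjection_orthogonal']
    have h2 : L.direction.starProjection (q - q0) = q - q0 :=
      Submodule.starProjection_eq_self_iff.2 hv
    have h3 : y - q0 = (y - q) + (q - q0) := by abel
    rw [h3, map_add, h2]
    simp
    abel
  rw [h1, dist_eq_norm]
  refine (ContinuousLinearMap.le_opNorm _ _).trans ?_
  calc _ ≤ 1 * ‖y - q‖ := by gcongr; exact Submodule.starProjection_norm_le _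
    _ = _ := one_mul _

namespace Cfg

theorem graph (n : ℕ) (hn : 0 < n) (lam δ : ℝ) (hlam : 0 ≤ lam) (hδ : 0 < δ) :
    ∃ K b0 : ℝ, 0 < K ∧ 0 < b0 ∧ ∀ (d : ℕ) (eps : ℝ) (C : Cfg n d lam eps) (x : Eu d) (t : ℝ)
      (a : Eu d × (Eu n →L[ℝ] Eu d)) (L : AffineSubspace ℝ (Eu d)) (b b' : ℝ), 0 < t → t ≤ 2 →
      C.Sec a → ‖a.2‖ ≤ 2 →
      C.W x t a b → Module.finrank ℝ L.direction = n →
      (∀ s : ℝ, 0 < s → C.m {y | y ∈ closedBall x t ∧ s < infDist y (L : Set (Eu d))} ≤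
        ENNReal.ofReal (b' ^ 2 * t ^ (n + 2) / s ^ 2)) →
      ENNReal.ofReal (δ * t ^ n) ≤ C.m (closedBall x t) →
      0 ≤ b → b ≤ b0 → 0 ≤ b' → b' ≤ b0 →
      ∃ a', C.Sec a' ∧ C.W x t a' (4 * b') ∧ ‖a'.2 - a.2‖ ≤ K * (b + b') := by
  obtain ⟨K, b0, hK, hb0, hcmp⟩ := compare n lam δ hlam hδ
  refine ⟨12 * K, min b0 (1 / (36 * K)), by positivity, by positivity, ?_⟩
  intro d eps C x t a L b b' ht ht2 hsec ha hW hL hLd hm hb hbb hb' hbb'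
  have hLne : ∃ q, q ∈ L := by
    by_contra h
    push Not at h
    have : L = ⊥ := by
      ext q; exact iff_of_false (h q) (AffineSubspace.notMem_bot ℝ _ q)
    rw [this, AffineSubspace.direction_bot, finrank_bot] at hL
    omega
  obtain ⟨q0, hq0⟩ := hLne
  set V := L.direction with hV
  set Q := V.starProjection with hQ
  set a2 : Eu d × (Eu n →L[ℝ] Eu d) := (q0 + Q (a.1 - q0), Q.comp a.2) with ha2
  have hap2 : ∀ p, ap a2 p = q0 + Q (ap a p - q0) := by
    intro p; simp only [ap, ha2, ContinuousLinearMap.comp_apply]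
    rw [show a.1 + a.2 p - q0 = (a.1 - q0) + a.2 p by abel, map_add]; abel
  have hQn : ∀ v, ‖Q v‖ ≤ ‖v‖ := fun v => (Q.le_opNorm v).trans (by
    calc ‖Q‖ * ‖v‖ ≤ 1 * ‖v‖ := by gcongr; exact Submodule.starProjection_norm_le _
      _ = ‖v‖ := one_mul _)
  have hW2 : C.W x t a2 (2 * (b + b')) := by
    intro s hs
    have hsub : {y | y ∈ closedBall x t ∧ s < ‖y - ap a2 (C.P y)‖} ⊆
        {y | y ∈ closedBall x t ∧ s / 2 < ‖y - ap a (C.P y)‖} ∪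
        {y | y ∈ closedBall x t ∧ s / 2 < infDist y (L : Set (Eu d))} := by
      rintro y ⟨hy, hys⟩
      by_contra hcon
      have c1 : ‖y - ap a (C.P y)‖ ≤ s / 2 := by
        by_contra h; exact hcon (Or.inl ⟨hy, not_le.1 h⟩)
      have c2 : infDist y (L : Set (Eu d)) ≤ s / 2 := by
        by_contra h; exact hcon (Or.inr ⟨hy, not_le.1 h⟩)
      have h1 := plane_dist L q0 hq0 y
      have h2 : y - ap a2 (C.P y) = (y - (q0 + Q (y - q0))) + Q (y - ap a (C.P y)) := by
        simp only [hap2, map_sub]; abel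
      have h3 := norm_add_le (y - (q0 + Q (y - q0))) (Q (y - ap a (C.P y)))
      rw [← h2] at h3
      have h4 := hQn (y - ap a (C.P y))
      linarith
    refine (measure_mono hsub).trans ((measure_union_le _ _).trans
      ((add_le_add (hW _ (by positivity)) (hLd _ (by positivity))).trans ?_))
    rw [← ENNReal.ofReal_add (by positivity) (by positivity)]
    apply ENNReal.ofReal_le_ofReal
    rw [← add_div, ← add_mul, show (b ^ 2 + b' ^ 2) * t ^ (n + 2) / (s / 2) ^ 2 =
      (4 * (b ^ 2 + b' ^ 2)) * t ^ (n + 2) / s ^ 2 by field_simp; ring]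
    gcongr; nlinarith
  have hc := hcmp d eps C x t a a2 b (2 * (b + b')) ht ht2 ha hW hW2 hm hb
    (hbb.trans (min_le_left _ _)) (by positivity)
  have hη : ‖a2.2 - a.2‖ ≤ 3 * K * (b + b') := by
    rw [norm_sub_rev]
    have h1 : ‖a.2 - a2.2‖ * t ≤ (3 * K * (b + b')) * t := by
      have := norm_nonneg (ap a (C.P x) - ap a2 (C.P x))
      have h3 : K * b' * t ≥ 0 := by positivity
      nlinarith
    exact le_of_mul_le_mul_right h1 ht
  have hη6 : 3 * K * (b + b') ≤ 1 / 6 := by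
    have h1 : b ≤ 1 / (36 * K) := hbb.trans (min_le_right _ _)
    have h2 : b' ≤ 1 / (36 * K) := hbb'.trans (min_le_right _ _)
    calc 3 * K * (b + b') ≤ 3 * K * (1 / (36 * K) + 1 / (36 * K)) := by gcongr
      _ = 1 / 6 := by field_simp; norm_num
  obtain ⟨T', hT'V, hPT', hTT', hT'n, hT'P⟩ := graph_lin C.P C.P_norm a.2 a2.2 hsec.2 ha V hL
    (fun p => by simp only [ha2, ContinuousLinearMap.comp_apply, hQ]
                 exact Submodule.starProjection_apply_mem _ _) _ hη6 hη
  refine ⟨(q0 - T' (C.P q0), T'), ⟨by simp [hPT'], hPT'⟩, ?_, by linarith⟩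
  intro s hs
  have hsub : {y | y ∈ closedBall x t ∧ s < ‖y - ap (q0 - T' (C.P q0), T') (C.P y)‖} ⊆
      {y | y ∈ closedBall x t ∧ s / 4 < infDist y (L : Set (Eu d))} := by
    rintro y ⟨hy, hys⟩
    refine ⟨hy, ?_⟩
    have h1 := plane_dist L q0 hq0 y
    set z := q0 + Q (y - q0) with hz
    have h2 : T' (C.P (Q (y - q0))) = Q (y - q0) := hT'P _ (Submodule.starProjection_apply_mem _ _)
    have h3 : y - ap (q0 - T' (C.P q0), T') (C.P y) = (y - z) - T' (C.P (y - z)) := by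
      simp only [ap, hz, map_sub, map_add] at h2 ⊢
      rw [h2]; abel
    have h4 : ‖T' (C.P (y - z))‖ ≤ 3 * ‖y - z‖ :=
      (T'.le_opNorm _).trans (by gcongr; exact C.hP _)
    have h5 := norm_sub_le (y - z) (T' (C.P (y - z)))
    rw [← h3] at h5
    have h6 : ‖y - z‖ ≤ infDist y (L : Set (Eu d)) := h1
    linarith
  refine (measure_mono hsub).trans ((hLd _ (by positivity)).trans ?_)
  apply ENNReal.ofReal_le_ofReal
  apply le_of_eq
  field_simp

end Cfg

end

section

/-- dyadic scale -/
noncomputable def tk (k : ℕ) : ℝ := (1 / 2 : ℝ) ^ k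

theorem tk_pos (k : ℕ) : 0 < tk k := by unfold tk; positivity
theorem tk_zero : tk 0 = 1 := by simp [tk]
theorem tk_succ (k : ℕ) : tk (k + 1) = tk k / 2 := by unfold tk; rw [pow_succ]; ring
theorem tk_add (k l : ℕ) : tk (k + l) = tk k * tk l := pow_add _ _ _
theorem tk_anti {k l : ℕ} (h : k ≤ l) : tk l ≤ tk k :=
  pow_le_pow_of_le_one (by norm_num) (by norm_num) h
theorem tk_lt {k l : ℕ} (h : k < l) : tk l < tk k :=
  pow_lt_pow_right_of_lt_one₀ (by norm_num) (by norm_num) h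
theorem tk_le_one (k : ℕ) : tk k ≤ 1 := by rw [← tk_zero]; exact tk_anti (Nat.zero_le _)
theorem le_of_tk {k l : ℕ} (h : tk l ≤ tk k) : k ≤ l := by
  by_contra hh; push Not at hh; exact absurd (tk_lt hh) (not_lt.2 h)
theorem lt_of_tk {k l : ℕ} (h : tk l < tk k) : k < l := by
  by_contra hh; push Not at hh; exact absurd (tk_anti hh) (not_le.2 h)

/-- crude constant -/
noncomputable def Qc (n : ℕ) : ℝ := 2 ^ (16 * (n + 2))

theorem Qc_pos (n : ℕ) : 0 < Qc n := by unfold Qc; positivity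
theorem Qc_one (n : ℕ) : 1 ≤ Qc n := one_le_pow₀ (by norm_num)

theorem tk_Qc (n k l : ℕ) (h : l ≤ k + 16) : tk k ^ (n + 2) ≤ Qc n ^ 2 * tk l ^ (n + 2) := by
  have h1 : tk k ≤ 2 ^ 16 * tk l := by
    have := tk_anti h
    rw [tk_add] at this
    have h2 : tk 16 = 1 / 2 ^ 16 := by norm_num [tk]
    rw [h2] at this
    linarith
  calc tk k ^ (n + 2) ≤ (2 ^ 16 * tk l) ^ (n + 2) := by
        have := (tk_pos k).le
        gcongr
    _ = Qc n * tk l ^ (n + 2) := by rw [mul_pow, Qc, pow_mul]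
    _ ≤ Qc n ^ 2 * tk l ^ (n + 2) := by
        have := (tk_pos l).le
        gcongr
        nlinarith [Qc_one n]

namespace Cfg

variable {n d : ℕ} {lam eps : ℝ} (C : Cfg n d lam eps) (δ : ℝ)

/-- density lower bound -/
def dens (x : Eu d) (k : ℕ) : Prop := ENNReal.ofReal (δ * tk k ^ n) ≤ C.m (closedBall x (tk k))

/-- good scale -/
def G (x : Eu d) (k : ℕ) : Prop := C.dens δ x k ∧
  ∃ a, C.Sec a ∧ C.sl a ≤ 1 / 2 ∧ C.W x (tk k) a (4 * C.b x k)

open Classical in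
/-- chosen section -/
noncomputable def sa (x : Eu d) (k : ℕ) : Eu d × (Eu n →L[ℝ] Eu d) :=
  if h : C.G δ x k then h.2.choose else (0, C.io)

theorem sa_spec {x : Eu d} {k : ℕ} (h : C.G δ x k) :
    C.Sec (C.sa δ x k) ∧ C.sl (C.sa δ x k) ≤ 1 / 2 ∧ C.W x (tk k) (C.sa δ x k) (4 * C.b x k) := by
  unfold sa; rw [dif_pos h]; exact h.2.choose_spec

/-- central part of `F` -/
def F1 : Set (Eu d) := C.F ∩ closedBall 0 (tk 16)

open Classical in
/-- stopping height -/
noncomputable def h (x : Eu d) : ℝ :=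
  if H : ∃ k, ¬ C.G δ x k then 2 * tk (Nat.find H) else 0

theorem h_nonneg (x : Eu d) : 0 ≤ C.h δ x := by
  unfold h; split_ifs
  · exact mul_nonneg zero_le_two (tk_pos _).le
  · exact le_rfl

theorem G_of_h {x : Eu d} {k : ℕ} (hk : C.h δ x ≤ tk k) : C.G δ x k := by
  classical
  by_contra hG
  have H : ∃ k, ¬ C.G δ x k := ⟨k, hG⟩
  have h1 : C.h δ x = 2 * tk (Nat.find H) := by
    unfold h; rw [dif_pos H]
  have h2 : Nat.find H ≤ k := Nat.find_min' H hG
  have h3 := tk_anti h2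
  have := tk_pos k
  linarith

theorem b_le {x : Eu d} (hx : x ∈ C.F) (k : ℕ) : C.b x k ≤ Real.sqrt eps := by
  apply Real.le_sqrt_of_sq_le
  refine le_trans ?_ (C.hbs x hx (k + 1))
  exact Finset.single_le_sum (f := fun k => C.b x k ^ 2) (fun i _ => sq_nonneg _)
    (Finset.mem_range.2 (Nat.lt_succ_self k))

theorem eps_nonneg {x : Eu d} (hx : x ∈ C.F) : 0 ≤ eps := by simpa using C.hbs x hx 0

theorem Wsub {x z : Eu d} {k l : ℕ} {a : Eu d × (Eu n →L[ℝ] Eu d)} {β : ℝ}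
    (hW : C.W x (tk k) a β) (hsub : closedBall z (tk l) ⊆ closedBall x (tk k)) (hl : l ≤ k + 16) :
    C.W z (tk l) a (Qc n * β) := by
  apply C.W_mono hW hsub
  have := tk_Qc n k l hl
  calc β ^ 2 * tk k ^ (n + 2) ≤ β ^ 2 * (Qc n ^ 2 * tk l ^ (n + 2)) := by gcongr
    _ = _ := by ring

theorem W0 {x : Eu d} (hx : x ∈ C.F1) : C.W x 1 (C.c, C.io) (Real.sqrt eps) := by
  intro s hs
  have hx2 : ‖x‖ ≤ 1 := by
    have := hx.2; rw [mem_closedBall_zero_iff] at this; exact this.trans (tk_le_one _)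
  refine (measure_mono ?_).trans ((C.H3 s hs).trans ?_)
  · rintro y ⟨hy, hys⟩
    refine ⟨?_, hys⟩
    rw [mem_closedBall_zero_iff]
    rw [mem_closedBall, dist_eq_norm] at hy
    have := norm_add_le x (y - x)
    simp only [add_sub_cancel] at this
    linarith
  · rw [Real.sq_sqrt (C.eps_nonneg hx.1)]; simp

/-- Basic facts used in the proof of the main proposition. -/
structure Fac (K : ℝ) : Prop where
  base : ∀ x ∈ C.F1, ∀ k ≤ 15, C.G δ x k
  sl0 : ∀ x ∈ C.F1, C.sl (C.sa δ x 0) ≤ K * Real.sqrt eps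
  stopping : ∀ x ∈ C.F1, 0 < C.h δ x → ∃ k, 15 ≤ k ∧ C.h δ x = tk k ∧ C.G δ x k ∧
    (¬ C.dens δ x (k + 1) ∨ 1 / 4 < C.sl (C.sa δ x k))
  cmp : ∀ x ∈ C.F, ∀ y ∈ C.F, ∀ (z : Eu d) (k k' l : ℕ), C.G δ x k → C.G δ y k' → C.dens δ z l →
    closedBall z (tk l) ⊆ closedBall x (tk k) → closedBall z (tk l) ⊆ closedBall y (tk k') →
    l ≤ k + 16 → l ≤ k' + 16 → ∀ p, ‖p - C.P z‖ ≤ 2 ^ 16 * tk l →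
    ‖ap (C.sa δ x k) p - ap (C.sa δ y k') p‖ ≤ K * (C.b x k + C.b y k') * tk l
  near : ∀ x ∈ C.F, ∀ (y : Eu d) (k k' : ℕ), C.G δ x k → C.dens δ y k' →
    closedBall y (tk k') ⊆ closedBall x (tk k) → k' ≤ k + 20 →
    ‖y - ap (C.sa δ x k) (C.P y)‖ ≤ 4 * tk k'
  cone : ∀ x ∈ C.F1, ∀ z ∈ C.F1, ‖x - z‖ ≤ 64 * (‖C.P x - C.P z‖ + C.h δ x + C.h δ z)

end Cfg

end

section

namespace Cfg

variable {n d : ℕ} {lam eps : ℝ} (C : Cfg n d lam eps) (δ : ℝ)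

theorem near_aux (hδ : 0 < δ) (he : 16 * eps * 2 ^ (20 * (n + 2)) < δ) (x : Eu d) (hx : x ∈ C.F)
    (y : Eu d) (k k' : ℕ) (hG : C.G δ x k) (hd : C.dens δ y k')
    (hsub : closedBall y (tk k') ⊆ closedBall x (tk k)) (hk : k' ≤ k + 20) :
    ‖y - ap (C.sa δ x k) (C.P y)‖ ≤ 4 * tk k' := by
  obtain ⟨hsec, hsl, hW⟩ := C.sa_spec δ hG
  set a := C.sa δ x k
  have htk' := tk_pos k'
  have htk := tk_pos k
  have ha : ‖a.2‖ ≤ 1 + 1 / 2 := C.norm_of_sl hsl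
  have hex : ∃ z ∈ closedBall y (tk k'), ‖z - ap a (C.P z)‖ ≤ tk k' := by
    by_contra hcon
    push Not at hcon
    have h1 : C.m (closedBall y (tk k')) ≤
        ENNReal.ofReal ((4 * C.b x k) ^ 2 * tk k ^ (n + 2) / tk k' ^ 2) :=
      by
        refine le_trans (measure_mono ?_) (hW (tk k') htk')
        intro z hz
        exact ⟨hsub hz, hcon z hz⟩
    have h2 := hd.trans h1
    rw [ENNReal.ofReal_le_ofReal_iff (by positivity), le_div_iff₀ (by positivity)] at h2
    have h3 : C.b x k ^ 2 ≤ eps := by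
      have := C.b_le hx k
      calc C.b x k ^ 2 ≤ Real.sqrt eps ^ 2 := by
            have := C.hb0 x k
            gcongr
        _ = eps := Real.sq_sqrt (C.eps_nonneg hx)
    have h4 : tk k ≤ 2 ^ 20 * tk k' := by
      have := tk_anti hk
      rw [tk_add] at this
      have h2 : tk 20 = 1 / 2 ^ 20 := by norm_num [tk]
      rw [h2] at this
      linarith
    have h5 : (4 * C.b x k) ^ 2 * tk k ^ (n + 2) ≤
        (16 * eps * 2 ^ (20 * (n + 2))) * (tk k' ^ n * tk k' ^ 2) := by
      have heps := C.eps_nonneg hx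
      calc (4 * C.b x k) ^ 2 * tk k ^ (n + 2) = 16 * C.b x k ^ 2 * tk k ^ (n + 2) := by ring
        _ ≤ 16 * eps * (2 ^ 20 * tk k') ^ (n + 2) := by gcongr
        _ = _ := by rw [mul_pow, ← pow_mul, ← pow_add]; ring
    have h6 : 0 < tk k' ^ n * tk k' ^ 2 := by positivity
    nlinarith
  obtain ⟨z, hz, hza⟩ := hex
  rw [mem_closedBall, dist_eq_norm] at hz
  have e1 : y - ap a (C.P y) = (z - ap a (C.P z)) - (z - y) + a.2 (C.P (z - y)) := by
    rw [map_sub, ← ap_sub]; abel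
  have e2 : ‖a.2 (C.P (z - y))‖ ≤ (1 + 1 / 2) * tk k' :=
    (a.2.le_opNorm _).trans (by gcongr; exact (C.hP _).trans hz)
  rw [e1]
  have e3 := norm_add_le ((z - ap a (C.P z)) - (z - y)) (a.2 (C.P (z - y)))
  have e4 := norm_sub_le (z - ap a (C.P z)) (z - y)
  linarith

theorem ball_sub {x y : Eu d} {r s : ℝ} (h : ‖y - x‖ + s ≤ r) :
    closedBall y s ⊆ closedBall x r := by
  apply closedBall_subset_closedBall'
  rw [dist_eq_norm]; linarith

theorem cone_aux (hnear : ∀ x ∈ C.F, ∀ (y : Eu d) (k k' : ℕ), C.G δ x k → C.dens δ y k' →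
    closedBall y (tk k') ⊆ closedBall x (tk k) → k' ≤ k + 20 →
    ‖y - ap (C.sa δ x k) (C.P y)‖ ≤ 4 * tk k') (x : Eu d) (hx : x ∈ C.F1) (z : Eu d)
    (hz : z ∈ C.F1) : ‖x - z‖ ≤ 64 * (‖C.P x - C.P z‖ + C.h δ x + C.h δ z) := by
  by_contra hcon
  push Not at hcon
  have hhx := C.h_nonneg δ x
  have hhz := C.h_nonneg δ z
  have hPn := norm_nonneg (C.P x - C.P z)
  have hpos : 0 < ‖x - z‖ := by linarith
  have hle : ‖x - z‖ ≤ 2 * tk 16 := by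
    have h1 := hx.2
    have h2 := hz.2
    rw [mem_closedBall_zero_iff] at h1 h2
    have := norm_sub_le x z
    linarith
  have h16 : tk 16 = 1 / 2 ^ 16 := by norm_num [tk]
  obtain ⟨k, hk1, hk2⟩ := exists_nat_pow_near_of_lt_one (x := 2 * ‖x - z‖) (y := (1 / 2 : ℝ))
    (by positivity) (by rw [h16] at hle; norm_num at hle; linarith) (by norm_num) (by norm_num)
  change tk (k + 1) < _ at hk1
  change _ ≤ tk k at hk2
  rw [tk_succ] at hk1
  have h6 : tk (k + 6) = tk k / 64 := by rw [tk_add]; norm_num [tk]; ring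
  have hGx : C.G δ x k := C.G_of_h δ (by linarith)
  have hdx : C.dens δ x (k + 6) := (C.G_of_h δ (by linarith)).1
  have hdz : C.dens δ z (k + 6) := (C.G_of_h δ (by linarith)).1
  have hkp := tk_pos k
  have n1 := hnear x hx.1 x k (k + 6) hGx hdx (ball_sub (by rw [h6]; simp; linarith)) (by omega)
  have n2 := hnear x hx.1 z k (k + 6) hGx hdz
    (ball_sub (by rw [h6, norm_sub_rev]; linarith)) (by omega)
  obtain ⟨hsec, hsl, hW⟩ := C.sa_spec δ hGx
  set a := C.sa δ x k
  have ha : ‖a.2‖ ≤ 1 + 1 / 2 := C.norm_of_sl hsl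
  have e1 : x - z = (x - ap a (C.P x)) - (z - ap a (C.P z)) + a.2 (C.P x - C.P z) := by
    rw [← ap_sub]; abel
  have e2 : ‖a.2 (C.P x - C.P z)‖ ≤ (1 + 1 / 2) * ‖C.P x - C.P z‖ :=
    (a.2.le_opNorm _).trans (by gcongr)
  have e3 := norm_add_le ((x - ap a (C.P x)) - (z - ap a (C.P z))) (a.2 (C.P x - C.P z))
  have e4 := norm_sub_le (x - ap a (C.P x)) (z - ap a (C.P z))
  rw [← e1] at e3
  rw [h6] at n1 n2
  linarith

theorem chain (n : ℕ) (hn : 0 < n) (lam δ : ℝ) (hlam : 0 ≤ lam) (hδ : 0 < δ)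
    (hδ1 : δ ≤ tk 16 ^ n / 2) :
    ∃ K e0 : ℝ, 0 < K ∧ 0 < e0 ∧ ∀ (d : ℕ) (eps : ℝ) (C : Cfg n d lam eps),
      Real.sqrt eps ≤ e0 → C.Fac δ K := by
  obtain ⟨K1, b1, hK1, hb1, hcmp⟩ := compare n lam δ hlam hδ
  obtain ⟨K2, b2, hK2, hb2, hgr⟩ := graph n hn lam δ hlam hδ
  have hQ := Qc_pos n
  have hQ1 := Qc_one n
  set K := K1 * (Qc n * 4) * (1 + 2 ^ 16) + K1 * (Qc n * 4 + 1) with hK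
  set e1 := Real.sqrt (δ / (32 * 2 ^ (20 * (n + 2)))) with he1
  have he1p : 0 < e1 := Real.sqrt_pos.2 (by positivity)
  set e0 := min (min e1 (b1 / (4 * Qc n))) (min (b2 / (4 * Qc n)) (1 / (4 * K2 * (4 * Qc n + 1))))
    with he0
  refine ⟨K, e0, by positivity, by positivity, ?_⟩
  intro d eps C hee
  have l1 : Real.sqrt eps ≤ e1 := hee.trans ((min_le_left _ _).trans (min_le_left _ _))
  have l2 : Real.sqrt eps ≤ b1 / (4 * Qc n) :=
    hee.trans ((min_le_left _ _).trans (min_le_right _ _))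
  have l3 : Real.sqrt eps ≤ b2 / (4 * Qc n) :=
    hee.trans ((min_le_right _ _).trans (min_le_left _ _))
  have l4 : Real.sqrt eps ≤ 1 / (4 * K2 * (4 * Qc n + 1)) :=
    hee.trans ((min_le_right _ _).trans (min_le_right _ _))
  rw [le_div_iff₀ (by positivity)] at l2 l3 l4
  have hs0 : 0 ≤ Real.sqrt eps := Real.sqrt_nonneg _
  have hnear : ∀ x ∈ C.F, ∀ (y : Eu d) (k k' : ℕ), C.G δ x k → C.dens δ y k' →
      closedBall y (tk k') ⊆ closedBall x (tk k) → k' ≤ k + 20 →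
      ‖y - ap (C.sa δ x k) (C.P y)‖ ≤ 4 * tk k' := by
    intro x hx y k k' h1 h2 h3 h4
    refine C.near_aux δ hδ ?_ x hx y k k' h1 h2 h3 h4
    have : eps ≤ δ / (32 * 2 ^ (20 * (n + 2))) := by
      rw [← Real.sq_sqrt (C.eps_nonneg hx)]
      calc Real.sqrt eps ^ 2 ≤ e1 ^ 2 := by gcongr
        _ = _ := Real.sq_sqrt (by positivity)
    rw [le_div_iff₀ (by positivity)] at this
    linarith
  have hbase : ∀ x ∈ C.F1, ∀ k ≤ 15, C.G δ x k := by
    intro x hx k hk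
    have hxn := hx.2
    rw [mem_closedBall_zero_iff] at hxn
    have hdens : C.dens δ x k := by
      unfold dens
      refine le_trans ?_ (C.H4.trans (measure_mono (ball_sub ?_)))
      · apply ENNReal.ofReal_le_ofReal
        have h1 : tk k ^ n ≤ 1 := pow_le_one₀ (tk_pos k).le (tk_le_one k)
        calc δ * tk k ^ n ≤ δ * 1 := by gcongr
          _ ≤ _ := by rw [mul_one]; exact hδ1
      · have h2 : tk 15 ≤ tk k := tk_anti hk
        have h3 : tk 16 = tk 15 / 2 := tk_succ 15
        change ‖0 - x‖ + tk 16 ≤ tk k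
        rw [zero_sub, norm_neg]; linarith
    refine ⟨hdens, ?_⟩
    have hW0 : C.W x (tk k) (C.c, C.io) (Qc n * Real.sqrt eps) := by
      have := C.W0 hx
      rw [← tk_zero] at this
      exact C.Wsub this (closedBall_subset_closedBall (tk_anti (Nat.zero_le _))) (by omega)
    obtain ⟨a', h1, h2, h3⟩ := hgr d eps C x (tk k) (C.c, C.io) (C.L x k) (Qc n * Real.sqrt eps)
      (C.b x k) (tk_pos k) ((tk_le_one k).trans (by norm_num)) ⟨C.hc, C.hPi⟩
      (C.io_norm.trans (by norm_num)) hW0 (C.hL x hx.1 k) (C.H2 x hx.1 k) hdens (by positivity)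
      (by nlinarith) (C.hb0 _ _) ((C.b_le hx.1 k).trans (by nlinarith))
    refine ⟨a', h1, ?_, h2⟩
    unfold sl
    refine h3.trans ?_
    have := C.b_le hx.1 k
    calc K2 * (Qc n * Real.sqrt eps + C.b x k) ≤ K2 * (Qc n * Real.sqrt eps + Real.sqrt eps) := by
          gcongr
      _ ≤ 1 / 2 := by nlinarith [mul_nonneg (mul_nonneg hK2.le hQ.le) hs0, mul_nonneg hK2.le hs0]
  refine ⟨hbase, ?_, ?_, ?_, hnear, C.cone_aux δ hnear⟩
  · intro x hx
    have hG := hbase x hx 0 (by norm_num)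
    obtain ⟨hsec, hsl, hW⟩ := C.sa_spec δ hG
    have hd := hG.1
    unfold dens at hd
    rw [tk_zero] at hW hd
    have hb := C.b_le hx.1 0
    have hb0 := C.hb0 x 0
    have h1 := hcmp d eps C x 1 (C.sa δ x 0) (C.c, C.io) (4 * C.b x 0) (Real.sqrt eps) one_pos
      (by norm_num) ((C.norm_of_sl hsl).trans (by norm_num)) hW (C.W0 hx) hd (by positivity)
      (by nlinarith) hs0
    unfold sl
    have h2 := norm_nonneg (ap (C.sa δ x 0) (C.P x) - ap (C.c, C.io) (C.P x))
    have h3 : ‖(C.sa δ x 0).2 - C.io‖ ≤ K1 * (4 * C.b x 0 + Real.sqrt eps) := by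
      simp only [mul_one] at h1; linarith
    refine h3.trans ?_
    calc K1 * (4 * C.b x 0 + Real.sqrt eps) ≤ K1 * (4 * Real.sqrt eps + Real.sqrt eps) := by gcongr
      _ ≤ K1 * (Qc n * 4 + 1) * Real.sqrt eps := by
          nlinarith [mul_nonneg hK1.le hs0, mul_nonneg (mul_nonneg hK1.le hs0) (sub_nonneg.2 hQ1)]
      _ ≤ K * Real.sqrt eps := by
          gcongr; rw [hK]
          have : 0 < K1 * (Qc n * 4) * (1 + 2 ^ 16) := by positivity
          linarith
  · intro x hx hh
    classical
    by_cases H : ∃ k, ¬ C.G δ x k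
    swap
    · unfold h at hh; rw [dif_neg H] at hh; exact absurd hh (lt_irrefl _)
    have hne := Nat.find_spec H
    have hmin : ∀ j < Nat.find H, C.G δ x j := fun j hj => by
      by_contra hj'; exact Nat.find_min H hj hj'
    have hheq : C.h δ x = 2 * tk (Nat.find H) := by unfold h; rw [dif_pos H]
    set f := Nat.find H with hf
    have h16 : 16 ≤ f := by
      by_contra hlt
      exact hne (hbase x hx f (by omega))
    obtain ⟨k, hkf⟩ : ∃ k, f = k + 1 := ⟨f - 1, by omega⟩
    have hGk : C.G δ x k := hmin k (by omega)
    refine ⟨k, by omega, ?_, hGk, ?_⟩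
    · rw [hheq, hkf, tk_succ]; ring
    · by_contra hcon
      push Not at hcon
      obtain ⟨hd, hsl4⟩ := hcon
      obtain ⟨hsec, hsl, hW⟩ := C.sa_spec δ hGk
      have hW' := C.Wsub hW (closedBall_subset_closedBall (tk_anti (Nat.le_succ k)))
        (show k + 1 ≤ k + 16 by omega)
      have hbk := C.b_le hx.1 k
      have hbk0 := C.hb0 x k
      have hbk1 := C.b_le hx.1 (k + 1)
      obtain ⟨a', h1, h2, h3⟩ := hgr d eps C x (tk (k + 1)) (C.sa δ x k) (C.L x (k + 1))
        (Qc n * (4 * C.b x k)) (C.b x (k + 1)) (tk_pos _) ((tk_le_one _).trans (by norm_num)) hsec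
        ((C.norm_of_sl hsl).trans (by norm_num)) hW' (C.hL x hx.1 _) (C.H2 x hx.1 _) hd
        (by positivity) (by nlinarith) (C.hb0 _ _) (hbk1.trans (by nlinarith))
      apply hne
      rw [hkf]
      refine ⟨hd, a', h1, ?_, h2⟩
      have h4 : ‖a'.2 - (C.sa δ x k).2‖ ≤ 1 / 4 := by
        refine h3.trans ?_
        calc K2 * (Qc n * (4 * C.b x k) + C.b x (k + 1))
            ≤ K2 * (Qc n * (4 * Real.sqrt eps) + Real.sqrt eps) := by gcongr
          _ ≤ 1 / 4 := by nlinarith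
      unfold sl at hsl4 ⊢
      have h5 := norm_add_le (a'.2 - (C.sa δ x k).2) ((C.sa δ x k).2 - C.io)
      rw [sub_add_sub_cancel] at h5
      linarith
  · intro x hx y hy z k k' l hGx hGy hd hs1 hs2 hl1 hl2 p hp
    obtain ⟨hsec, hsl, hW⟩ := C.sa_spec δ hGx
    obtain ⟨hsec', hsl', hW'⟩ := C.sa_spec δ hGy
    have hWz := C.Wsub hW hs1 hl1
    have hWz' := C.Wsub hW' hs2 hl2
    have hbx := C.b_le hx k
    have hbx0 := C.hb0 x k
    have hby0 := C.hb0 y k'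
    have h1 := hcmp d eps C z (tk l) (C.sa δ x k) (C.sa δ y k') (Qc n * (4 * C.b x k))
      (Qc n * (4 * C.b y k')) (tk_pos l) ((tk_le_one l).trans (by norm_num))
      ((C.norm_of_sl hsl).trans (by norm_num)) hWz hWz' hd (by positivity) (by nlinarith)
      (by positivity)
    set a := C.sa δ x k
    set a' := C.sa δ y k'
    have htl := tk_pos l
    have e1 : ap a p - ap a' p = (ap a (C.P z) - ap a' (C.P z)) + (a.2 - a'.2) (p - C.P z) := by
      rw [_root_.sub_apply, ← ap_sub, ← ap_sub]; abel
    have e2 : ‖(a.2 - a'.2) (p - C.P z)‖ ≤ ‖a.2 - a'.2‖ * (2 ^ 16 * tk l) :=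
      ((a.2 - a'.2).le_opNorm _).trans (by gcongr)
    have e3 := norm_add_le (ap a (C.P z) - ap a' (C.P z)) ((a.2 - a'.2) (p - C.P z))
    rw [← e1] at e3
    have e4 : 0 ≤ ‖ap a (C.P z) - ap a' (C.P z)‖ := norm_nonneg _
    have e5 : 0 ≤ ‖a.2 - a'.2‖ * tk l := by positivity
    have e6 : ‖ap a p - ap a' p‖ ≤
        (1 + 2 ^ 16) * (K1 * (Qc n * (4 * C.b x k) + Qc n * (4 * C.b y k')) * tk l) := by
      nlinarith
    refine e6.trans ?_
    have e7 : 0 ≤ K1 * (Qc n * 4 + 1) * (C.b x k + C.b y k') * tk l := by positivity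
    rw [hK]
    nlinarith

end Cfg

end

section

theorem le_lintegral_finset {α : Type*} [MeasurableSpace α] (μ : Measure α) (s : Finset ℕ)
    (f : ℕ → α → ℝ≥0∞) : ∑ i ∈ s, ∫⁻ x, f i x ∂μ ≤ ∫⁻ x, ∑ i ∈ s, f i x ∂μ := by
  classical
  induction s using Finset.induction_on with
  | empty => simp
  | insert a s ha ih =>
    simp only [Finset.sum_insert ha]
    exact (add_le_add le_rfl ih).trans (le_lintegral_add _ _)

theorem lemVc {n d : ℕ} (m : Measure (Eu d)) (P : Eu d → Eu n) (S : Set (Eu d))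
    (r : Eu d → ℝ) (hr : ∀ x ∈ S, 0 < r x ∧ r x ≤ 1 / 2) (hP : ∀ x ∈ S, ‖P x‖ ≤ 1 / 2)
    (A : ℝ≥0∞)
    (h : ∀ x0 ∈ S, m (S ∩ {x | ‖P x - P x0‖ ≤ 3 * r x0 ∧ r x ≤ 2 * r x0}) ≤
      A * ENNReal.ofReal (r x0 ^ n)) : m S ≤ A := by
  have h1 := lemV m P S r (1 / 2) hr ((closedBall (0 : Eu n) 1).indicator fun _ => A / c1 n) ?_
  · rw [lintegral_indicator isClosed_closedBall.measurableSet, setLIntegral_const,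
      vol_ball _ _ zero_le_one] at h1
    simp only [one_pow, ENNReal.ofReal_one, one_mul] at h1
    rwa [ENNReal.div_mul_cancel (c1_pos n) (c1_top n)] at h1
  · intro x0 hx0
    refine ⟨A / c1 n, ?_, ?_⟩
    · refine (h x0 hx0).trans (le_of_eq ?_)
      rw [vol_ball _ _ (hr x0 hx0).1.le, mul_comm (ENNReal.ofReal _), ← mul_assoc,
        ENNReal.div_mul_cancel (c1_pos n) (c1_top n)]
    · intro p hp
      rw [indicator_of_mem]
      rw [mem_closedBall_zero_iff]
      rw [mem_closedBall, dist_eq_norm] at hp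
      have h2 := norm_add_le (p - P x0) (P x0)
      rw [sub_add_cancel] at h2
      have := (hr x0 hx0).2
      have := hP x0 hx0
      linarith

namespace Cfg

variable {n d : ℕ} {lam eps : ℝ} (C : Cfg n d lam eps) (δ : ℝ)

/-- points stopped because of low density -/
def FL : Set (Eu d) := {x | x ∈ C.F1 ∧ ∃ k, 15 ≤ k ∧ C.h δ x = tk k ∧ ¬ C.dens δ x (k + 1)}

theorem F1_P {x : Eu d} (hx : x ∈ C.F1) : ‖C.P x‖ ≤ 1 / 65536 := by
  have := hx.2
  rw [mem_closedBall_zero_iff] at this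
  have h2 : tk 16 = 1 / 65536 := by norm_num [tk]
  rw [h2] at this
  exact (C.hP x).trans this

theorem FL_h {x : Eu d} (hx : x ∈ C.FL δ) : 0 < C.h δ x ∧ C.h δ x ≤ 1 / 32768 ∧
    C.m (closedBall x (C.h δ x / 2)) ≤ ENNReal.ofReal (δ * (C.h δ x / 2) ^ n) := by
  obtain ⟨-, k, hk, h1, h2⟩ := hx
  rw [h1]
  refine ⟨tk_pos k, ?_, ?_⟩
  · have := tk_anti hk
    have h2 : tk 15 = 1 / 32768 := by norm_num [tk]
    rwa [h2] at this
  · rw [← tk_succ]; exact (not_le.1 h2).le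

theorem FL_I (d : ℕ) : ∃ N : ℕ, ∀ (n : ℕ) (lam eps : ℝ) (C : Cfg n d lam eps) (δ K : ℝ), 0 ≤ δ →
    C.Fac δ K →
    C.m {x | x ∈ C.FL δ ∧ ∀ z ∈ C.F1, C.h δ x / 65536 ≤ ‖C.P x - C.P z‖ + C.h δ z} ≤
      ENNReal.ofReal (N * (δ * 524288 ^ n)) := by
  obtain ⟨N, hN⟩ := packing d (5 / 65536 / 16 / 200) (by norm_num)
  refine ⟨N, fun n lam eps C δ K hδ hfac => ?_⟩
  refine lemVc C.m C.P _ (fun x => C.h δ x / 524288) ?_ ?_ _ ?_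
  · intro x hx
    have := C.FL_h δ hx.1
    constructor <;> linarith
  · intro x hx
    have := C.F1_P hx.1.1
    linarith
  · intro x0 hx0
    obtain ⟨h1, h2, -⟩ := C.FL_h δ hx0.1
    set h0 := C.h δ x0 with hh0
    refine (hN C.m _ x0 (200 * h0) (ENNReal.ofReal (δ * h0 ^ n)) (by positivity) ?_ ?_).trans
      (le_of_eq ?_)
    · rintro y ⟨hy, hy1, hy2⟩
      rw [mem_closedBall, dist_eq_norm]
      have h3 := hfac.cone y hy.1.1 x0 hx0.1.1
      rw [← hh0] at h3
      linarith
    · rintro y ⟨hy, hy1, hy2⟩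
      obtain ⟨h4, -, h5⟩ := C.FL_h δ hy.1
      have h6 := hx0.2 y hy.1.1
      rw [norm_sub_rev] at h6
      refine (measure_mono (closedBall_subset_closedBall ?_)).trans (h5.trans ?_)
      · linarith
      · apply ENNReal.ofReal_le_ofReal
        gcongr
        linarith
    · rw [← ENNReal.ofReal_natCast, ← ENNReal.ofReal_mul (by positivity),
        ← ENNReal.ofReal_mul (by positivity)]
      congr 1
      rw [mul_assoc, mul_assoc, ← mul_pow]
      congr 3
      ring

theorem FL_IIa {K : ℝ} (hδ : 0 ≤ δ) (hfac : C.Fac δ K) :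
    C.m {x | x ∈ C.FL δ ∧ ∃ z ∈ C.F1, ‖C.P x - C.P z‖ + C.h δ z < C.h δ x / 65536 ∧
      ‖x - z‖ ≤ C.h δ x / 16} ≤ ENNReal.ofReal (δ * 524288 ^ n) := by
  refine lemVc C.m C.P _ (fun x => C.h δ x / 65536) ?_ ?_ _ ?_
  · intro x hx
    have := C.FL_h δ hx.1
    constructor <;> linarith
  · intro x hx
    have := C.F1_P hx.1.1
    linarith
  · intro x0 hx0
    obtain ⟨h1, h2, h3⟩ := C.FL_h δ hx0.1
    set h0 := C.h δ x0 with hh0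
    refine (measure_mono ?_).trans (h3.trans ?_)
    · rintro y ⟨⟨hy, z, hz, hz1, hz2⟩, hy1, hy2⟩
      obtain ⟨-, w, hw, hw1, hw2⟩ := hx0
      rw [mem_closedBall, dist_eq_norm]
      have h3 := hfac.cone z hz w hw
      rw [← hh0] at hw1 hw2
      have e1 : C.P z - C.P w = -(C.P y - C.P z) + (C.P y - C.P x0) + (C.P x0 - C.P w) := by abel
      have e2 : y - x0 = (y - z) + (z - w) + -(x0 - w) := by abel
      have e3 := norm_add₃_le (a := -(C.P y - C.P z)) (b := (C.P y - C.P x0))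
        (c := (C.P x0 - C.P w))
      have e4 := norm_add₃_le (a := y - z) (b := z - w) (c := -(x0 - w))
      rw [← e1, norm_neg] at e3
      rw [← e2, norm_neg] at e4
      have := C.h_nonneg δ z
      have := C.h_nonneg δ w
      linarith
    · rw [← ENNReal.ofReal_mul (by positivity)]
      apply ENNReal.ofReal_le_ofReal
      rw [mul_assoc, ← mul_pow]
      have : 0 < h0 := h1
      gcongr
      linarith

theorem exists_nearmin (hne : C.F1.Nonempty) (τ : ℝ) (hτ : 0 < τ) (p : Eu n) :
    ∃ z ∈ C.F1, ∀ z' ∈ C.F1, ‖p - C.P z‖ + C.h δ z ≤ ‖p - C.P z'‖ + C.h δ z' + τ := by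
  have hne' : ((fun z => ‖p - C.P z‖ + C.h δ z) '' C.F1).Nonempty := hne.image _
  have hbdd : BddBelow ((fun z => ‖p - C.P z‖ + C.h δ z) '' C.F1) := by
    refine ⟨0, ?_⟩
    rintro _ ⟨z, -, rfl⟩
    have := C.h_nonneg δ z
    positivity
  obtain ⟨_, ⟨z, hz, rfl⟩, h1⟩ := exists_lt_of_csInf_lt hne' (lt_add_of_pos_right _ hτ)
  refine ⟨z, hz, fun z' hz' => ?_⟩
  have := csInf_le hbdd ⟨z', hz', rfl⟩
  simp only at h1 this
  linarith

theorem FL_IIb_pt {K : ℝ} (hfac : C.Fac δ K) {x z w : Eu d} {p : Eu n} {k : ℕ} (hk : 15 ≤ k)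
    (hx : x ∈ C.F1) (hz : z ∈ C.F1) (hw : w ∈ C.F1) (hh : C.h δ x = tk k)
    (hz1 : ‖C.P x - C.P z‖ + C.h δ z < tk k / 65536) (hz2 : tk k / 16 < ‖x - z‖)
    (hp : ‖p - C.P x‖ ≤ 4 * (tk k / 65536))
    (hw1 : ‖p - C.P w‖ + C.h δ w ≤ ‖p - C.P z‖ + C.h δ z + tk k / 65536) :
    C.G δ w (k - 7) ∧ x ∈ closedBall w (tk (k - 7)) ∧
      tk k / 128 < ‖x - ap (C.sa δ w (k - 7)) (C.P x)‖ := by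
  have t0 := tk_pos k
  have h7 : tk (k - 7) = 128 * tk k := by
    have : k = (k - 7) + 7 := by omega
    conv_rhs => rw [this, tk_add]
    have h2 : tk 7 = 1 / 128 := by norm_num [tk]
    rw [h2]; ring
  have h12 : tk (k + 12) = tk k / 4096 := by
    rw [tk_add]
    have h2 : tk 12 = 1 / 4096 := by norm_num [tk]
    rw [h2]; ring
  have hw0 := C.h_nonneg δ w
  have hz0 := C.h_nonneg δ z
  have a1 : ‖p - C.P z‖ ≤ ‖p - C.P x‖ + ‖C.P x - C.P z‖ := norm_sub_le_norm_sub_add_norm_sub ..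
  have a2 : ‖C.P x - C.P w‖ ≤ ‖C.P x - p‖ + ‖p - C.P w‖ := norm_sub_le_norm_sub_add_norm_sub ..
  rw [norm_sub_rev (C.P x) p] at a2
  have a3 : ‖C.P z - C.P w‖ ≤ ‖C.P z - C.P x‖ + ‖C.P x - C.P w‖ :=
    norm_sub_le_norm_sub_add_norm_sub ..
  rw [norm_sub_rev (C.P z) (C.P x)] at a3
  have np := norm_nonneg (p - C.P w)
  have nq := norm_nonneg (C.P x - C.P z)
  have b1 := hfac.cone x hx w hw
  have b2 := hfac.cone z hz w hw
  rw [hh] at b1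
  have hG : C.G δ w (k - 7) := C.G_of_h δ (by rw [h7]; linarith)
  have hG2 : C.G δ w (k + 12) := C.G_of_h δ (by rw [h12]; linarith)
  refine ⟨hG, ?_, ?_⟩
  · rw [mem_closedBall, dist_eq_norm, h7]; linarith
  · have c1 := hfac.near w hw.1 w (k - 7) (k + 12) hG hG2.1
      (closedBall_subset_closedBall (by rw [h7, h12]; linarith)) (by omega)
    rw [h12] at c1
    have c2 := (C.sa_spec δ hG).2.1
    have c3 := C.norm_of_sl c2
    have c4 : ‖ap (C.sa δ w (k - 7)) (C.P x) - ap (C.sa δ w (k - 7)) (C.P w)‖ ≤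
        (1 + 1 / 2) * ‖C.P x - C.P w‖ := by
      rw [ap_sub]; exact ((C.sa δ w (k - 7)).2.le_opNorm _).trans (by gcongr)
    have c5 : ‖x - z‖ ≤ ‖x - w‖ + ‖w - z‖ := norm_sub_le_norm_sub_add_norm_sub ..
    rw [norm_sub_rev w z] at c5
    have e : x - w = (x - ap (C.sa δ w (k - 7)) (C.P x)) +
      (ap (C.sa δ w (k - 7)) (C.P x) - ap (C.sa δ w (k - 7)) (C.P w)) +
      -(w - ap (C.sa δ w (k - 7)) (C.P w)) := by abel
    have e4 := norm_add₃_le (a := x - ap (C.sa δ w (k - 7)) (C.P x))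
      (b := ap (C.sa δ w (k - 7)) (C.P x) - ap (C.sa δ w (k - 7)) (C.P w))
      (c := -(w - ap (C.sa δ w (k - 7)) (C.P w)))
    rw [← e, norm_neg] at e4
    linarith

/-- third part of the low density points -/
def S3 (k : ℕ) : Set (Eu d) := {x | x ∈ C.F1 ∧ C.h δ x = tk k ∧ ∃ z ∈ C.F1,
  ‖C.P x - C.P z‖ + C.h δ z < C.h δ x / 65536 ∧ C.h δ x / 16 < ‖x - z‖}

theorem FL_IIb_k {K : ℝ} (hfac : C.Fac δ K) (k N : ℕ) (hk : 15 ≤ k) (hkN : k ≤ N)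
    (w : Eu n → Eu d) (hw : ∀ p, w p ∈ C.F1 ∧ ∀ z' ∈ C.F1, ‖p - C.P (w p)‖ + C.h δ (w p) ≤
      ‖p - C.P z'‖ + C.h δ z' + tk N / 65536) :
    C.m (C.S3 δ k) ≤ ∫⁻ p, (closedBall (0 : Eu n) 1).indicator
      (fun p => ENNReal.ofReal (16 * 128 ^ (n + 4) * 65536 ^ n * C.b (w p) (k - 7) ^ 2) / c1 n) p
        ∂μH[(n : ℝ)] := by
  have t0 := tk_pos k
  have hle : tk k ≤ 1 / 32768 := by
    have := tk_anti hk
    have h2 : tk 15 = 1 / 32768 := by norm_num [tk]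
    rwa [h2] at this
  have hNk := tk_anti hkN
  refine lemV C.m C.P _ (fun _ => tk k / 65536) (tk k / 65536) (fun x _ => ⟨by positivity, le_rfl⟩)
    _ ?_
  intro x0 hx0
  set T := C.S3 δ k ∩ {x | ‖C.P x - C.P x0‖ ≤ 3 * (tk k / 65536) ∧
    tk k / 65536 ≤ 2 * (tk k / 65536)} with hT
  set V := μH[(n : ℝ)] (closedBall (C.P x0) (tk k / 65536)) with hV
  have hV1 : V = ENNReal.ofReal ((tk k / 65536) ^ n) * c1 n := vol_ball _ _ (by positivity)
  have hV0 : V ≠ 0 := by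
    rw [hV1]; refine mul_ne_zero ?_ (c1_pos n)
    have : 0 < (tk k / 65536) ^ n := by positivity
    simpa using this
  have hVt : V ≠ ⊤ := by
    rw [hV1]; exact ENNReal.mul_ne_top ENNReal.ofReal_ne_top (c1_top n)
  refine ⟨C.m T / V, ?_, ?_⟩
  · rw [ENNReal.div_mul_cancel hV0 hVt]
  · intro p hp
    rw [mem_closedBall, dist_eq_norm] at hp
    rw [indicator_of_mem]
    · rw [ENNReal.div_le_iff hV0 hVt, hV1, mul_comm (ENNReal.ofReal ((tk k / 65536) ^ n)),
        ← mul_assoc, ENNReal.div_mul_cancel (c1_pos n) (c1_top n)]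
      have hpt : ∀ x ∈ T, C.G δ (w p) (k - 7) ∧ x ∈ closedBall (w p) (tk (k - 7)) ∧
          tk k / 128 < ‖x - ap (C.sa δ (w p) (k - 7)) (C.P x)‖ := by
        rintro x ⟨⟨hx, hh, z, hz, hz1, hz2⟩, hx1, -⟩
        rw [hh] at hz1 hz2
        have hx2 : ‖C.P x - C.P x0‖ ≤ 3 * (tk k / 65536) := hx1
        refine C.FL_IIb_pt δ hfac (p := p) hk hx hz (hw p).1 hh hz1 hz2 ?_ ?_
        · have : ‖p - C.P x‖ ≤ ‖p - C.P x0‖ + ‖C.P x0 - C.P x‖ :=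
            norm_sub_le_norm_sub_add_norm_sub ..
          rw [norm_sub_rev (C.P x0)] at this
          linarith
        · have := (hw p).2 z hz
          linarith
      by_cases hTe : T = ∅
      · rw [hTe]; simp
      obtain ⟨x, hx⟩ := nonempty_iff_ne_empty.2 hTe
      have hG := (hpt x hx).1
      have hW := (C.sa_spec δ hG).2.2 (tk k / 128) (by positivity)
      refine (measure_mono fun y hy => (hpt y hy).2).trans (hW.trans ?_)
      rw [← ENNReal.ofReal_mul (by positivity)]
      apply ENNReal.ofReal_le_ofReal
      have h7 : tk (k - 7) = 128 * tk k := by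
        have : k = (k - 7) + 7 := by omega
        conv_rhs => rw [this, tk_add]
        have h2 : tk 7 = 1 / 128 := by norm_num [tk]
        rw [h2]; ring
      rw [h7]
      apply le_of_eq
      have : (65536 : ℝ) ^ n ≠ 0 := by positivity
      rw [div_pow, div_pow]
      field_simp
      ring
    · rw [mem_closedBall_zero_iff]
      have h2 := norm_add_le (p - C.P x0) (C.P x0)
      rw [sub_add_cancel] at h2
      have := C.F1_P hx0.1
      linarith

theorem FL_IIb {K : ℝ} (hfac : C.Fac δ K) (hne : C.F1.Nonempty) :
    C.m (⋃ k ∈ Ici 15, C.S3 δ k) ≤ ENNReal.ofReal (16 * 128 ^ (n + 4) * 65536 ^ n * eps) := by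
  have key : ∀ N, C.m (⋃ k ∈ Finset.Icc 15 N, C.S3 δ k) ≤
      ENNReal.ofReal (16 * 128 ^ (n + 4) * 65536 ^ n * eps) := by
    intro N
    choose w hw1 hw2 using fun p => C.exists_nearmin δ hne (tk N / 65536)
      (by have := tk_pos N; positivity) p
    calc C.m (⋃ k ∈ Finset.Icc 15 N, C.S3 δ k) ≤ ∑ k ∈ Finset.Icc 15 N, C.m (C.S3 δ k) :=
          measure_biUnion_finset_le _ _
      _ ≤ ∑ k ∈ Finset.Icc 15 N, ∫⁻ p, (closedBall (0 : Eu n) 1).indicator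
          (fun p => ENNReal.ofReal (16 * 128 ^ (n + 4) * 65536 ^ n * C.b (w p) (k - 7) ^ 2) / c1 n) p
        ∂μH[(n : ℝ)] := by
          refine Finset.sum_le_sum fun k hk => ?_
          rw [Finset.mem_Icc] at hk
          exact C.FL_IIb_k δ hfac k N hk.1 hk.2 w fun p => ⟨hw1 p, hw2 p⟩
      _ ≤ _ := le_lintegral_finset _ _ _
      _ ≤ ∫⁻ p, (closedBall (0 : Eu n) 1).indicator
        (fun p => ENNReal.ofReal (16 * 128 ^ (n + 4) * 65536 ^ n * eps) / c1 n) p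
          ∂μH[(n : ℝ)] := by
          refine lintegral_mono fun p => ?_
          by_cases hp : p ∈ closedBall (0 : Eu n) 1
          · simp only [indicator_of_mem hp]
            simp only [div_eq_mul_inv]
            rw [← Finset.sum_mul, ← ENNReal.ofReal_sum_of_nonneg (fun i _ => by positivity),
              ← Finset.mul_sum]
            gcongr
            refine le_trans ?_ (C.hbs (w p) (hw1 p).1 (N + 1))
            rw [← Finset.sum_image (s := Finset.Icc 15 N) (g := fun k => k - 7)
              (f := fun k => C.b (w p) k ^ 2)]
            · refine Finset.sum_le_sum_of_subset_of_nonneg ?_ fun i _ _ => sq_nonneg _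
              intro i hi
              obtain ⟨j, hj, rfl⟩ := Finset.mem_image.1 hi
              rw [Finset.mem_Icc] at hj
              rw [Finset.mem_range]
              omega
            · intro i hi j hj hij
              simp only [Finset.coe_Icc, mem_Icc] at hi hj
              simp only at hij
              omega
          · simp only [indicator_of_notMem hp]; simp
      _ = _ := by
          rw [lintegral_indicator isClosed_closedBall.measurableSet, setLIntegral_const,
            vol_ball _ _ zero_le_one]
          simp only [one_pow, ENNReal.ofReal_one, one_mul]
          rw [ENNReal.div_mul_cancel (c1_pos n) (c1_top n)]
  have hU : (⋃ k ∈ Ici 15, C.S3 δ k) = ⋃ N, ⋃ k ∈ Finset.Icc 15 N, C.S3 δ k := by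
    ext x
    simp only [mem_iUnion, mem_Ici, Finset.mem_Icc, exists_prop]
    constructor
    · rintro ⟨k, hk, hx⟩; exact ⟨k, k, ⟨hk, le_rfl⟩, hx⟩
    · rintro ⟨N, k, hk, hx⟩; exact ⟨k, hk.1, hx⟩
  rw [hU, Monotone.measure_iUnion]
  · exact iSup_le key
  · intro N N' hN
    refine biUnion_subset_biUnion_left ?_
    intro k hk
    simp only [Finset.coe_Icc, mem_Icc] at hk ⊢
    exact ⟨hk.1, hk.2.trans hN⟩

theorem FL_bound (n d : ℕ) : ∃ C1 C2 : ℝ, 0 ≤ C1 ∧ 0 ≤ C2 ∧ ∀ (lam eps : ℝ)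
    (C : Cfg n d lam eps) (δ K : ℝ), 0 ≤ δ → 0 ≤ eps → C.Fac δ K → C.F1.Nonempty →
    C.m (C.FL δ) ≤ ENNReal.ofReal (C1 * δ + C2 * eps) := by
  obtain ⟨N, hN⟩ := FL_I d
  refine ⟨N * 524288 ^ n + 524288 ^ n, 16 * 128 ^ (n + 4) * 65536 ^ n, by positivity,
    by positivity, fun lam eps C δ K hδ he hfac hne => ?_⟩
  have h1 := hN n lam eps C δ K hδ hfac
  have h2 := C.FL_IIa δ hδ hfac
  have h3 := C.FL_IIb δ hfac hne
  refine (measure_mono ?_).trans ((measure_union_le _ _).trans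
    ((add_le_add ((measure_union_le _ _).trans (add_le_add h1 h2)) h3).trans (le_of_eq ?_)))
  · intro x hx
    by_cases hI : ∀ z ∈ C.F1, C.h δ x / 65536 ≤ ‖C.P x - C.P z‖ + C.h δ z
    · exact Or.inl (Or.inl ⟨hx, hI⟩)
    push Not at hI
    obtain ⟨z, hz, hz1⟩ := hI
    by_cases hII : ‖x - z‖ ≤ C.h δ x / 16
    · exact Or.inl (Or.inr ⟨hx, z, hz, hz1, hII⟩)
    push Not at hII
    obtain ⟨hx1, k, hk, hk1, -⟩ := hx
    exact Or.inr (mem_iUnion₂.2 ⟨k, hk, hx1, hk1, z, hz, hz1, hII⟩)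
  · rw [← ENNReal.ofReal_add (by positivity) (by positivity),
      ← ENNReal.ofReal_add (by positivity) (by positivity)]
    congr 1
    ring

end Cfg

end

section

namespace Tree

variable {n d : ℕ}

/-- energy of difference quotients -/
noncomputable def Ph (f : Eu n → Eu d) (D : Eu n → ℝ) (e : Eu n) (k : ℕ) : ℝ≥0∞ :=
  ∫⁻ u in {u | D u < 4 * tk k}, ENNReal.ofReal (‖f (u + tk k • e) - f u‖ ^ 2 / tk k ^ 2) ∂μH[(n : ℝ)]

/-- energy of second differences -/
noncomputable def Il (f : Eu n → Eu d) (D : Eu n → ℝ) (e : Eu n) (k : ℕ) : ℝ≥0∞ :=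
  ∫⁻ u in {u | D u < 4 * tk k},
    ENNReal.ofReal (‖(f (u + tk (k + 1) • e) - f u) -
      (f (u + tk k • e) - f (u + tk (k + 1) • e))‖ ^ 2 / tk k ^ 2) ∂μH[(n : ℝ)]

/-- stopped energy -/
noncomputable def Lf (f : Eu n → Eu d) (D : Eu n → ℝ) (e : Eu n) (k : ℕ) : ℝ≥0∞ :=
  ∫⁻ u in {u | 4 * tk (k + 1) ≤ D u ∧ D u < 4 * tk k},
    ENNReal.ofReal (‖f (u + tk (k + 1) • e) - f u‖ ^ 2 / tk (k + 1) ^ 2) ∂μH[(n : ℝ)]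

theorem step (f : Eu n → Eu d) (hf : Measurable f) (D : Eu n → ℝ) (hD : Measurable D)
    (hDL : ∀ u v, D u ≤ D v + ‖u - v‖) (e : Eu n) (he : ‖e‖ = 1) (k : ℕ) :
    2 * Ph f D e (k + 1) + Lf f D e k ≤ 2 * Ph f D e k + 2 * Il f D e k := by
  have t0 := tk_pos k
  have hms : ∀ t : ℝ, MeasurableSet {u | D u < t} := fun t => measurableSet_lt hD measurable_const
  have hX : Measurable fun u => ENNReal.ofReal
      (‖f (u + tk (k + 1) • e) - f u‖ ^ 2 / tk (k + 1) ^ 2) := by fun_prop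
  have hY : Measurable fun u => ENNReal.ofReal
      (‖f (u + tk k • e) - f (u + tk (k + 1) • e)‖ ^ 2 / tk (k + 1) ^ 2) := by fun_prop
  have hS : Measurable fun u => ENNReal.ofReal (‖f (u + tk k • e) - f u‖ ^ 2 / tk k ^ 2) := by
    fun_prop
  have hI : Measurable fun u => ENNReal.ofReal (‖(f (u + tk (k + 1) • e) - f u) -
      (f (u + tk k • e) - f (u + tk (k + 1) • e))‖ ^ 2 / tk k ^ 2) := by fun_prop
  have e1 : 2 * Ph f D e k + 2 * Il f D e k =
      (∫⁻ u in {u | D u < 4 * tk k}, ENNReal.ofReal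
      (‖f (u + tk (k + 1) • e) - f u‖ ^ 2 / tk (k + 1) ^ 2) ∂μH[(n : ℝ)]) +
      ∫⁻ u in {u | D u < 4 * tk k}, ENNReal.ofReal
      (‖f (u + tk k • e) - f (u + tk (k + 1) • e)‖ ^ 2 / tk (k + 1) ^ 2) ∂μH[(n : ℝ)] := by
    rw [← lintegral_add_left hX, ← mul_add, Ph, Il, ← lintegral_add_left hS,
      ← lintegral_const_mul' _ _ (by norm_num)]
    congr 1
    ext u
    rw [← ENNReal.ofReal_add (by positivity) (by positivity),
      ← ENNReal.ofReal_add (by positivity) (by positivity)]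
    have h2m : ∀ x : ℝ, 2 * ENNReal.ofReal x = ENNReal.ofReal (2 * x) := by
      intro x
      rw [ENNReal.ofReal_mul (by norm_num)]; simp
    rw [h2m]
    congr 1
    set X := f (u + tk (k + 1) • e) - f u
    set Y := f (u + tk k • e) - f (u + tk (k + 1) • e)
    have hXY : f (u + tk k • e) - f u = X + Y := by simp only [X, Y]; abel
    rw [hXY, tk_succ]
    have := parallelogram_law_with_norm ℝ X Y
    field_simp
    nlinarith
  have e2 : Ph f D e (k + 1) + Lf f D e k = ∫⁻ u in {u | D u < 4 * tk k}, ENNReal.ofReal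
      (‖f (u + tk (k + 1) • e) - f u‖ ^ 2 / tk (k + 1) ^ 2) ∂μH[(n : ℝ)] := by
    rw [Ph, Lf, ← lintegral_union]
    · congr 2
      ext u
      have := tk_lt (Nat.lt_succ_self k)
      simp only [Nat.succ_eq_add_one] at this
      change (D u < 4 * tk (k + 1) ∨ 4 * tk (k + 1) ≤ D u ∧ D u < 4 * tk k) ↔ D u < 4 * tk k
      constructor
      · rintro (h | h)
        · linarith
        · exact h.2
      · intro h
        rcases lt_or_ge (D u) (4 * tk (k + 1)) with h' | h'
        · exact Or.inl h'
        · exact Or.inr ⟨h', h⟩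
    · exact (measurableSet_le measurable_const hD).inter (hms _)
    · rw [Set.disjoint_left]
      intro u h1 h2
      exact absurd h2.1 (not_le.2 h1)
  have e3 : Ph f D e (k + 1) ≤ ∫⁻ u in {u | D u < 4 * tk k}, ENNReal.ofReal
      (‖f (u + tk k • e) - f (u + tk (k + 1) • e)‖ ^ 2 / tk (k + 1) ^ 2) ∂μH[(n : ℝ)] := by
    have h1 : Ph f D e (k + 1) = ∫⁻ u in {u | D (u + tk (k + 1) • e) < 4 * tk (k + 1)},
        ENNReal.ofReal (‖f (u + tk k • e) - f (u + tk (k + 1) • e)‖ ^ 2 / tk (k + 1) ^ 2)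
          ∂μH[(n : ℝ)] := by
      have hms2 : MeasurableSet {u | D (u + tk (k + 1) • e) < 4 * tk (k + 1)} :=
        measurableSet_lt (hD.comp (measurable_add_const _)) measurable_const
      rw [Ph, ← lintegral_indicator (hms _),
        ← lintegral_indicator hms2]
      rw [← lintegral_add_right_eq_self _ (tk (k + 1) • e)]
      congr 1
      ext u
      have : u + tk (k + 1) • e + tk (k + 1) • e = u + tk k • e := by
        rw [add_assoc, ← add_smul, tk_succ]; congr 2; ring
      simp only [indicator, mem_ofPred_eq, this]
    rw [h1]
    refine lintegral_mono_set ?_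
    intro u hu
    change D u < _
    have h2 : D (u + tk (k + 1) • e) < 4 * tk (k + 1) := hu
    have h3 := hDL u (u + tk (k + 1) • e)
    rw [sub_add_cancel_left, norm_neg, norm_smul, he, Real.norm_of_nonneg (tk_pos _).le,
      mul_one] at h3
    rw [tk_succ] at h2 h3
    linarith
  rw [e1, ← e2, two_mul]
  calc Ph f D e (k + 1) + Ph f D e (k + 1) + Lf f D e k
      = (Ph f D e (k + 1) + Lf f D e k) + Ph f D e (k + 1) := by ring
    _ ≤ _ := by gcongr

theorem tot (f : Eu n → Eu d) (hf : Measurable f) (D : Eu n → ℝ) (hD : Measurable D)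
    (hDL : ∀ u v, D u ≤ D v + ‖u - v‖) (e : Eu n) (he : ‖e‖ = 1) (k0 N : ℕ) :
    2 * Ph f D e (k0 + N) + ∑ j ∈ Finset.range N, Lf f D e (k0 + j) ≤
      2 * Ph f D e k0 + 2 * ∑ j ∈ Finset.range N, Il f D e (k0 + j) := by
  induction N with
  | zero => simp
  | succ N ih =>
    rw [Finset.sum_range_succ, Finset.sum_range_succ, mul_add, ← add_assoc (2 * Ph f D e k0)]
    have := step f hf D hD hDL e he (k0 + N)
    calc _ = (2 * Ph f D e (k0 + N + 1) + Lf f D e (k0 + N)) +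
          ∑ j ∈ Finset.range N, Lf f D e (k0 + j) := by rw [← add_assoc k0]; ring
      _ ≤ (2 * Ph f D e (k0 + N) + 2 * Il f D e (k0 + N)) +
          ∑ j ∈ Finset.range N, Lf f D e (k0 + j) := by gcongr
      _ = (2 * Ph f D e (k0 + N) + ∑ j ∈ Finset.range N, Lf f D e (k0 + j)) +
          2 * Il f D e (k0 + N) := by ring
      _ ≤ _ := by gcongr

end Tree

end

section

/-- tail sums -/
noncomputable def tl (N : ℕ) (b : ℕ → ℝ) (j : ℕ) : ℝ := ∑ i ∈ Finset.Icc j N, b i * tk i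

theorem tl_nonneg (N : ℕ) (b : ℕ → ℝ) (hb : ∀ i, 0 ≤ b i) (j : ℕ) : 0 ≤ tl N b j :=
  Finset.sum_nonneg fun i _ => mul_nonneg (hb i) (tk_pos i).le

theorem tl_rec (N : ℕ) (b : ℕ → ℝ) (hb : ∀ i, 0 ≤ b i) (j : ℕ) :
    (tl N b j / tk j) ^ 2 ≤ 2 * b j ^ 2 + (tl N b (j + 1) / tk (j + 1)) ^ 2 / 2 := by
  by_cases h : j ≤ N
  · have h1 : tl N b j = b j * tk j + tl N b (j + 1) := by
      unfold tl
      rw [← Finset.insert_Icc_add_one_left_eq_Icc h, Finset.sum_insert (by simp)]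
    have t0 := tk_pos j
    have h2 : tl N b j / tk j = b j + (tl N b (j + 1) / tk (j + 1)) / 2 := by
      rw [h1, tk_succ]; field_simp
    rw [h2]
    nlinarith [sq_nonneg (b j - (tl N b (j + 1) / tk (j + 1)) / 2)]
  · have h1 : tl N b j = 0 := by
      unfold tl; rw [Finset.Icc_eq_empty h]; simp
    rw [h1, zero_div, zero_pow two_ne_zero]; positivity

theorem tl_hardy (N : ℕ) (b : ℕ → ℝ) (hb : ∀ i, 0 ≤ b i) (eps : ℝ)
    (hs : ∀ T, ∑ k ∈ Finset.range T, b k ^ 2 ≤ eps) (T : ℕ) :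
    ∑ k ∈ Finset.range T, (tl N b k / tk k) ^ 2 ≤ 4 * eps := by
  have h : ∀ T, ∑ k ∈ Finset.range T, (tl N b k / tk k) ^ 2 ≤
      4 * ∑ k ∈ Finset.range T, b k ^ 2 + (tl N b T / tk T) ^ 2 := by
    intro T
    induction T with
    | zero => simp; positivity
    | succ T ih =>
      rw [Finset.sum_range_succ, Finset.sum_range_succ]
      have := tl_rec N b hb T
      linarith
  have h0 : ∀ T, N < T → tl N b T = 0 := by
    intro T hT
    unfold tl; rw [Finset.Icc_eq_empty (not_le.2 hT)]; simp
  have h1 := h (max T (N + 1))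
  rw [h0 _ (by omega)] at h1
  have h2 := hs (max T (N + 1))
  have h3 : ∑ k ∈ Finset.range T, (tl N b k / tk k) ^ 2 ≤
      ∑ k ∈ Finset.range (max T (N + 1)), (tl N b k / tk k) ^ 2 :=
    Finset.sum_le_sum_of_subset_of_nonneg (Finset.range_mono (le_max_left _ _))
      fun i _ _ => sq_nonneg _
  simp only [zero_div] at h1
  linarith

/-- finite separated family of stopped points -/
structure Fam {n d : ℕ} {lam eps : ℝ} (C : Cfg n d lam eps) (δ : ℝ) where
  M : ℕ
  hM : 0 < M
  x : ℕ → Eu d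
  κ : ℕ → ℕ
  N : ℕ
  hx : ∀ i < M, x i ∈ C.F1
  hh : ∀ i < M, C.h δ (x i) = tk (κ i)
  hκ : ∀ i < M, 15 ≤ κ i
  hN : ∀ i < M, κ i + 2 ≤ N
  sep : ∀ i < M, ∀ j < M, i ≠ j → 5 * tk (κ i) + 5 * tk (κ j) ≤ ‖C.P (x i) - C.P (x j)‖

namespace Fam

variable {n d : ℕ} {lam eps : ℝ} {C : Cfg n d lam eps} {δ : ℝ} (Φ : Fam C δ)

/-- weighted distance to a family member -/
noncomputable def g (i : ℕ) (p : Eu n) : ℝ := ‖p - C.P (Φ.x i)‖ + tk (Φ.κ i)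

/-- regularised distance -/
noncomputable def D (p : Eu n) : ℝ :=
  (Finset.range Φ.M).inf' ⟨0, Finset.mem_range.2 Φ.hM⟩ fun i => Φ.g i p

theorem ex_idx (p : Eu n) : ∃ i, i < Φ.M ∧ Φ.g i p = Φ.D p := by
  obtain ⟨i, hi, h⟩ := Finset.exists_mem_eq_inf' (s := Finset.range Φ.M)
    ⟨0, Finset.mem_range.2 Φ.hM⟩ (fun i => Φ.g i p)
  exact ⟨i, Finset.mem_range.1 hi, h.symm⟩

theorem D_le {i : ℕ} (hi : i < Φ.M) (p : Eu n) : Φ.D p ≤ Φ.g i p :=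
  Finset.inf'_le (fun i => Φ.g i p) (Finset.mem_range.2 hi)

open Classical in
/-- index of the minimiser -/
noncomputable def idx (p : Eu n) : ℕ := Nat.find (Φ.ex_idx p)

theorem idx_lt (p : Eu n) : Φ.idx p < Φ.M := by
  classical
  exact (Nat.find_spec (Φ.ex_idx p)).1

theorem idx_eq (p : Eu n) : Φ.g (Φ.idx p) p = Φ.D p := by
  classical
  exact (Nat.find_spec (Φ.ex_idx p)).2

open Classical in
/-- scale -/
noncomputable def kp (p : Eu n) : ℕ := Nat.findGreatest (fun k => Φ.D p ≤ 3 / 2 * tk k) Φ.N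

/-- closest point -/
noncomputable def Z (p : Eu n) : Eu d := Φ.x (Φ.idx p)

/-- approximating function -/
noncomputable def A (p : Eu n) : Eu d := ap (C.sa δ (Φ.Z p) (Φ.kp p)) p

theorem D_lip (u v : Eu n) : Φ.D u ≤ Φ.D v + ‖u - v‖ := by
  rw [← Φ.idx_eq v]
  refine (Φ.D_le (Φ.idx_lt v) u).trans ?_
  unfold g
  have : ‖u - C.P (Φ.x (Φ.idx v))‖ ≤ ‖u - v‖ + ‖v - C.P (Φ.x (Φ.idx v))‖ :=
    norm_sub_le_norm_sub_add_norm_sub ..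
  linarith

theorem D_meas : Measurable Φ.D := by
  have : LipschitzWith 1 Φ.D := LipschitzWith.of_le_add fun u v => by
    rw [dist_eq_norm]; exact Φ.D_lip u v
  exact this.continuous.measurable

theorem idx_meas : Measurable Φ.idx := by
  classical
  unfold idx
  refine measurable_find (fun p => Φ.ex_idx p) fun k => ?_
  have hg : Measurable (Φ.g k) := by unfold g; fun_prop
  exact (MeasurableSet.const _).inter (measurableSet_eq_fun hg Φ.D_meas)

theorem kp_meas : Measurable Φ.kp := by
  classical
  unfold kp
  exact measurable_findGreatest fun k _ => measurableSet_le Φ.D_meas measurable_const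

theorem A_meas : Measurable Φ.A := by
  have h2 : Measurable fun p => ((Φ.idx p, Φ.kp p), p) :=
    (Φ.idx_meas.prodMk Φ.kp_meas).prodMk measurable_id
  have h3 : ∀ φ : ℕ × ℕ → Eu d × (Eu n →L[ℝ] Eu d),
      Measurable fun q : (ℕ × ℕ) × Eu n => ap (φ q.1) q.2 := fun φ =>
    measurable_from_prod_countable_right fun q => (ap_cont (φ q)).measurable
  have h4 := (h3 fun q => C.sa δ (Φ.x q.1) q.2).comp h2
  have h5 : Φ.A = (fun q : (ℕ × ℕ) × Eu n => ap (C.sa δ (Φ.x q.1.1) q.1.2) q.2) ∘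
      fun p => ((Φ.idx p, Φ.kp p), p) := by
    funext p
    simp only [Function.comp, A, Z]
  rw [h5]
  exact h4

theorem Z_mem (p : Eu n) : Φ.Z p ∈ C.F1 := Φ.hx _ (Φ.idx_lt p)

theorem D_eq (p : Eu n) : Φ.D p = ‖p - C.P (Φ.Z p)‖ + C.h δ (Φ.Z p) := by
  rw [← Φ.idx_eq p, Z, Φ.hh _ (Φ.idx_lt p)]; rfl

theorem le_kp {p : Eu n} {j : ℕ} (hj : j ≤ Φ.N) (h : Φ.D p ≤ 3 / 2 * tk j) : j ≤ Φ.kp p := by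
  classical
  exact Nat.le_findGreatest hj h

theorem kp_spec {p : Eu n} (h : Φ.D p ≤ 3 / 2) : Φ.D p ≤ 3 / 2 * tk (Φ.kp p) := by
  classical
  have h0 : Φ.D p ≤ 3 / 2 * tk 0 := by rw [tk_zero]; linarith
  exact Nat.findGreatest_spec (P := fun k => Φ.D p ≤ 3 / 2 * tk k) (Nat.zero_le Φ.N) h0

theorem kp_le (p : Eu n) : Φ.kp p ≤ Φ.N := by
  classical
  exact Nat.findGreatest_le _

theorem hZ_kp {p : Eu n} (h : Φ.D p ≤ 3 / 2) : C.h δ (Φ.Z p) ≤ tk (Φ.kp p) := by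
  have h1 := Φ.kp_spec h
  have h2 := Φ.D_eq p
  have h3 := norm_nonneg (p - C.P (Φ.Z p))
  rw [Z, Φ.hh _ (Φ.idx_lt p)] at h2 ⊢
  rcases Nat.eq_zero_or_pos (Φ.kp p) with h0 | h0
  · rw [h0, tk_zero]; exact tk_le_one _
  · apply tk_anti
    have : tk (Φ.κ (Φ.idx p)) < tk (Φ.kp p - 1) := by
      have h4 : tk (Φ.kp p) = tk (Φ.kp p - 1) / 2 := by
        rw [← tk_succ]; congr 1; omega
      have := tk_pos (Φ.kp p - 1)
      rw [Z] at h3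
      linarith
    have := lt_of_tk this
    omega

/-- tail at a point -/
noncomputable def gg (p : Eu n) (j : ℕ) : ℝ := tl Φ.N (C.b (Φ.Z p)) j

theorem gg_nonneg (p : Eu n) (j : ℕ) : 0 ≤ Φ.gg p j := tl_nonneg _ _ (fun i => C.hb0 _ i) _

theorem tele {K : ℝ} (hK : 0 ≤ K) (hfac : C.Fac δ K) {p : Eu n} (hD : Φ.D p ≤ 3 / 2) {j : ℕ}
    (hj : j ≤ Φ.kp p) :
    ‖Φ.A p - ap (C.sa δ (Φ.Z p) j) p‖ ≤ 2 * K * Φ.gg p j := by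
  have hb0 : ∀ i, 0 ≤ C.b (Φ.Z p) i * tk i := fun i => mul_nonneg (C.hb0 _ _) (tk_pos i).le
  have hG : ∀ i ≤ Φ.kp p, C.G δ (Φ.Z p) i := fun i hi =>
    C.G_of_h δ ((Φ.hZ_kp hD).trans (tk_anti hi))
  have key : ∀ t, j + t ≤ Φ.kp p → ‖ap (C.sa δ (Φ.Z p) (j + t)) p - ap (C.sa δ (Φ.Z p) j) p‖ ≤
      K * (2 * ∑ i ∈ Finset.range (t + 1), C.b (Φ.Z p) (j + i) * tk (j + i) -
        C.b (Φ.Z p) (j + t) * tk (j + t)) := by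
    intro t
    induction t with
    | zero =>
      intro _
      simp only [add_zero, sub_self, norm_zero, zero_add, Finset.range_one, Finset.sum_singleton]
      have := hb0 j
      apply mul_nonneg hK
      linarith
    | succ t ih =>
      intro ht
      have ih := ih (by omega)
      have hstep := hfac.cmp (Φ.Z p) (Φ.Z_mem p).1 (Φ.Z p) (Φ.Z_mem p).1 (Φ.Z p) (j + t + 1)
        (j + t) (j + t + 1) (hG _ (by omega)) (hG _ (by omega)) (hG _ (by omega)).1
        (closedBall_subset_closedBall le_rfl)
        (closedBall_subset_closedBall (tk_anti (by omega))) (by omega) (by omega) p (by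
          have h1 := Φ.kp_spec hD
          have h2 := Φ.D_eq p
          have h3 := C.h_nonneg δ (Φ.Z p)
          have h4 := tk_anti (k := j + t + 1) (l := Φ.kp p) (by omega)
          have := tk_pos (j + t + 1)
          linarith)
      have htri : ‖ap (C.sa δ (Φ.Z p) (j + (t + 1))) p - ap (C.sa δ (Φ.Z p) j) p‖ ≤
          ‖ap (C.sa δ (Φ.Z p) (j + t + 1)) p - ap (C.sa δ (Φ.Z p) (j + t)) p‖ +
          ‖ap (C.sa δ (Φ.Z p) (j + t)) p - ap (C.sa δ (Φ.Z p) j) p‖ :=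
        norm_sub_le_norm_sub_add_norm_sub ..
      refine htri.trans ((add_le_add hstep ih).trans ?_)
      rw [Finset.sum_range_succ _ (t + 1), ← add_assoc j t 1, tk_succ (j + t)]
      have h5 := hb0 (j + t)
      nlinarith [mul_nonneg hK h5]
  obtain ⟨t, ht⟩ := Nat.exists_eq_add_of_le hj
  have h1 := key t ht.ge
  rw [← ht] at h1
  refine h1.trans ?_
  have h2 : ∑ i ∈ Finset.range (t + 1), C.b (Φ.Z p) (j + i) * tk (j + i) ≤ Φ.gg p j := by
    unfold gg tl
    rw [← Finset.sum_image (s := Finset.range (t + 1)) (g := fun i => j + i)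
      (f := fun i => C.b (Φ.Z p) i * tk i)]
    · refine Finset.sum_le_sum_of_subset_of_nonneg ?_ fun i _ _ => hb0 i
      intro i hi
      obtain ⟨l, hl, rfl⟩ := Finset.mem_image.1 hi
      rw [Finset.mem_range] at hl
      rw [Finset.mem_Icc]
      have := Φ.kp_le p
      omega
    · intro i _ l _ hil
      simpa using hil
  have h3 := hb0 (Φ.kp p)
  nlinarith [mul_le_mul_of_nonneg_left h2 hK, mul_nonneg hK h3]

theorem b_le_gg (p : Eu n) {j : ℕ} (hj : j ≤ Φ.N) : C.b (Φ.Z p) j * tk j ≤ Φ.gg p j := by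
  unfold gg tl
  exact Finset.single_le_sum (f := fun i => C.b (Φ.Z p) i * tk i)
    (fun i _ => mul_nonneg (C.hb0 _ _) (tk_pos i).le) (Finset.mem_Icc.2 ⟨le_rfl, hj⟩)

theorem cross {K : ℝ} (hK : 0 ≤ K) (hfac : C.Fac δ K) {u v : Eu n} {k : ℕ} (hk : 10 ≤ k)
    (hkN : k ≤ Φ.N) (hu : Φ.D u < 4 * tk k) (huv : ‖v - u‖ ≤ tk k) :
    ‖Φ.A v - ap (C.sa δ (Φ.Z u) (k - 10)) v‖ ≤ 3 * K * (Φ.gg v (k - 10) + Φ.gg u (k - 10)) := by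
  have t0 := tk_pos k
  have hv : Φ.D v < 5 * tk k := by
    have := Φ.D_lip v u
    linarith
  have h10 : tk (k - 10) = 1024 * tk k := by
    have : k = (k - 10) + 10 := by omega
    conv_rhs => rw [this, tk_add]
    have h2 : tk 10 = 1 / 1024 := by norm_num [tk]
    rw [h2]; ring
  have h8 : tk (k - 8) = 256 * tk k := by
    have : k = (k - 8) + 8 := by omega
    conv_rhs => rw [this, tk_add]
    have h2 : tk 8 = 1 / 256 := by norm_num [tk]
    rw [h2]; ring
  have h1k : tk (k - 10) ≤ 1 := tk_le_one _
  have hj : k - 10 ≤ Φ.kp v := Φ.le_kp (by omega) (by rw [h10]; linarith)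
  have ht := Φ.tele hK hfac (p := v) (by linarith) hj
  have eu := Φ.D_eq u
  have ev := Φ.D_eq v
  have hu0 := C.h_nonneg δ (Φ.Z u)
  have hv0 := C.h_nonneg δ (Φ.Z v)
  have nu := norm_nonneg (u - C.P (Φ.Z u))
  have nv := norm_nonneg (v - C.P (Φ.Z v))
  have hcone := hfac.cone (Φ.Z u) (Φ.Z_mem u) (Φ.Z v) (Φ.Z_mem v)
  have a1 : ‖C.P (Φ.Z u) - C.P (Φ.Z v)‖ ≤ ‖u - C.P (Φ.Z u)‖ + ‖v - u‖ + ‖v - C.P (Φ.Z v)‖ := by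
    have e : C.P (Φ.Z u) - C.P (Φ.Z v) =
      -(u - C.P (Φ.Z u)) + -(v - u) + (v - C.P (Φ.Z v)) := by abel
    have := norm_add₃_le (a := -(u - C.P (Φ.Z u))) (b := -(v - u)) (c := v - C.P (Φ.Z v))
    rw [← e, norm_neg, norm_neg] at this
    exact this
  have a2 : ‖v - C.P (Φ.Z u)‖ ≤ ‖v - u‖ + ‖u - C.P (Φ.Z u)‖ :=
    norm_sub_le_norm_sub_add_norm_sub ..
  have hGu : ∀ i ≤ k - 8, C.G δ (Φ.Z u) i := fun i hi => C.G_of_h δ (by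
    have := tk_anti hi
    rw [h8] at this
    linarith)
  have hGv : C.G δ (Φ.Z v) (k - 10) := C.G_of_h δ (by rw [h10]; linarith)
  have hc := hfac.cmp (Φ.Z v) (Φ.Z_mem v).1 (Φ.Z u) (Φ.Z_mem u).1 (Φ.Z u) (k - 10) (k - 10) (k - 8)
    hGv (hGu _ (by omega)) (hGu _ le_rfl).1
    (Cfg.ball_sub (by rw [h8, h10]; linarith))
    (closedBall_subset_closedBall (by rw [h8, h10]; linarith)) (by omega) (by omega) v
    (by rw [h8]; linarith)
  have htri : ‖Φ.A v - ap (C.sa δ (Φ.Z u) (k - 10)) v‖ ≤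
      ‖Φ.A v - ap (C.sa δ (Φ.Z v) (k - 10)) v‖ +
      ‖ap (C.sa δ (Φ.Z v) (k - 10)) v - ap (C.sa δ (Φ.Z u) (k - 10)) v‖ :=
    norm_sub_le_norm_sub_add_norm_sub ..
  have b1 := Φ.b_le_gg v (j := k - 10) (by omega)
  have b2 := Φ.b_le_gg u (j := k - 10) (by omega)
  have g1 := Φ.gg_nonneg u (k - 10)
  have hle : K * (C.b (Φ.Z v) (k - 10) + C.b (Φ.Z u) (k - 10)) * tk (k - 8) ≤
      K * (Φ.gg v (k - 10) + Φ.gg u (k - 10)) := by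
    rw [mul_assoc]
    apply mul_le_mul_of_nonneg_left _ hK
    have c1 := C.hb0 (Φ.Z v) (k - 10)
    have c2 := C.hb0 (Φ.Z u) (k - 10)
    have : tk (k - 8) ≤ tk (k - 10) := tk_anti (by omega)
    nlinarith
  nlinarith [mul_nonneg hK g1]

end Fam

end

section

namespace Fam

variable {n d : ℕ} {lam eps : ℝ} {C : Cfg n d lam eps} {δ : ℝ} (Φ : Fam C δ)

/-- deviation from the reference plane -/
noncomputable def f (p : Eu n) : Eu d := Φ.A p - C.io p

theorem f_meas : Measurable Φ.f := Φ.A_meas.sub C.io.continuous.measurable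

/-- square function density -/
noncomputable def Th (j : ℕ) (v : Eu n) : ℝ≥0∞ :=
  (closedBall (0 : Eu n) 1).indicator (fun v => ENNReal.ofReal ((Φ.gg v j / tk j) ^ 2)) v

theorem Th_meas (j : ℕ) : Measurable (Φ.Th j) := by
  unfold Th
  refine Measurable.indicator ?_ isClosed_closedBall.measurableSet
  have h1 : Measurable fun v => Φ.gg v j := by
    have : (fun v => Φ.gg v j) = (fun i => tl Φ.N (C.b (Φ.x i)) j) ∘ Φ.idx := rfl
    rw [this]
    exact (measurable_of_countable _).comp Φ.idx_meas
  fun_prop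

theorem Th_sum (T : ℕ) : ∑ j ∈ Finset.range T, ∫⁻ v, Φ.Th j v ∂μH[(n : ℝ)] ≤
    ENNReal.ofReal (4 * eps) * c1 n := by
  refine (le_lintegral_finset _ _ _).trans ?_
  calc ∫⁻ v, ∑ j ∈ Finset.range T, Φ.Th j v ∂μH[(n : ℝ)]
      ≤ ∫⁻ v, (closedBall (0 : Eu n) 1).indicator (fun _ => ENNReal.ofReal (4 * eps)) v
        ∂μH[(n : ℝ)] := by
        refine lintegral_mono fun v => ?_
        unfold Th
        by_cases hv : v ∈ closedBall (0 : Eu n) 1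
        · simp only [indicator_of_mem hv]
          rw [← ENNReal.ofReal_sum_of_nonneg (fun i _ => by positivity)]
          apply ENNReal.ofReal_le_ofReal
          exact tl_hardy Φ.N (C.b (Φ.Z v)) (fun i => C.hb0 _ i) eps (C.hbs _ (Φ.Z_mem v).1) T
        · simp only [indicator_of_notMem hv]; simp
    _ = _ := by
        rw [lintegral_indicator isClosed_closedBall.measurableSet, setLIntegral_const,
          vol_ball _ _ zero_le_one]
        simp

theorem ball_one {v : Eu n} (h : Φ.D v ≤ 1 / 2) : v ∈ closedBall (0 : Eu n) 1 := by
  rw [mem_closedBall_zero_iff]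
  have h1 := Φ.D_eq v
  have h2 := C.F1_P (Φ.Z_mem v)
  have h3 := C.h_nonneg δ (Φ.Z v)
  have h4 := norm_add_le (v - C.P (Φ.Z v)) (C.P (Φ.Z v))
  rw [sub_add_cancel] at h4
  linarith

theorem tk10 {k : ℕ} (hk : 10 ≤ k) : tk (k - 10) = 1024 * tk k := by
  have : k = (k - 10) + 10 := by omega
  conv_rhs => rw [this, tk_add]
  have h2 : tk 10 = 1 / 1024 := by norm_num [tk]
  rw [h2]; ring

theorem second {K : ℝ} (hK : 0 ≤ K) (hfac : C.Fac δ K) {u : Eu n} {k : ℕ} (hk : 10 ≤ k)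
    (hkN : k ≤ Φ.N) (hu : Φ.D u < 4 * tk k) (e : Eu n) (he : ‖e‖ = 1) :
    ‖(Φ.f (u + tk (k + 1) • e) - Φ.f u) -
      (Φ.f (u + tk k • e) - Φ.f (u + tk (k + 1) • e))‖ ≤
    3 * K * (2 * Φ.gg (u + tk (k + 1) • e) (k - 10) + 5 * Φ.gg u (k - 10) +
      Φ.gg (u + tk k • e) (k - 10)) := by
  have t0 := tk_pos k
  have h1 := Φ.cross hK hfac hk hkN hu (v := u) (by simp [t0.le])
  have h2 := Φ.cross hK hfac hk hkN hu (v := u + tk (k + 1) • e) (by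
    rw [add_sub_cancel_left, norm_smul, he, Real.norm_of_nonneg (tk_pos _).le, mul_one]
    exact tk_anti (by omega))
  have h3 := Φ.cross hK hfac hk hkN hu (v := u + tk k • e) (by
    rw [add_sub_cancel_left, norm_smul, he, Real.norm_of_nonneg (tk_pos _).le, mul_one])
  set a := C.sa δ (Φ.Z u) (k - 10) with ha
  set p := u + tk (k + 1) • e with hp
  set q := u + tk k • e with hq
  have hpq : q - p = p - u := by
    rw [hp, hq, tk_succ]
    module
  have e1 : (Φ.f p - Φ.f u) - (Φ.f q - Φ.f p) =
      (Φ.A p - ap a p) + (Φ.A p - ap a p) + (-(Φ.A u - ap a u) + -(Φ.A q - ap a q)) := by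
    have e2 : ap a p - ap a u = ap a q - ap a p := by rw [ap_sub, ap_sub, hpq]
    have e3 : C.io p - C.io u = C.io q - C.io p := by rw [← map_sub, ← map_sub, hpq]
    unfold f
    have e4 : (Φ.A p - C.io p - (Φ.A u - C.io u)) - (Φ.A q - C.io q - (Φ.A p - C.io p)) =
      (Φ.A p - Φ.A u - (Φ.A q - Φ.A p)) - ((C.io p - C.io u) - (C.io q - C.io p)) := by abel
    have e5 : (Φ.A p - ap a p) + (Φ.A p - ap a p) + (-(Φ.A u - ap a u) + -(Φ.A q - ap a q)) =
      (Φ.A p - Φ.A u - (Φ.A q - Φ.A p)) - ((ap a p - ap a u) - (ap a q - ap a p)) := by abel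
    rw [e4, e5, e2, e3]
    simp
  rw [e1]
  have n1 := norm_add_le ((Φ.A p - ap a p) + (Φ.A p - ap a p))
    (-(Φ.A u - ap a u) + -(Φ.A q - ap a q))
  have n2 := norm_add_le (Φ.A p - ap a p) (Φ.A p - ap a p)
  have n3 := norm_add_le (-(Φ.A u - ap a u)) (-(Φ.A q - ap a q))
  rw [norm_neg, norm_neg] at n3
  linarith

theorem Il_le {K : ℝ} (hK : 0 ≤ K) (hfac : C.Fac δ K) {k : ℕ} (hk : 10 ≤ k)
    (hkN : k ≤ Φ.N) (e : Eu n) (he : ‖e‖ = 1) :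
    Tree.Il Φ.f Φ.D e k ≤
      ENNReal.ofReal (72 * 2 ^ 20 * K ^ 2) * (8 * ∫⁻ v, Φ.Th (k - 10) v ∂μH[(n : ℝ)]) := by
  have t0 := tk_pos k
  have hT := Φ.Th_meas (k - 10)
  have hsh : ∀ w : Eu n, ∫⁻ v, Φ.Th (k - 10) (v + w) ∂μH[(n : ℝ)] =
    ∫⁻ v, Φ.Th (k - 10) v ∂μH[(n : ℝ)] := fun w => lintegral_add_right_eq_self _ w
  have hk10 : tk k ≤ 1 / 1024 := by
    have := tk10 hk
    have := tk_le_one (k - 10)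
    linarith
  have hms : MeasurableSet {u | Φ.D u < 4 * tk k} := measurableSet_lt Φ.D_meas measurable_const
  calc Tree.Il Φ.f Φ.D e k ≤ ∫⁻ u in {u | Φ.D u < 4 * tk k},
        ENNReal.ofReal (72 * 2 ^ 20 * K ^ 2) * (2 * Φ.Th (k - 10) (u + tk (k + 1) • e) +
          5 * Φ.Th (k - 10) u + Φ.Th (k - 10) (u + tk k • e)) ∂μH[(n : ℝ)] := by
        refine setLIntegral_mono' hms fun u hu => ?_
        have hu' : Φ.D u < 4 * tk k := hu
        have h1 := Φ.second hK hfac hk hkN hu' e he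
        have g1 := Φ.gg_nonneg (u + tk (k + 1) • e) (k - 10)
        have g2 := Φ.gg_nonneg u (k - 10)
        have g3 := Φ.gg_nonneg (u + tk k • e) (k - 10)
        have b0 : u ∈ closedBall (0 : Eu n) 1 := Φ.ball_one (by linarith)
        have b1 : u + tk (k + 1) • e ∈ closedBall (0 : Eu n) 1 := by
          apply Φ.ball_one
          have := Φ.D_lip (u + tk (k + 1) • e) u
          rw [add_sub_cancel_left, norm_smul, he, Real.norm_of_nonneg (tk_pos _).le, mul_one,
            tk_succ] at this
          rw [tk_succ]
          linarith
        have b2 : u + tk k • e ∈ closedBall (0 : Eu n) 1 := by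
          apply Φ.ball_one
          have := Φ.D_lip (u + tk k • e) u
          rw [add_sub_cancel_left, norm_smul, he, Real.norm_of_nonneg (tk_pos _).le, mul_one]
            at this
          linarith
        unfold Th
        rw [indicator_of_mem b0, indicator_of_mem b1, indicator_of_mem b2]
        set X := Φ.gg (u + tk (k + 1) • e) (k - 10)
        set Y := Φ.gg u (k - 10)
        set Z := Φ.gg (u + tk k • e) (k - 10)
        have o2 : (2 : ℝ≥0∞) = ENNReal.ofReal 2 := by simp
        have o5 : (5 : ℝ≥0∞) = ENNReal.ofReal 5 := by simp
        have h2m : ∀ x : ℝ, 2 * ENNReal.ofReal x = ENNReal.ofReal (2 * x) := by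
          intro x
          rw [ENNReal.ofReal_mul (by norm_num)]; simp
        have h5m : ∀ x : ℝ, 5 * ENNReal.ofReal x = ENNReal.ofReal (5 * x) := by
          intro x
          rw [ENNReal.ofReal_mul (by norm_num)]; simp
        rw [h2m, h5m, ← ENNReal.ofReal_add (by positivity) (by positivity),
          ← ENNReal.ofReal_add (by positivity) (by positivity),
          ← ENNReal.ofReal_mul (by positivity)]
        apply ENNReal.ofReal_le_ofReal
        rw [tk10 hk]
        calc _ ≤ (3 * K * (2 * X + 5 * Y + Z)) ^ 2 / tk k ^ 2 := by gcongr
          _ ≤ (9 * K ^ 2) * (8 * (2 * X ^ 2 + 5 * Y ^ 2 + Z ^ 2)) / tk k ^ 2 := by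
              gcongr
              rw [mul_pow]
              have : (3 * K) ^ 2 = 9 * K ^ 2 := by ring
              rw [this]
              gcongr
              nlinarith [sq_nonneg (X - Y), sq_nonneg (X - Z), sq_nonneg (Y - Z)]
          _ = _ := by field_simp; ring
    _ ≤ ∫⁻ u, ENNReal.ofReal (72 * 2 ^ 20 * K ^ 2) * (2 * Φ.Th (k - 10) (u + tk (k + 1) • e) +
          5 * Φ.Th (k - 10) u + Φ.Th (k - 10) (u + tk k • e)) ∂μH[(n : ℝ)] :=
        setLIntegral_le_lintegral _ _
    _ = _ := by
        have m1 : Measurable fun u => 2 * Φ.Th (k - 10) (u + tk (k + 1) • e) :=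
          (hT.comp (measurable_add_const _)).const_mul _
        have m2 : Measurable fun u => 5 * Φ.Th (k - 10) u := hT.const_mul _
        have m12 : Measurable fun u => 2 * Φ.Th (k - 10) (u + tk (k + 1) • e) +
          5 * Φ.Th (k - 10) u := m1.add m2
        rw [lintegral_const_mul' _ _ ENNReal.ofReal_ne_top, lintegral_add_left m12,
          lintegral_add_left m1, lintegral_const_mul' _ _ (by norm_num),
          lintegral_const_mul' _ _ (by norm_num), hsh, hsh]
        congr 1
        ring

theorem Ph_le {K : ℝ} (hK : 0 ≤ K) (hfac : C.Fac δ K) (he0 : 0 ≤ eps) (hN : 10 ≤ Φ.N) (e : Eu n)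
    (he : ‖e‖ = 1) :
    Tree.Ph Φ.f Φ.D e 10 ≤ ENNReal.ofReal (2 ^ 30 * K ^ 2 * eps) * c1 n := by
  have ht : tk 10 = 1 / 1024 := by norm_num [tk]
  have hms : MeasurableSet {u | Φ.D u < 4 * tk 10} := measurableSet_lt Φ.D_meas measurable_const
  set s := Real.sqrt eps with hs
  have hs0 : 0 ≤ s := Real.sqrt_nonneg _
  have hs2 : s ^ 2 = eps := Real.sq_sqrt he0
  have hgg : ∀ v, Φ.gg v 0 ≤ 2 * s := by
    intro v
    have h1 := tl_hardy Φ.N (C.b (Φ.Z v)) (fun i => C.hb0 _ i) eps (C.hbs _ (Φ.Z_mem v).1) 1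
    rw [Finset.sum_range_one, tk_zero, div_one] at h1
    have h2 : Φ.gg v 0 ^ 2 ≤ (2 * s) ^ 2 := by rw [mul_pow, hs2]; norm_num; exact h1
    exact abs_le_of_sq_le_sq' h2 (by positivity) |>.2
  calc Tree.Ph Φ.f Φ.D e 10 ≤ ∫⁻ u in {u | Φ.D u < 4 * tk 10},
        ENNReal.ofReal (2 ^ 30 * K ^ 2 * eps) ∂μH[(n : ℝ)] := by
        refine setLIntegral_mono' hms fun u hu => ?_
        have hu' : Φ.D u < 4 * tk 10 := hu
        apply ENNReal.ofReal_le_ofReal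
        have h1 := Φ.cross hK hfac le_rfl hN hu (v := u) (by simp [(tk_pos 10).le])
        have h3 := Φ.cross hK hfac le_rfl hN hu (v := u + tk 10 • e) (by
          rw [add_sub_cancel_left, norm_smul, he, Real.norm_of_nonneg (tk_pos _).le, mul_one])
        rw [Nat.sub_self] at h1 h3
        have g1 := hgg u
        have g3 := hgg (u + tk 10 • e)
        set a := C.sa δ (Φ.Z u) 0 with ha
        set q := u + tk 10 • e with hq
        have hsl : ‖a.2 - C.io‖ ≤ K * s := hfac.sl0 _ (Φ.Z_mem u)
        have hqu : q - u = tk 10 • e := by rw [hq, add_sub_cancel_left]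
        have e1 : Φ.f q - Φ.f u = (Φ.A q - ap a q) + -(Φ.A u - ap a u) +
            (a.2 - C.io) (q - u) := by
          have : (a.2 - C.io) (q - u) = (ap a q - ap a u) - (C.io q - C.io u) := by
            rw [ap_sub, ← map_sub, _root_.sub_apply]
          rw [this]
          unfold f
          abel
        have n1 := norm_add₃_le (a := Φ.A q - ap a q) (b := -(Φ.A u - ap a u))
          (c := (a.2 - C.io) (q - u))
        rw [← e1, norm_neg] at n1
        have n2 : ‖(a.2 - C.io) (q - u)‖ ≤ K * s := by
          refine ((a.2 - C.io).le_opNorm _).trans ?_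
          rw [hqu, norm_smul, he, Real.norm_of_nonneg (tk_pos _).le, mul_one, ht]
          have := norm_nonneg (a.2 - C.io)
          linarith
        have hKs : 0 ≤ K * s := mul_nonneg hK hs0
        have h4 : ‖Φ.f q - Φ.f u‖ ≤ 25 * (K * s) := by
          have := mul_le_mul_of_nonneg_left g1 hK
          have := mul_le_mul_of_nonneg_left g3 hK
          nlinarith
        rw [ht]
        have h5 : ‖Φ.f q - Φ.f u‖ ^ 2 ≤ (25 * (K * s)) ^ 2 := by gcongr
        have h6 : (25 * (K * s)) ^ 2 = 625 * (K ^ 2 * eps) := by rw [← hs2]; ring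
        rw [h6] at h5
        have h7 : 0 ≤ K ^ 2 * eps := by positivity
        rw [div_le_iff₀ (by norm_num)]
        norm_num
        nlinarith
    _ = ENNReal.ofReal (2 ^ 30 * K ^ 2 * eps) * μH[(n : ℝ)] {u | Φ.D u < 4 * tk 10} :=
        setLIntegral_const _ _
    _ ≤ ENNReal.ofReal (2 ^ 30 * K ^ 2 * eps) * μH[(n : ℝ)] (closedBall (0 : Eu n) 1) := by
        gcongr
        intro u hu
        have hu' : Φ.D u < 4 * tk 10 := hu
        rw [ht] at hu'
        exact Φ.ball_one (by linarith)
    _ = _ := by rw [vol_ball _ _ zero_le_one]; simp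

theorem upper {K : ℝ} (hK : 0 ≤ K) (hfac : C.Fac δ K) (he0 : 0 ≤ eps) (hN : 10 ≤ Φ.N) (e : Eu n)
    (he : ‖e‖ = 1) :
    ∑ j ∈ Finset.range (Φ.N - 10 + 1), Tree.Lf Φ.f Φ.D e (10 + j) ≤
      ENNReal.ofReal (2 ^ 40 * K ^ 2 * eps) * c1 n := by
  have h1 := Tree.tot Φ.f Φ.f_meas Φ.D Φ.D_meas Φ.D_lip e he 10 (Φ.N - 10 + 1)
  refine le_trans (le_trans le_add_self h1) ?_
  have h2 := Φ.Ph_le hK hfac he0 hN e he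
  have h3 : ∑ j ∈ Finset.range (Φ.N - 10 + 1), Tree.Il Φ.f Φ.D e (10 + j) ≤
      ENNReal.ofReal (72 * 2 ^ 20 * K ^ 2) * (8 * (ENNReal.ofReal (4 * eps) * c1 n)) := by
    calc _ ≤ ∑ j ∈ Finset.range (Φ.N - 10 + 1), ENNReal.ofReal (72 * 2 ^ 20 * K ^ 2) *
          (8 * ∫⁻ v, Φ.Th j v ∂μH[(n : ℝ)]) := by
          refine Finset.sum_le_sum fun j hj => ?_
          rw [Finset.mem_range] at hj
          have := Φ.Il_le hK hfac (k := 10 + j) (by omega) (by omega) e he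
          rwa [Nat.add_sub_cancel_left] at this
      _ = ENNReal.ofReal (72 * 2 ^ 20 * K ^ 2) * (8 * ∑ j ∈ Finset.range (Φ.N - 10 + 1),
          ∫⁻ v, Φ.Th j v ∂μH[(n : ℝ)]) := by
          rw [← Finset.mul_sum, ← Finset.mul_sum]
      _ ≤ _ := mul_le_mul_right (mul_le_mul_right (Φ.Th_sum _) 8) _
  refine (add_le_add (mul_le_mul_right h2 2) (mul_le_mul_right h3 2)).trans ?_
  have h2m : ∀ x : ℝ, 2 * ENNReal.ofReal x = ENNReal.ofReal (2 * x) := by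
    intro x
    rw [ENNReal.ofReal_mul (by norm_num)]; simp
  have h8m : ∀ x : ℝ, 8 * ENNReal.ofReal x = ENNReal.ofReal (8 * x) := by
    intro x
    rw [ENNReal.ofReal_mul (by norm_num)]; simp
  rw [← mul_assoc, ← mul_assoc 8, ← mul_assoc (ENNReal.ofReal _), ← mul_assoc 2, h2m, h8m,
    ← ENNReal.ofReal_mul (by positivity), h2m, ← add_mul,
    ← ENNReal.ofReal_add (by positivity) (by positivity)]
  gcongr
  have : 0 ≤ K ^ 2 * eps := by positivity
  nlinarith

end Fam

end

section

namespace Fam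

variable {n d : ℕ} {lam eps : ℝ} {C : Cfg n d lam eps} {δ : ℝ} (Φ : Fam C δ)

theorem idx_near {i : ℕ} (hi : i < Φ.M) {v : Eu n} (hv : ‖v - C.P (Φ.x i)‖ ≤ tk (Φ.κ i) / 2) :
    Φ.idx v = i := by
  by_contra hne
  have h1 := Φ.sep _ (Φ.idx_lt v) _ hi hne
  have h2 := Φ.idx_eq v
  have h3 := Φ.D_le hi v
  unfold g at h2 h3
  have t0 := tk_pos (Φ.κ i)
  have t1 := tk_pos (Φ.κ (Φ.idx v))
  have h4 : ‖C.P (Φ.x (Φ.idx v)) - C.P (Φ.x i)‖ ≤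
    ‖C.P (Φ.x (Φ.idx v)) - v‖ + ‖v - C.P (Φ.x i)‖ := norm_sub_le_norm_sub_add_norm_sub ..
  rw [norm_sub_rev _ v] at h4
  linarith

theorem D_near {i : ℕ} (hi : i < Φ.M) {v : Eu n} (hv : ‖v - C.P (Φ.x i)‖ ≤ tk (Φ.κ i) / 2) :
    Φ.D v = ‖v - C.P (Φ.x i)‖ + tk (Φ.κ i) := by
  rw [← Φ.idx_eq v, Φ.idx_near hi hv]; rfl

theorem kp_near {i : ℕ} (hi : i < Φ.M) {v : Eu n} (hv : ‖v - C.P (Φ.x i)‖ ≤ tk (Φ.κ i) / 2) :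
    Φ.kp v = Φ.κ i := by
  have hD := Φ.D_near hi hv
  have h1 : Φ.κ i ≤ Φ.kp v := by
    apply Φ.le_kp
    · have := Φ.hN i hi; omega
    · linarith
  have h2 := Φ.kp_spec (p := v) (by have := tk_le_one (Φ.κ i); linarith)
  by_contra hne
  have h3 : Φ.κ i + 1 ≤ Φ.kp v := by omega
  have h4 := tk_anti h3
  rw [tk_succ] at h4
  have t0 := tk_pos (Φ.κ i)
  have := norm_nonneg (v - C.P (Φ.x i))
  linarith

theorem A_near {i : ℕ} (hi : i < Φ.M) {v : Eu n} (hv : ‖v - C.P (Φ.x i)‖ ≤ tk (Φ.κ i) / 2) :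
    Φ.A v = ap (C.sa δ (Φ.x i) (Φ.κ i)) v := by
  unfold A Z
  rw [Φ.idx_near hi hv, Φ.kp_near hi hv]

theorem lower_k (e : Eu n) (he : ‖e‖ = 1) (c : ℝ) (hc0 : 0 ≤ c)
    (hc : ∀ i < Φ.M, c ≤ ‖((C.sa δ (Φ.x i) (Φ.κ i)).2 - C.io) e‖) (k : ℕ) (s : Finset ℕ)
    (hs : ∀ i ∈ s, i < Φ.M ∧ Φ.κ i + 1 = k) :
    ∑ i ∈ s, ENNReal.ofReal (c ^ 2) * (ENNReal.ofReal ((tk (Φ.κ i) / 4) ^ n) * c1 n) ≤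
      Tree.Lf Φ.f Φ.D e k := by
  set B : ℕ → Set (Eu n) := fun i => closedBall (C.P (Φ.x i)) (tk (Φ.κ i) / 4) with hB
  have hBm : ∀ i, MeasurableSet (B i) := fun i => isClosed_closedBall.measurableSet
  have hdis : Set.PairwiseDisjoint (↑s) B := by
    intro i hi j hj hij
    have h1 := Φ.sep i (hs i hi).1 j (hs j hj).1 hij
    apply closedBall_disjoint_closedBall
    rw [dist_eq_norm]
    have t0 := tk_pos (Φ.κ i)
    have t1 := tk_pos (Φ.κ j)
    linarith
  have key : ∀ i ∈ s, ∀ u ∈ B i, (4 * tk (k + 1) ≤ Φ.D u ∧ Φ.D u < 4 * tk k) ∧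
      ENNReal.ofReal (c ^ 2) ≤ ENNReal.ofReal
        (‖Φ.f (u + tk (k + 1) • e) - Φ.f u‖ ^ 2 / tk (k + 1) ^ 2) := by
    intro i hi u hu
    obtain ⟨hiM, hik⟩ := hs i hi
    have hu' : ‖u - C.P (Φ.x i)‖ ≤ tk (Φ.κ i) / 4 := by
      rw [← dist_eq_norm]; exact hu
    have t0 := tk_pos (Φ.κ i)
    have e1 : tk k = tk (Φ.κ i) / 2 := by rw [← hik, tk_succ]
    have e2 : tk (k + 1) = tk (Φ.κ i) / 4 := by rw [tk_succ, e1]; ring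
    have hu2 : ‖u - C.P (Φ.x i)‖ ≤ tk (Φ.κ i) / 2 := by linarith
    have hD := Φ.D_near hiM hu2
    have hn0 := norm_nonneg (u - C.P (Φ.x i))
    refine ⟨⟨by rw [e2]; linarith, by rw [e1]; linarith⟩, ?_⟩
    set t := tk (k + 1) with ht
    have ht0 : 0 < t := tk_pos _
    have hv : ‖u + t • e - C.P (Φ.x i)‖ ≤ tk (Φ.κ i) / 2 := by
      have : u + t • e - C.P (Φ.x i) = (u - C.P (Φ.x i)) + t • e := by abel
      rw [this]
      refine (norm_add_le _ _).trans ?_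
      rw [norm_smul, he, Real.norm_of_nonneg ht0.le, mul_one]
      linarith
    have e3 : Φ.f (u + t • e) - Φ.f u =
        t • (((C.sa δ (Φ.x i) (Φ.κ i)).2 - C.io) e) := by
      unfold f
      rw [Φ.A_near hiM hu2, Φ.A_near hiM hv]
      have h1 := ap_sub (C.sa δ (Φ.x i) (Φ.κ i)) (u + t • e) u
      rw [add_sub_cancel_left, map_smul] at h1
      have h2 : C.io (u + t • e) - C.io u = t • C.io e := by
        rw [← map_sub, add_sub_cancel_left, map_smul]
      rw [_root_.sub_apply, smul_sub, ← h1, ← h2]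
      abel
    apply ENNReal.ofReal_le_ofReal
    rw [e3, norm_smul, Real.norm_of_nonneg ht0.le, mul_pow, mul_div_cancel_left₀ _ (by positivity)]
    have := hc i hiM
    gcongr
  calc ∑ i ∈ s, ENNReal.ofReal (c ^ 2) * (ENNReal.ofReal ((tk (Φ.κ i) / 4) ^ n) * c1 n)
      ≤ ∑ i ∈ s, ∫⁻ u in B i, ENNReal.ofReal
        (‖Φ.f (u + tk (k + 1) • e) - Φ.f u‖ ^ 2 / tk (k + 1) ^ 2) ∂μH[(n : ℝ)] := by
        refine Finset.sum_le_sum fun i hi => ?_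
        have t0 := tk_pos (Φ.κ i)
        rw [← vol_ball (C.P (Φ.x i)) _ (by positivity), ← setLIntegral_const]
        exact setLIntegral_mono' (hBm i) fun u hu => (key i hi u hu).2
    _ = ∫⁻ u in ⋃ i ∈ s, B i, ENNReal.ofReal
        (‖Φ.f (u + tk (k + 1) • e) - Φ.f u‖ ^ 2 / tk (k + 1) ^ 2) ∂μH[(n : ℝ)] :=
        (lintegral_biUnion_finset hdis (fun i _ => hBm i) _).symm
    _ ≤ _ := by
        apply lintegral_mono_set
        intro u hu
        obtain ⟨i, hi, hui⟩ := mem_iUnion₂.1 hu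
        exact (key i hi u hui).1

theorem fam_bound {K : ℝ} (hK : 0 ≤ K) (hfac : C.Fac δ K) (he0 : 0 ≤ eps) (hN : 10 ≤ Φ.N)
    (e : Eu n) (he : ‖e‖ = 1) (c : ℝ) (hc0 : 0 ≤ c)
    (hc : ∀ i < Φ.M, c ≤ ‖((C.sa δ (Φ.x i) (Φ.κ i)).2 - C.io) e‖) :
    ∑ i ∈ Finset.range Φ.M, ENNReal.ofReal (c ^ 2) *
      (ENNReal.ofReal ((tk (Φ.κ i) / 4) ^ n) * c1 n) ≤
      ENNReal.ofReal (2 ^ 40 * K ^ 2 * eps) * c1 n := by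
  refine le_trans ?_ (Φ.upper hK hfac he0 hN e he)
  rw [← Finset.sum_fiberwise_of_maps_to (s := Finset.range Φ.M)
    (t := Finset.range (Φ.N - 10 + 1)) (g := fun i => Φ.κ i + 1 - 10)]
  · refine Finset.sum_le_sum fun j _ => ?_
    refine Φ.lower_k e he c hc0 hc _ _ ?_
    intro i hi
    rw [Finset.mem_filter, Finset.mem_range] at hi
    have := Φ.hκ i hi.1
    exact ⟨hi.1, by omega⟩
  · intro i hi
    rw [Finset.mem_range] at hi ⊢
    have := Φ.hκ i hi
    have := Φ.hN i hi
    omega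

end Fam

end

section

namespace Cfg

variable {n d : ℕ} {lam eps : ℝ} (C : Cfg n d lam eps) (δ : ℝ)

/-- points stopped because of large slope in direction `e` -/
def FS (e : Eu n) (c : ℝ) : Set (Eu d) :=
  {x | x ∈ C.F1 ∧ ∃ κ, 15 ≤ κ ∧ C.h δ x = tk κ ∧ c ≤ ‖((C.sa δ x κ).2 - C.io) e‖}

theorem FS_fin {K : ℝ} (hK : 0 ≤ K) (hfac : C.Fac δ K) (he0 : 0 ≤ eps) (e : Eu n)
    (he : ‖e‖ = 1) (c : ℝ) (hc0 : 0 ≤ c) (s : Finset (Eu d)) (hs : ∀ x ∈ s, x ∈ C.FS δ e c)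
    (hdis : ∀ x ∈ s, ∀ y ∈ s, x ≠ y →
      5 * C.h δ x + 5 * C.h δ y ≤ ‖C.P x - C.P y‖) :
    ∑ x ∈ s, ENNReal.ofReal (c ^ 2) * ENNReal.ofReal ((C.h δ x / 4) ^ n) ≤
      ENNReal.ofReal (2 ^ 40 * K ^ 2 * eps) := by
  classical
  rcases s.eq_empty_or_nonempty with rfl | hne
  · simp
  have hκ : ∀ x : Eu d, ∃ κ, x ∈ s → 15 ≤ κ ∧ C.h δ x = tk κ ∧
      c ≤ ‖((C.sa δ x κ).2 - C.io) e‖ := by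
    intro x
    by_cases hx : x ∈ s
    · obtain ⟨κ, h⟩ := (hs x hx).2
      exact ⟨κ, fun _ => h⟩
    · exact ⟨0, fun h => absurd h hx⟩
  choose κ hκ using hκ
  set E := s.equivFin with hE
  set M := s.card with hM
  set x : ℕ → Eu d := fun i => if h : i < M then (E.symm ⟨i, h⟩ : Eu d) else 0 with hxdef
  have hx : ∀ i (h : i < M), x i = (E.symm ⟨i, h⟩ : Eu d) := fun i h => dif_pos h
  have hxs : ∀ i, i < M → x i ∈ s := fun i h => by rw [hx i h]; exact (E.symm ⟨i, h⟩).2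
  have hinj : ∀ i < M, ∀ j < M, i ≠ j → x i ≠ x j := by
    intro i hi j hj hij h
    rw [hx i hi, hx j hj] at h
    have := E.symm.injective (Subtype.ext h)
    exact hij (by simpa using this)
  let Φ : Fam C δ :=
    { M := M
      hM := Finset.card_pos.2 hne
      x := x
      κ := fun i => κ (x i)
      N := 10 + ∑ x ∈ s, κ x
      hx := fun i hi => (hs _ (hxs i hi)).1
      hh := fun i hi => (hκ _ (hxs i hi)).2.1
      hκ := fun i hi => (hκ _ (hxs i hi)).1
      hN := fun i hi => by
        have := Finset.single_le_sum (f := κ) (fun _ _ => Nat.zero_le _) (hxs i hi)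
        omega
      sep := fun i hi j hj hij => by
        have := hdis _ (hxs i hi) _ (hxs j hj) (hinj i hi j hj hij)
        rwa [(hκ _ (hxs i hi)).2.1, (hκ _ (hxs j hj)).2.1] at this }
  have hb := Φ.fam_bound hK hfac he0 (Nat.le_add_right _ _) e he c hc0
    (fun i hi => (hκ _ (hxs i hi)).2.2)
  have hb2 : (∑ i ∈ Finset.range M, ENNReal.ofReal (c ^ 2) *
      ENNReal.ofReal ((tk (κ (x i)) / 4) ^ n)) * c1 n ≤
      ENNReal.ofReal (2 ^ 40 * K ^ 2 * eps) * c1 n := by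
    rw [Finset.sum_mul]
    refine le_trans (le_of_eq ?_) hb
    exact Finset.sum_congr rfl fun i _ => mul_assoc _ _ _
  have hb3 := (ENNReal.mul_le_mul_iff_left (c1_pos n) (c1_top n)).1 hb2
  refine le_trans (le_of_eq ?_) hb3
  rw [Finset.sum_range, ← Finset.sum_coe_sort s, ← E.symm.sum_comp]
  refine Finset.sum_congr rfl fun i _ => ?_
  have h1 := hx i i.2
  rw [← (hκ _ (hxs i i.2)).2.1, h1]

theorem FS_bound {K : ℝ} (hK : 0 ≤ K) (hlam : 0 ≤ lam) (hfac : C.Fac δ K) (he0 : 0 ≤ eps)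
    (e : Eu n) (he : ‖e‖ = 1) (c : ℝ) (hc0 : 0 < c) :
    C.m (C.FS δ e c) ≤ ENNReal.ofReal (lam * 4608 ^ n / c ^ 2 * (2 ^ 40 * K ^ 2) * eps) := by
  classical
  set S := C.FS δ e c with hS
  have hh : ∀ x ∈ S, 0 < C.h δ x ∧ C.h δ x ≤ 1 / 32768 := by
    rintro x ⟨-, κ, hκ, hx, -⟩
    rw [hx]
    refine ⟨tk_pos _, (tk_anti hκ).trans ?_⟩
    norm_num [tk]
  obtain ⟨u, huS, hdis, hcov⟩ := Vitali.exists_disjoint_subfamily_covering_enlargement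
    (fun x : Eu d => closedBall (C.P x) (5 * C.h δ x)) S (fun x => 5 * C.h δ x) 2 (by norm_num)
    (fun x hx => by have := (hh x hx).1; positivity)
    1 (fun x hx => by have := (hh x hx).2; linarith)
    (fun x hx => ⟨C.P x, mem_closedBall_self (by have := (hh x hx).1; positivity)⟩)
  have hcount : u.Countable := by
    apply hdis.countable_of_nonempty_interior
    intro x hx
    refine ⟨C.P x, ?_⟩
    exact ball_subset_interior_closedBall (mem_ball_self (by
      have := (hh x (huS hx)).1; positivity))
  have hsub : S ⊆ ⋃ b ∈ u, closedBall b (1152 * C.h δ b) := by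
    intro x hx
    obtain ⟨b, hb, ⟨q, hq1, hq2⟩, hle⟩ := hcov x hx
    refine mem_iUnion₂.2 ⟨b, hb, ?_⟩
    have h1 : dist q (C.P x) ≤ 5 * C.h δ x := hq1
    have h2 : dist q (C.P b) ≤ 5 * C.h δ b := hq2
    have h3 := dist_triangle_left (C.P x) (C.P b) q
    have h4 := hfac.cone x hx.1 b (huS hb).1
    rw [dist_eq_norm (C.P x)] at h3
    rw [mem_closedBall, dist_eq_norm]
    linarith
  calc C.m S ≤ C.m (⋃ b ∈ u, closedBall b (1152 * C.h δ b)) := measure_mono hsub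
    _ ≤ ∑' b : u, C.m (closedBall (b : Eu d) (1152 * C.h δ b)) :=
        measure_biUnion_le C.m hcount _
    _ ≤ ∑' b : u, ENNReal.ofReal (lam * 4608 ^ n / c ^ 2) *
          (ENNReal.ofReal (c ^ 2) * ENNReal.ofReal ((C.h δ b / 4) ^ n)) := by
        refine ENNReal.tsum_le_tsum fun b => ?_
        have h1 := hh b (huS b.2)
        have h0 := h1.1
        refine (C.H1 b (huS b.2).1.1 _ (by positivity) (by linarith)).trans ?_
        rw [← ENNReal.ofReal_mul (by positivity), ← ENNReal.ofReal_mul (by positivity)]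
        apply ENNReal.ofReal_le_ofReal
        apply le_of_eq
        rw [div_pow, mul_pow]
        have : (4608 : ℝ) ^ n = 1152 ^ n * 4 ^ n := by rw [← mul_pow]; norm_num
        rw [this]
        field_simp
    _ ≤ ENNReal.ofReal (lam * 4608 ^ n / c ^ 2) * ENNReal.ofReal (2 ^ 40 * K ^ 2 * eps) := by
        rw [ENNReal.tsum_mul_left]
        gcongr
        rw [ENNReal.tsum_eq_iSup_sum]
        refine iSup_le fun s => ?_
        have h1 := C.FS_fin δ hK hfac he0 e he c hc0.le (s.map (Function.Embedding.subtype _))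
          (by
            intro x hx
            obtain ⟨y, -, rfl⟩ := Finset.mem_map.1 hx
            exact huS y.2)
          (by
            intro x hx y hy hxy
            obtain ⟨x, -, rfl⟩ := Finset.mem_map.1 hx
            obtain ⟨y, -, rfl⟩ := Finset.mem_map.1 hy
            have h2 := hdis x.2 y.2 hxy
            have h3 := (hh x (huS x.2)).1
            have h4 := (hh y (huS y.2)).1
            have h5 := (disjoint_closedBall_closedBall_iff (by positivity) (by positivity)).1 h2
            rw [dist_eq_norm] at h5
            exact h5.le)
        rw [Finset.sum_map] at h1
        exact h1
    _ = _ := by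
        rw [← ENNReal.ofReal_mul (by positivity)]
        congr 1; ring

end Cfg

end

section

theorem opnorm_coord {n d : ℕ} (hn : 0 < n) (A : Eu n →L[ℝ] Eu d)
    (h : 1 / 4 < ‖A‖) : ∃ j : Fin n, 1 / (4 * (n : ℝ)) ≤ ‖A (EuclideanSpace.single j 1)‖ := by
  by_contra hh
  push Not at hh
  have hn' : (0 : ℝ) < n := by exact_mod_cast hn
  have : ‖A‖ ≤ 1 / 4 := by
    refine A.opNorm_le_bound (by norm_num) fun v => ?_
    have hv : v = ∑ j, v j • EuclideanSpace.single j (1 : ℝ) := by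
      have := (EuclideanSpace.basisFun (Fin n) ℝ).sum_repr v
      simpa using this.symm
    have h1 : A v = ∑ j, v j • A (EuclideanSpace.single j (1 : ℝ)) := by
      conv_lhs => rw [hv]
      rw [map_sum]
      simp only [map_smul]
    rw [h1]
    calc _ ≤ ∑ j, ‖v j • A (EuclideanSpace.single j (1 : ℝ))‖ := norm_sum_le _ _
      _ ≤ ∑ j : Fin n, ‖v‖ * (1 / (4 * (n : ℝ))) := by
          refine Finset.sum_le_sum fun j _ => ?_
          rw [norm_smul]
          have h2 := (hh j).le
          have h3 : ‖v j‖ ≤ ‖v‖ := PiLp.norm_apply_le v j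
          gcongr
      _ = _ := by
          simp
          field_simp
  linarith

theorem lip_image {n d : ℕ} (P : Eu d →L[ℝ] Eu n) (Z : Set (Eu d)) (K : ℝ≥0)
    (h : ∀ x ∈ Z, ∀ y ∈ Z, ‖x - y‖ ≤ K * ‖P x - P y‖) :
    ∃ g : Eu n → Eu d, (∃ K : ℝ≥0, LipschitzWith K g) ∧ Z ⊆ range g := by
  classical
  have hinj : Set.InjOn P Z := by
    intro x hx y hy hxy
    have := h x hx y hy
    rw [hxy, sub_self, norm_zero, mul_zero] at this
    exact sub_eq_zero.1 (norm_eq_zero.1 (le_antisymm this (norm_nonneg _)))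
  set f : Eu n → Eu d := Function.invFunOn P Z with hf
  have hfx : ∀ x ∈ Z, f (P x) = x := fun x hx => hinj.leftInvOn_invFunOn hx
  have hlip : LipschitzOnWith K f (P '' Z) := by
    refine LipschitzOnWith.of_dist_le_mul ?_
    rintro _ ⟨x, hx, rfl⟩ _ ⟨y, hy, rfl⟩
    rw [hfx x hx, hfx y hy, dist_eq_norm, dist_eq_norm]
    exact h x hx y hy
  obtain ⟨g, hg, hgf⟩ := hlip.extend_finite_dimension
  refine ⟨g, ⟨_, hg⟩, fun x hx => ⟨P x, ?_⟩⟩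
  rw [← hgf ⟨x, hx, rfl⟩, hfx x hx]

theorem Cfg.main (n d : ℕ) (hn : 0 < n) (lam : ℝ) (hlam : 0 ≤ lam) :
    ∃ eps : ℝ, 0 < eps ∧ ∀ C : Cfg n d lam eps, ∃ Z ⊆ C.F, C.m Z ≠ 0 ∧
      ∃ g : Eu n → Eu d, (∃ K : ℝ≥0, LipschitzWith K g) ∧ Z ⊆ range g := by
  obtain ⟨C1, C2, hC1, hC2, hFL⟩ := Cfg.FL_bound n d
  have hn' : (0 : ℝ) < n := by exact_mod_cast hn
  set c0 : ℝ := tk 16 ^ n / 2 with hc0d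
  have hc0 : 0 < c0 := by have := tk_pos 16; positivity
  set δ : ℝ := min c0 (c0 / (4 * (C1 + 1))) with hδd
  have hδ : 0 < δ := lt_min hc0 (by positivity)
  have hδ2 : C1 * δ ≤ c0 / 4 := by
    have h1 : δ ≤ c0 / (4 * (C1 + 1)) := min_le_right _ _
    rw [le_div_iff₀ (by positivity)] at h1
    nlinarith
  obtain ⟨K, e0, hK, he0, hch⟩ := Cfg.chain n hn lam δ hlam hδ (min_le_left _ _)
  set c : ℝ := 1 / (4 * (n : ℝ)) with hcd
  have hc : 0 < c := by positivity
  set C3 : ℝ := lam * 4608 ^ n / c ^ 2 * (2 ^ 40 * K ^ 2) with hC3d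
  have hC3 : 0 ≤ C3 := by positivity
  set eps : ℝ := min (e0 ^ 2) (c0 / (4 * (C2 + n * C3 + 1))) with hepsd
  have heps : 0 < eps := lt_min (by positivity) (by positivity)
  have heps2 : C2 * eps + n * (C3 * eps) ≤ c0 / 4 := by
    have h1 : eps ≤ c0 / (4 * (C2 + n * C3 + 1)) := min_le_right _ _
    rw [le_div_iff₀ (by positivity)] at h1
    nlinarith
  refine ⟨eps, heps, fun C => ?_⟩
  have hfac := hch d eps C (by
    rw [Real.sqrt_le_left he0.le]; exact min_le_left _ _)
  have hF1m : ENNReal.ofReal c0 ≤ C.m C.F1 := by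
    have := C.H4
    rw [C.HF _ isClosed_closedBall.measurableSet] at this
    exact this
  have hF1ne : C.F1.Nonempty := by
    by_contra hne
    rw [not_nonempty_iff_eq_empty] at hne
    rw [hne, measure_empty] at hF1m
    exact absurd hF1m (not_le.2 (ENNReal.ofReal_pos.2 hc0))
  set Z : Set (Eu d) := {x | x ∈ C.F1 ∧ C.h δ x = 0} with hZ
  have hsub : C.F1 ⊆ Z ∪ C.FL δ ∪ ⋃ j : Fin n, C.FS δ (EuclideanSpace.single j 1) c := by
    intro x hx
    rcases (C.h_nonneg δ x).eq_or_lt with h | h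
    · exact Or.inl (Or.inl ⟨hx, h.symm⟩)
    obtain ⟨k, hk, hhk, hG, hst | hst⟩ := hfac.stopping x hx h
    · exact Or.inl (Or.inr ⟨hx, k, hk, hhk, hst⟩)
    · right
      obtain ⟨j, hj⟩ := opnorm_coord hn _ hst
      exact mem_iUnion.2 ⟨j, hx, k, hk, hhk, hj⟩
  refine ⟨Z, fun x hx => hx.1.1, ?_, lip_image C.P Z 64 ?_⟩
  · intro h0
    have h1 : C.m C.F1 ≤ ENNReal.ofReal (c0 / 2) := by
      calc C.m C.F1 ≤ C.m (Z ∪ C.FL δ ∪ ⋃ j : Fin n, C.FS δ (EuclideanSpace.single j 1) c) :=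
            measure_mono hsub
        _ ≤ C.m Z + C.m (C.FL δ) + C.m (⋃ j : Fin n, C.FS δ (EuclideanSpace.single j 1) c) :=
            (measure_union_le _ _).trans (add_le_add (measure_union_le _ _) le_rfl)
        _ ≤ 0 + ENNReal.ofReal (C1 * δ + C2 * eps) + ∑ j : Fin n, ENNReal.ofReal (C3 * eps) := by
            refine add_le_add (add_le_add h0.le ?_) ?_
            · exact hFL lam eps C δ K hδ.le heps.le hfac hF1ne
            · refine (measure_iUnion_fintype_le _ _).trans (Finset.sum_le_sum fun j _ => ?_)
              exact C.FS_bound δ hK.le hlam hfac heps.le _ (by simp) c hc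
        _ = ENNReal.ofReal (C1 * δ + C2 * eps + n * (C3 * eps)) := by
            rw [zero_add, Finset.sum_const, Finset.card_univ, Fintype.card_fin,
              ENNReal.ofReal_add (p := C1 * δ + C2 * eps) (by positivity) (by positivity),
              ENNReal.ofReal_mul (p := (n : ℝ)) (by positivity), ENNReal.ofReal_natCast,
              nsmul_eq_mul]
        _ ≤ _ := ENNReal.ofReal_le_ofReal (by linarith)
    have h2 := hF1m.trans h1
    rw [ENNReal.ofReal_le_ofReal_iff (by positivity)] at h2
    linarith
  · intro x hx y hy
    have := hfac.cone x hx.1 y hy.1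
    rw [hx.2, hy.2, add_zero, add_zero] at this
    exact this

end

section

theorem weak_of_beta {n d : ℕ} (μ : Measure (Eu d)) (ξ : Eu d) (ρ v : ℝ) (hρ : 0 < ρ)
    (h : beta2sq n d μ ξ ρ < ENNReal.ofReal v) :
    ∃ L : AffineSubspace ℝ (Eu d), Module.finrank ℝ L.direction = n ∧ ∀ s : ℝ, 0 < s →
      μ {y | y ∈ closedBall ξ ρ ∧ s < infDist y (L : Set (Eu d))} ≤
        ENNReal.ofReal (v * ρ ^ (n + 2) / s ^ 2) := by
  unfold beta2sq at h
  obtain ⟨⟨L, hL⟩, hlt⟩ := iInf_lt_iff.1 h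
  refine ⟨L, hL, fun s hs => ?_⟩
  have hv : 0 < v := ENNReal.ofReal_pos.1 (lt_of_le_of_lt zero_le hlt)
  simp only at hlt
  set J := ∫⁻ y in closedBall ξ ρ,
        ENNReal.ofReal ((infDist y (L : Set (Eu d)) / ρ) ^ 2) ∂μ with hJ
  have hJ1 : J ≤ ENNReal.ofReal (v * ρ ^ n) := by
    have := (ENNReal.div_le_iff (by simpa using by positivity) ENNReal.ofReal_ne_top).1 hlt.le
    rwa [← ENNReal.ofReal_mul hv.le] at this
  set A : Set (Eu d) := {y | y ∈ closedBall ξ ρ ∧ s < infDist y (L : Set (Eu d))} with hA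
  have hAm : MeasurableSet A := by
    refine isClosed_closedBall.measurableSet.inter ?_
    exact measurableSet_lt measurable_const (continuous_infDist_pt _).measurable
  have h1 : ENNReal.ofReal ((s / ρ) ^ 2) * μ A ≤ J := by
    rw [← setLIntegral_const]
    refine (setLIntegral_mono' hAm fun y hy => ?_).trans (lintegral_mono_set fun y hy => hy.1)
    apply ENNReal.ofReal_le_ofReal
    have := hy.2.le
    gcongr
  have h2 := h1.trans hJ1
  have h3 : ENNReal.ofReal ((s / ρ) ^ 2) ≠ 0 :=
    (ENNReal.ofReal_pos.2 (by positivity)).ne'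
  rw [mul_comm, ← ENNReal.le_div_iff_mul_le (Or.inl h3) (Or.inl ENNReal.ofReal_ne_top),
    ← ENNReal.ofReal_div_of_pos (by positivity)] at h2
  refine h2.trans (ENNReal.ofReal_le_ofReal (le_of_eq ?_))
  rw [pow_add]
  field_simp

theorem plane_nonempty {n d : ℕ} (hn : 0 < n) {L : AffineSubspace ℝ (Eu d)}
    (h : Module.finrank ℝ L.direction = n) : (L : Set (Eu d)).Nonempty := by
  by_contra hne
  rw [not_nonempty_iff_eq_empty, AffineSubspace.coe_eq_bot_iff] at hne
  rw [hne, AffineSubspace.direction_bot, finrank_bot] at h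
  omega

/-- rescaling homeomorphism -/
noncomputable def zm {d : ℕ} (x0 : Eu d) (t : ℝ) (ht : t ≠ 0) : Eu d ≃ₜ Eu d where
  toFun y := t⁻¹ • (y - x0)
  invFun y := x0 + t • y
  left_inv y := by simp [smul_smul, ht]
  right_inv y := by simp [smul_smul, ht]
  continuous_toFun := by fun_prop
  continuous_invFun := by fun_prop

theorem scale_plane {n d : ℕ} (hn : 0 < n) (L : AffineSubspace ℝ (Eu d))
    (h : Module.finrank ℝ L.direction = n) (x0 : Eu d) (t : ℝ) (ht : 0 < t) :
    ∃ L' : AffineSubspace ℝ (Eu d), Module.finrank ℝ L'.direction = n ∧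
      ∀ y, t * infDist y (L' : Set (Eu d)) ≤ infDist (x0 + t • y) (L : Set (Eu d)) := by
  obtain ⟨p, hp⟩ := plane_nonempty hn h
  refine ⟨AffineSubspace.mk' (t⁻¹ • (p - x0)) L.direction, by
    rw [AffineSubspace.direction_mk']; exact h, fun y => ?_⟩
  rw [le_infDist ⟨p, hp⟩]
  intro z hz
  have hm : t⁻¹ • (z - x0) ∈ AffineSubspace.mk' (t⁻¹ • (p - x0)) L.direction := by
    rw [AffineSubspace.mem_mk', vsub_eq_sub, ← smul_sub, sub_sub_sub_cancel_right]
    exact L.direction.smul_mem _ (AffineSubspace.vsub_mem_direction hz hp)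
  have h1 := infDist_le_dist_of_mem (x := y) hm
  have h2 : dist (x0 + t • y) z = t * dist y (t⁻¹ • (z - x0)) := by
    rw [dist_eq_norm, dist_eq_norm]
    have : x0 + t • y - z = t • (y - t⁻¹ • (z - x0)) := by
      rw [smul_sub, smul_smul, mul_inv_cancel₀ ht.ne', one_smul]; abel
    rw [this, norm_smul, Real.norm_of_nonneg ht.le]
  rw [h2]
  gcongr

theorem plane_maps {n d : ℕ} (hn : 0 < n) (L : AffineSubspace ℝ (Eu d))
    (h : Module.finrank ℝ L.direction = n) :
    ∃ (P : Eu d →L[ℝ] Eu n) (io : Eu n →L[ℝ] Eu d) (c : Eu d), (∀ x, ‖P x‖ ≤ ‖x‖) ∧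
      (∀ p, ‖io p‖ = ‖p‖) ∧ (∀ p, P (io p) = p) ∧ P c = 0 ∧
      ∀ y, ‖y - (c + io (P y))‖ ≤ infDist y (L : Set (Eu d)) := by
  obtain ⟨q, hq⟩ := plane_nonempty hn h
  set V := L.direction with hV
  let b := (stdOrthonormalBasis ℝ V).reindex (finCongr h)
  let R : V ≃ₗᵢ[ℝ] Eu n := b.repr
  set π : Eu d →L[ℝ] V := V.orthogonalProjectionOnto with hπ
  refine ⟨(R : V →L[ℝ] Eu n).comp π, V.subtypeL.comp (R.symm : Eu n →L[ℝ] V),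
    q - (π q : Eu d), ?_, ?_, ?_, ?_, ?_⟩
  · intro x
    change ‖R (π x)‖ ≤ ‖x‖
    rw [R.norm_map]
    exact V.norm_orthogonalProjectionOnto_apply_le x
  · intro p
    change ‖((R.symm p : V) : Eu d)‖ = ‖p‖
    rw [Submodule.norm_coe, R.symm.norm_map]
  · intro p
    change R (π (R.symm p : V)) = p
    rw [hπ, Submodule.orthogonalProjectionOnto_mem_subspace_eq_self, R.apply_symm_apply]
  · change R (π (q - (π q : Eu d))) = 0
    rw [map_sub, hπ, Submodule.orthogonalProjectionOnto_mem_subspace_eq_self, sub_self, map_zero]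
  · intro y
    change ‖y - (q - (π q : Eu d) + (R.symm (R (π y)) : V))‖ ≤ _
    rw [R.symm_apply_apply]
    rw [le_infDist ⟨q, hq⟩]
    intro z hz
    have e1 : y - (q - (π q : Eu d) + (π y : Eu d)) = (y - q) - (π (y - q) : Eu d) := by
      rw [map_sub, Submodule.coe_sub]; abel
    rw [e1]
    change ‖(y - q) - V.starProjection (y - q)‖ ≤ _
    rw [Submodule.starProjection_minimal]
    have hzq : z - q ∈ V := AffineSubspace.vsub_mem_direction hz hq
    have := ciInf_le (f := fun w : V => ‖y - q - w‖)
      ⟨0, by rintro _ ⟨w, rfl⟩; exact norm_nonneg _⟩ ⟨z - q, hzq⟩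
    refine this.trans (le_of_eq ?_)
    rw [dist_eq_norm]
    congr 1
    simp

end

section

theorem build {n d : ℕ} (hn : 0 < n) (E F : Set (Eu d)) (hE : MeasurableSet E) (hFE : F ⊆ E)
    (x0 : Eu d) (t lam eps : ℝ) (ht : 0 < t) (hlam : 0 ≤ lam) (heps : 0 < eps)
    (hden : ∀ ξ ∈ F, ∀ r : ℝ, 0 < r → r ≤ t →
      μH[(n : ℝ)].restrict E (closedBall ξ r) ≤ ENNReal.ofReal (lam * r ^ n))
    (v : Eu d → ℕ → ℝ) (hv0 : ∀ ξ k, 0 ≤ v ξ k)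
    (hv : ∀ ξ ∈ F, ∀ k, beta2sq n d (μH[(n : ℝ)].restrict E) ξ (t * (1 / 2) ^ k) <
      ENNReal.ofReal (v ξ k))
    (hvs : ∀ ξ ∈ F, ∀ N, ∑ k ∈ Finset.range N, v ξ k ≤ eps)
    (h3 : beta2sq n d (μH[(n : ℝ)].restrict E) x0 (t * 2) < ENNReal.ofReal (eps / 2 ^ (n + 2)))
    (h4 : ENNReal.ofReal ((t * (1 / 2) ^ 16) ^ n / 2) ≤
      μH[(n : ℝ)] (F ∩ closedBall x0 (t * (1 / 2) ^ 16))) :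
    ∃ C : Cfg n d lam eps, ∀ Z ⊆ C.F, C.m Z ≠ 0 →
      μH[(n : ℝ)] ((fun y => x0 + t • y) '' Z) ≠ 0 ∧ ((fun y => x0 + t • y) '' Z) ⊆ F := by
  classical
  set μ : Measure (Eu d) := μH[(n : ℝ)].restrict E with hμ
  set φ := zm x0 t ht.ne' with hφ
  set ψ : Eu d → Eu d := fun y => x0 + t • y with hψ
  set m : Measure (Eu d) := ENNReal.ofReal (t⁻¹ ^ n) • (μH[(n : ℝ)].restrict F).map φ with hm
  have hpre : ∀ S : Set (Eu d), φ ⁻¹' S = ψ '' S := by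
    intro S
    exact (φ.symm.image_eq_preimage_symm S).symm
  have hmS : ∀ S : Set (Eu d), m S = ENNReal.ofReal (t⁻¹ ^ n) *
      μH[(n : ℝ)].restrict F (ψ '' S) := by
    intro S
    rw [hm, Measure.smul_apply, φ.measurableEmbedding.map_apply, hpre, smul_eq_mul]
  have hψm : ∀ S : Set (Eu d), MeasurableSet S → MeasurableSet (ψ '' S) := by
    intro S hS
    rw [← hpre]
    exact φ.continuous.measurable hS
  have hmE : ∀ S : Set (Eu d), MeasurableSet S → m S ≤ ENNReal.ofReal (t⁻¹ ^ n) * μ (ψ '' S) := by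
    intro S hS
    rw [hmS]
    gcongr
    exact Measure.restrict_mono hFE le_rfl
  have hdist : ∀ x y : Eu d, dist (ψ x) (ψ y) = t * dist x y := by
    intro x y
    rw [hψ, dist_eq_norm, dist_eq_norm]
    simp only
    rw [add_sub_add_left_eq_sub, ← smul_sub, norm_smul, Real.norm_of_nonneg ht.le]
  have hball : ∀ (x : Eu d) (r : ℝ), ψ '' closedBall x r ⊆ closedBall (ψ x) (t * r) := by
    rintro x r _ ⟨y, hy, rfl⟩
    rw [mem_closedBall] at hy ⊢
    rw [hdist]; gcongr
  have htn : t⁻¹ ^ n * t ^ n = 1 := by rw [← mul_pow, inv_mul_cancel₀ ht.ne', one_pow]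
  -- planes
  have hpl : ∀ (x : Eu d) (ρ w : ℝ), 0 < ρ → beta2sq n d μ (ψ x) (t * ρ) < ENNReal.ofReal w →
      ∃ L : AffineSubspace ℝ (Eu d), Module.finrank ℝ L.direction = n ∧ ∀ s : ℝ, 0 < s →
      m {y | y ∈ closedBall x ρ ∧ s < infDist y (L : Set (Eu d))} ≤
        ENNReal.ofReal (w * ρ ^ (n + 2) / s ^ 2) := by
    intro x ρ w hρ hb
    obtain ⟨L, hL, hLs⟩ := weak_of_beta μ (ψ x) (t * ρ) w (by positivity) hb
    obtain ⟨L', hL', hd⟩ := scale_plane hn L hL x0 t ht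
    refine ⟨L', hL', fun s hs => ?_⟩
    have hAm : MeasurableSet {y | y ∈ closedBall x ρ ∧ s < infDist y (L' : Set (Eu d))} := by
      refine isClosed_closedBall.measurableSet.inter ?_
      exact measurableSet_lt measurable_const (continuous_infDist_pt _).measurable
    refine (hmE _ hAm).trans ?_
    have h1 : μ (ψ '' {y | y ∈ closedBall x ρ ∧ s < infDist y (L' : Set (Eu d))}) ≤
        ENNReal.ofReal (w * (t * ρ) ^ (n + 2) / (t * s) ^ 2) := by
      refine (measure_mono ?_).trans (hLs (t * s) (by positivity))
      rintro _ ⟨y, ⟨hy1, hy2⟩, rfl⟩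
      refine ⟨hball _ _ ⟨y, hy1, rfl⟩, ?_⟩
      have : t * s < t * infDist y (L' : Set (Eu d)) := by gcongr
      exact this.trans_le (hd y)
    refine (mul_le_mul_right h1 _).trans ?_
    rw [← ENNReal.ofReal_mul (by positivity)]
    apply ENNReal.ofReal_le_ofReal
    apply le_of_eq
    have e1 : t⁻¹ ^ n * (w * (t * ρ) ^ (n + 2) / (t * s) ^ 2) =
      (t⁻¹ ^ n * t ^ n) * (t ^ 2 / t ^ 2) * (w * ρ ^ (n + 2) / s ^ 2) := by
      rw [mul_pow, mul_pow, pow_add t]; field_simp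
    rw [e1, htn, div_self (by positivity), one_mul, one_mul]
  have hF' : ∀ x, ψ x ∈ F → ∀ k : ℕ, ∃ L : AffineSubspace ℝ (Eu d),
      Module.finrank ℝ L.direction = n ∧ ∀ s : ℝ, 0 < s →
      m {y | y ∈ closedBall x ((1 / 2 : ℝ) ^ k) ∧ s < infDist y (L : Set (Eu d))} ≤
        ENNReal.ofReal (v (ψ x) k * ((1 / 2 : ℝ) ^ k) ^ (n + 2) / s ^ 2) := fun x hx k =>
    hpl x _ _ (by positivity) (hv _ hx k)
  have hLx : ∀ (x : Eu d) (k : ℕ), ∃ L : AffineSubspace ℝ (Eu d), ψ x ∈ F →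
      (Module.finrank ℝ L.direction = n ∧ ∀ s : ℝ, 0 < s →
      m {y | y ∈ closedBall x ((1 / 2 : ℝ) ^ k) ∧ s < infDist y (L : Set (Eu d))} ≤
        ENNReal.ofReal (v (ψ x) k * ((1 / 2 : ℝ) ^ k) ^ (n + 2) / s ^ 2)) := by
    intro x k
    by_cases hx : ψ x ∈ F
    · obtain ⟨L, hL⟩ := hF' x hx k
      exact ⟨L, fun _ => hL⟩
    · exact ⟨⊥, fun h => absurd h hx⟩
  choose L hL using hLx
  have hψ0 : ψ 0 = x0 := by simp [hψ]
  obtain ⟨L0, hL0, hL0s⟩ := hpl 0 2 (eps / 2 ^ (n + 2)) two_pos (by rw [hψ0]; exact h3)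
  obtain ⟨P, io, c, hP, hio, hPi, hc, hPd⟩ := plane_maps hn L0 hL0
  refine ⟨{ m := m, F := ψ ⁻¹' F, P := P, io := io, hP := hP, hio := hio, hPi := hPi
            HF := ?_, H1 := ?_, L := L, hL := fun x hx k => (hL x k hx).1
            b := fun x k => Real.sqrt (v (ψ x) k), hb0 := fun x k => Real.sqrt_nonneg _
            hbs := ?_, H2 := ?_, c := c, hc := hc, H3 := ?_, H4 := ?_ }, ?_⟩
  · intro S hS
    rw [hmS, hmS]
    congr 1
    rw [Measure.restrict_apply (hψm S hS)]
    have hsub : ψ '' (ψ ⁻¹' F ∩ S) ⊆ F := by rintro _ ⟨y, hy, rfl⟩; exact hy.1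
    rw [Measure.restrict_eq_self _ hsub]
    congr 1
    rw [image_preimage_inter, inter_comm]
  · intro x hx r hr hr1
    refine (hmE _ isClosed_closedBall.measurableSet).trans ?_
    have h1 : μ (ψ '' closedBall x r) ≤ ENNReal.ofReal (lam * (t * r) ^ n) :=
      (measure_mono (hball x r)).trans (hden _ hx _ (by positivity) (by nlinarith))
    refine (mul_le_mul_right h1 _).trans ?_
    rw [← ENNReal.ofReal_mul (by positivity)]
    apply ENNReal.ofReal_le_ofReal
    apply le_of_eq
    calc t⁻¹ ^ n * (lam * (t * r) ^ n) = (t⁻¹ ^ n * t ^ n) * (lam * r ^ n) := by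
          rw [mul_pow]; ring
      _ = _ := by rw [htn, one_mul]
  · intro x hx N
    refine le_trans (le_of_eq ?_) (hvs _ hx N)
    exact Finset.sum_congr rfl fun k _ => Real.sq_sqrt (hv0 _ _)
  · intro x hx k s hs
    rw [Real.sq_sqrt (hv0 _ _)]
    exact (hL x k hx).2 s hs
  · intro s hs
    refine (measure_mono ?_).trans ((hL0s s hs).trans ?_)
    · rintro y ⟨hy1, hy2⟩
      exact ⟨hy1, hy2.trans_le (hPd y)⟩
    · apply ENNReal.ofReal_le_ofReal
      apply le_of_eq
      field_simp
  · rw [hmS, Measure.restrict_apply (hψm _ isClosed_closedBall.measurableSet)]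
    have e1 : ψ '' closedBall 0 ((1 / 2 : ℝ) ^ 16) = closedBall x0 (t * (1 / 2) ^ 16) := by
      apply Subset.antisymm
      · have := hball 0 ((1 / 2 : ℝ) ^ 16)
        rwa [hψ0] at this
      · intro y hy
        have hy2 : ψ (φ y) = y := φ.symm_apply_apply y
        refine ⟨φ y, ?_, hy2⟩
        rw [mem_closedBall] at hy ⊢
        rw [← hy2, ← hψ0, hdist] at hy
        exact le_of_mul_le_mul_left hy ht
    rw [e1, inter_comm]
    refine le_trans ?_ (mul_le_mul_right h4 _)
    rw [← ENNReal.ofReal_mul (by positivity)]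
    apply ENNReal.ofReal_le_ofReal
    apply le_of_eq
    calc ((1 / 2 : ℝ) ^ 16) ^ n / 2 = (t⁻¹ ^ n * t ^ n) * (((1 / 2 : ℝ) ^ 16) ^ n / 2) := by
          rw [htn, one_mul]
      _ = _ := by rw [mul_pow]; ring
  · intro Z hZ hZm
    have hsub : ψ '' Z ⊆ F := by rintro _ ⟨y, hy, rfl⟩; exact hZ hy
    refine ⟨fun h0 => hZm ?_, hsub⟩
    change m Z = 0
    rw [hmS, Measure.restrict_eq_self _ hsub, h0, mul_zero]

end

section

theorem beta_int {n d : ℕ} (μ : Measure (Eu d)) (ξ : Eu d) (ρ : ℝ) (hρ : 0 < ρ) :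
    beta2sq n d μ ξ ρ ≤ 2 ^ (n + 3) *
      ∫⁻ r in Ioo ρ (2 * ρ), beta2sq n d μ ξ r / ENNReal.ofReal r := by
  set b := beta2sq n d μ ξ ρ with hb
  have h1 : b / ENNReal.ofReal (2 * ρ) * ENNReal.ofReal ρ ≤ 2 ^ (n + 2) *
      ∫⁻ r in Ioo ρ (2 * ρ), beta2sq n d μ ξ r / ENNReal.ofReal r := by
    rw [← lintegral_const_mul' _ _ (by finiteness)]
    calc b / ENNReal.ofReal (2 * ρ) * ENNReal.ofReal ρ =
        ∫⁻ r in Ioo ρ (2 * ρ), b / ENNReal.ofReal (2 * ρ) := by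
          rw [setLIntegral_const, Real.volume_Ioo]
          congr 2; ring
      _ ≤ _ := by
          refine setLIntegral_mono' measurableSet_Ioo fun r hr => ?_
          rw [← mul_div_assoc]
          have := beta_mono n d μ ξ ρ r hρ hr.1.le hr.2.le
          refine ENNReal.div_le_div this (ENNReal.ofReal_le_ofReal hr.2.le)
  have h2 : b = 2 * (b / ENNReal.ofReal (2 * ρ) * ENNReal.ofReal ρ) := by
    have h3 : ENNReal.ofReal (2 * ρ) = 2 * ENNReal.ofReal ρ := by
      rw [ENNReal.ofReal_mul (by norm_num)]; simp
    have h4 : b / ENNReal.ofReal (2 * ρ) * ENNReal.ofReal (2 * ρ) = b :=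
      ENNReal.div_mul_cancel (ENNReal.ofReal_pos.2 (by positivity)).ne' ENNReal.ofReal_ne_top
    conv_lhs => rw [← h4]
    conv_lhs => enter [2]; rw [h3]
    ring
  rw [h2]
  refine (mul_le_mul_right h1 2).trans (le_of_eq ?_)
  rw [pow_succ 2 (n + 2)]
  ring

theorem beta_sum2 {n d : ℕ} (μ : Measure (Eu d)) (ξ : Eu d) (t R : ℝ) (ht : 0 < t)
    (hR : 2 * t ≤ R) (N : ℕ) :
    ∑ k ∈ Finset.range N, beta2sq n d μ ξ (t * (1 / 2) ^ k) ≤ 2 ^ (n + 3) *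
      ∫⁻ r in Ioo 0 R, beta2sq n d μ ξ r / ENNReal.ofReal r := by
  calc _ ≤ ∑ k ∈ Finset.range N, 2 ^ (n + 3) *
        ∫⁻ r in Ioo (t * (1 / 2) ^ k) (2 * (t * (1 / 2) ^ k)),
          beta2sq n d μ ξ r / ENNReal.ofReal r :=
        Finset.sum_le_sum fun k _ => beta_int μ ξ _ (by positivity)
    _ = 2 ^ (n + 3) * ∫⁻ r in ⋃ k ∈ Finset.range N,
          Ioo (t * (1 / 2) ^ k) (2 * (t * (1 / 2) ^ k)),
          beta2sq n d μ ξ r / ENNReal.ofReal r := by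
        rw [← Finset.mul_sum, lintegral_biUnion_finset _ (fun _ _ => measurableSet_Ioo)]
        have key : ∀ i j : ℕ, i < j → Disjoint (Ioo (t * (1 / 2) ^ i) (2 * (t * (1 / 2) ^ i)))
            (Ioo (t * (1 / 2) ^ j) (2 * (t * (1 / 2) ^ j))) := by
          intro i j hij
          rw [Set.disjoint_left]
          rintro r ⟨h1, -⟩ ⟨-, h2⟩
          have h3 : ((1 / 2 : ℝ)) ^ j ≤ (1 / 2) ^ (i + 1) :=
            pow_le_pow_of_le_one (by norm_num) (by norm_num) hij
          rw [pow_succ] at h3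
          nlinarith
        intro i _ j _ hij
        rcases lt_or_gt_of_ne hij with h | h
        · exact key i j h
        · exact (key j i h).symm
    _ ≤ _ := by
        gcongr
        intro r hr
        obtain ⟨k, -, h1, h2⟩ := mem_iUnion₂.1 hr
        have h3 : ((1 / 2 : ℝ)) ^ k ≤ 1 := pow_le_one₀ (by norm_num) (by norm_num)
        have h4 : 0 < t * (1 / 2) ^ k := by positivity
        exact ⟨h4.trans h1, by nlinarith⟩

theorem tail_small {f : ℝ → ℝ≥0∞} (hf : ∫⁻ r in Ioo (0 : ℝ) 1, f r < ⊤) (ε : ℝ≥0∞)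
    (hε : 0 < ε) : ∃ j : ℕ, ∫⁻ r in Ioo (0 : ℝ) (1 / ((j : ℝ) + 1)), f r ≤ ε := by
  have h1 : Tendsto (fun j : ℕ => (volume.restrict (Ioo (0 : ℝ) 1))
      (Ioo (0 : ℝ) (1 / ((j : ℝ) + 1)))) atTop (nhds 0) := by
    refine tendsto_of_tendsto_of_tendsto_of_le_of_le tendsto_const_nhds
      (h := fun j : ℕ => ENNReal.ofReal (1 / ((j : ℝ) + 1))) ?_ (fun _ => zero_le) ?_
    · rw [← ENNReal.ofReal_zero]
      exact ENNReal.tendsto_ofReal tendsto_one_div_add_atTop_nhds_zero_nat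
    · intro j
      refine (Measure.restrict_apply_le _ _).trans (le_of_eq ?_)
      rw [Real.volume_Ioo, sub_zero]
  have h2 := tendsto_setLIntegral_zero hf.ne h1
  obtain ⟨j, hj⟩ := (h2.eventually (ge_mem_nhds hε)).exists
  refine ⟨j, ?_⟩
  rw [Measure.restrict_restrict measurableSet_Ioo, inter_eq_left.2] at hj
  · exact hj
  · intro r hr
    refine ⟨hr.1, hr.2.trans_le ?_⟩
    rw [div_le_one (by positivity)]
    have : (0 : ℝ) ≤ j := by positivity
    linarith

end

section

theorem piece {n d : ℕ} (hn : 0 < n) (E : Set (Eu d)) (hE : MeasurableSet E)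
    (hfin : μH[(n:ℝ)] E < ⊤)
    (hβ : ∀ᵐ x ∂((μH[(n:ℝ)] : Measure (Eu d)).restrict E),
        (∫⁻ r in Set.Ioo (0 : ℝ) 1,
          beta2sq n d (μH[(n:ℝ)].restrict E) x r / ENNReal.ofReal r) < ⊤)
    (G : Set (Eu d)) (hGE : G ⊆ E) (hG : μH[(n:ℝ)] G ≠ 0) :
    ∃ Z ⊆ G, μH[(n:ℝ)] Z ≠ 0 ∧ ∃ g : Eu n → Eu d, (∃ K : ℝ≥0, LipschitzWith K g) ∧
      Z ⊆ range g := by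
  set μ : Measure (Eu d) := (μH[(n:ℝ)] : Measure (Eu d)).restrict E with hμ
  haveI : IsFiniteMeasure μ := ⟨by rw [hμ, Measure.restrict_apply_univ]; exact hfin⟩
  have hmain := fun N : ℕ => Cfg.main n d hn (N : ℝ) (by positivity)
  choose eps heps hC using hmain
  set F : ℕ → ℕ → Set (Eu d) := fun N j => {x | x ∈ G ∧
    (∀ r, 0 < r → r < 1 / ((N:ℝ) + 1) → μ (closedBall x r) ≤ (N:ℝ≥0∞) * ENNReal.ofReal (r ^ n)) ∧
    ∫⁻ r in Ioo (0 : ℝ) (1 / ((j : ℝ) + 1)), beta2sq n d μ x r / ENNReal.ofReal r ≤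
      ENNReal.ofReal (eps N / 2 ^ (2 * n + 6))} with hF
  have hex : ∃ N j, μH[(n:ℝ)] (F N j) ≠ 0 := by
    by_contra hcon
    push Not at hcon
    apply hG
    have h1 : ∀ᵐ x ∂(μH[(n:ℝ)] : Measure (Eu d)), x ∉ ⋃ N, ⋃ j, F N j := by
      refine measure_eq_zero_iff_ae_notMem.1 ?_
      exact measure_iUnion_null fun N => measure_iUnion_null fun j => hcon N j
    have h2 := density_fin_ae n d μ
    have h3 := (ae_restrict_iff' hE).1 hβ
    refine measure_eq_zero_iff_ae_notMem.2 ?_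
    filter_upwards [h1, h2, h3] with x hx1 hx2 hx3 hxG
    obtain ⟨N, hN⟩ := hx2
    obtain ⟨j, hj⟩ := tail_small (hx3 (hGE hxG)) (ENNReal.ofReal (eps N / 2 ^ (2 * n + 6)))
      (ENNReal.ofReal_pos.2 (by have := heps N; positivity))
    exact hx1 (mem_iUnion.2 ⟨N, mem_iUnion.2 ⟨j, hxG, hN, hj⟩⟩)
  obtain ⟨N, j, hNj⟩ := hex
  set e := eps N with he
  have he0 : 0 < e := heps N
  have hFG : F N j ⊆ G := fun x hx => hx.1
  have hFfin : μH[(n:ℝ)] (F N j) ≠ ⊤ := ((measure_mono (hFG.trans hGE)).trans_lt hfin).ne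
  set m : ℝ := min (1 / ((N:ℝ) + 1)) (1 / ((j:ℝ) + 1)) with hm
  have hm0 : 0 < m := lt_min (by positivity) (by positivity)
  obtain ⟨x0, hx0, r, hr0, hr1, hlow⟩ := density_low n d hn (F N j) hNj hFfin
    (m / (8 * 2 ^ 16)) (by positivity)
  set t : ℝ := 2 ^ 16 * r with ht
  have ht0 : 0 < t := by positivity
  have htr : t * (1 / 2) ^ 16 = r := by rw [ht]; ring
  have ht8 : 8 * t < m := by
    rw [lt_div_iff₀ (by positivity)] at hr1
    rw [ht]; linarith
  have htN : t < 1 / ((N:ℝ) + 1) := by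
    have : m ≤ 1 / ((N:ℝ) + 1) := min_le_left _ _
    linarith
  have htj : 8 * t < 1 / ((j:ℝ) + 1) := ht8.trans_le (min_le_right _ _)
  have hcst : (2:ℝ≥0∞) ^ (n + 3) * ENNReal.ofReal (e / 2 ^ (2 * n + 6)) =
      ENNReal.ofReal (e / 2 ^ (n + 3)) := by
    have : (2:ℝ≥0∞) ^ (n + 3) = ENNReal.ofReal (2 ^ (n + 3)) := by
      rw [ENNReal.ofReal_pow (by norm_num)]; simp
    rw [this, ← ENNReal.ofReal_mul (by positivity)]
    congr 1
    have h : (2:ℝ) ^ (2 * n + 6) = 2 ^ (n + 3) * 2 ^ (n + 3) := by rw [← pow_add]; congr 1; ring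
    rw [h]
    field_simp
  have hsum : ∀ ξ ∈ F N j, ∀ M : ℕ,
      ∑ k ∈ Finset.range M, beta2sq n d μ ξ (t * (1 / 2) ^ k) ≤ ENNReal.ofReal (e / 2 ^ (n + 3)) := by
    intro ξ hξ M
    refine (beta_sum2 μ ξ t (1 / ((j:ℝ) + 1)) ht0 (by linarith) M).trans ?_
    rw [← hcst]
    exact mul_le_mul_right hξ.2.2 _
  have hfinb : ∀ ξ ∈ F N j, ∀ k : ℕ, beta2sq n d μ ξ (t * (1 / 2) ^ k) ≠ ⊤ := by
    intro ξ hξ k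
    refine ((le_trans ?_ (hsum ξ hξ (k + 1))).trans_lt ENNReal.ofReal_lt_top).ne
    exact Finset.single_le_sum (f := fun k => beta2sq n d μ ξ (t * (1 / 2) ^ k))
      (fun _ _ => zero_le) (Finset.self_mem_range_succ k)
  have hpw : (8:ℝ) ≤ 2 ^ (n + 3) := by
    have : (1:ℝ) ≤ 2 ^ n := one_le_pow₀ (by norm_num)
    rw [pow_add]; linarith
  obtain ⟨C, hCZ⟩ := build hn E (F N j) hE (hFG.trans hGE) x0 t N e ht0 (by positivity) he0
    (by
      intro ξ hξ ρ hρ hρt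
      refine (hξ.2.1 ρ hρ (hρt.trans_lt htN)).trans (le_of_eq ?_)
      rw [ENNReal.ofReal_mul (by positivity), ENNReal.ofReal_natCast])
    (fun ξ k => (beta2sq n d μ ξ (t * (1 / 2) ^ k)).toReal + e / 4 * (1 / 2) ^ k)
    (by intro ξ k; positivity)
    (by
      intro ξ hξ k
      rw [ENNReal.lt_ofReal_iff_toReal_lt (hfinb ξ hξ k)]
      have : 0 < e / 4 * (1 / 2) ^ k := by positivity
      linarith)
    (by
      intro ξ hξ M
      rw [Finset.sum_add_distrib, ← ENNReal.toReal_sum (fun k _ => hfinb ξ hξ k), ← Finset.mul_sum]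
      have h1 : (∑ k ∈ Finset.range M, beta2sq n d μ ξ (t * (1 / 2) ^ k)).toReal ≤
          e / 2 ^ (n + 3) := by
        refine ENNReal.toReal_le_of_le_ofReal (by positivity) (hsum ξ hξ M)
      have h2 : ∑ k ∈ Finset.range M, ((1:ℝ) / 2) ^ k ≤ 2 := by
        rw [geom_sum_eq (by norm_num)]
        have : (0:ℝ) < (1 / 2) ^ M := by positivity
        rw [div_le_iff_of_neg (by norm_num)]
        linarith
      have h3 : e / 2 ^ (n + 3) ≤ e / 8 := by gcongr
      nlinarith)
    (by
      refine (beta_int μ x0 (t * 2) (by positivity)).trans_lt ?_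
      have h1 : ∫⁻ r in Ioo (t * 2) (2 * (t * 2)), beta2sq n d μ x0 r / ENNReal.ofReal r ≤
          ENNReal.ofReal (e / 2 ^ (2 * n + 6)) := by
        refine (lintegral_mono_set ?_).trans hx0.2.2
        intro ρ hρ
        exact ⟨lt_trans (by positivity) hρ.1, hρ.2.trans (by linarith)⟩
      refine (mul_le_mul_right h1 _).trans_lt ?_
      rw [hcst]
      refine (ENNReal.ofReal_lt_ofReal_iff (by positivity)).2 ?_
      refine div_lt_div_of_pos_left he0 (by positivity) ?_
      exact pow_lt_pow_right₀ (by norm_num) (by omega))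
    (by rw [htr]; exact hlow)
  obtain ⟨Z, hZF, hZ0, g, ⟨K, hK⟩, hZg⟩ := hC N C
  obtain ⟨h1, h2⟩ := hCZ Z hZF hZ0
  refine ⟨_, h2.trans hFG, h1, fun u => x0 + t • g u, ?_, ?_⟩
  · refine ⟨‖t‖₊ * K, ?_⟩
    refine LipschitzWith.of_dist_le_mul fun u v => ?_
    rw [dist_add_left, dist_smul₀]
    have := hK.dist_le_mul u v
    push_cast
    rw [mul_assoc]
    gcongr
  · rintro _ ⟨y, hy, rfl⟩
    obtain ⟨u, rfl⟩ := hZg hy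
    exact ⟨u, rfl⟩

end

theorem meas_range {n d : ℕ} (g : Eu n → Eu d) (K : ℝ≥0) (hK : LipschitzWith K g) :
    MeasurableSet (range g) := by
  have : range g = ⋃ R : ℕ, g '' closedBall 0 R := by
    rw [← image_iUnion, iUnion_closedBall_nat, image_univ]
  rw [this]
  exact MeasurableSet.iUnion fun R =>
    ((isCompact_closedBall (0 : Eu n) R).image hK.continuous).isClosed.measurableSet

theorem dir2 {n d : ℕ} (hn : 0 < n) (E : Set (Eu d)) (hE : MeasurableSet E)
    (hfin : μH[(n:ℝ)] E < ⊤)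
    (hβ : ∀ᵐ x ∂((μH[(n:ℝ)] : Measure (Eu d)).restrict E),
        (∫⁻ r in Set.Ioo (0 : ℝ) 1,
          beta2sq n d (μH[(n:ℝ)].restrict E) x r / ENNReal.ofReal r) < ⊤) :
    ∃ f : ℕ → Eu n → Eu d, (∀ i, ∃ K : ℝ≥0, LipschitzWith K (f i)) ∧
      μH[(n:ℝ)] (E \ ⋃ i, range (f i)) = 0 := by
  set μ : Measure (Eu d) := (μH[(n:ℝ)] : Measure (Eu d)).restrict E with hμ
  haveI : IsFiniteMeasure μ := ⟨by rw [hμ, Measure.restrict_apply_univ]; exact hfin⟩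
  let S := {f : ℕ → Eu n → Eu d // ∀ i, ∃ K : ℝ≥0, LipschitzWith K (f i)}
  haveI : Nonempty S := ⟨⟨fun _ _ => 0, fun _ => ⟨0, LipschitzWith.const _⟩⟩⟩
  let U : S → Set (Eu d) := fun f => ⋃ i, range (f.1 i)
  have hUm : ∀ f : S, MeasurableSet (U f) := fun f => MeasurableSet.iUnion fun i => by
    obtain ⟨K, hK⟩ := f.2 i
    exact meas_range _ K hK
  obtain ⟨u, -, hu, huS⟩ := exists_seq_tendsto_sSup (S := range fun f : S => μ (U f))
    (range_nonempty _) (OrderTop.bddAbove _)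
  choose fs hfs using huS
  -- combine the maximising sequence
  let F : ℕ → Eu n → Eu d := fun i => (fs (Nat.unpair i).1).1 (Nat.unpair i).2
  have hFl : ∀ i, ∃ K : ℝ≥0, LipschitzWith K (F i) := fun i => (fs _).2 _
  have hsub : ∀ k, U (fs k) ⊆ U ⟨F, hFl⟩ := by
    intro k x hx
    obtain ⟨i, hi⟩ := mem_iUnion.1 hx
    refine mem_iUnion.2 ⟨Nat.pair k i, ?_⟩
    simpa [F] using hi
  have hmax : ∀ f : S, μ (U f) ≤ μ (U ⟨F, hFl⟩) := by
    intro f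
    refine (le_sSup (mem_range_self f)).trans (le_of_tendsto' hu fun k => ?_)
    rw [← hfs k]
    exact measure_mono (hsub k)
  refine ⟨F, hFl, ?_⟩
  by_contra h0
  obtain ⟨Z, hZ, hZ0, g, ⟨K, hK⟩, hZg⟩ := piece hn E hE hfin hβ _ sdiff_subset h0
  let F2 : ℕ → Eu n → Eu d := fun i => Nat.casesOn i g F
  have hF2l : ∀ i, ∃ K : ℝ≥0, LipschitzWith K (F2 i) := by
    intro i
    cases i with
    | zero => exact ⟨K, hK⟩
    | succ i => exact hFl i
  have hm := hmax ⟨F2, hF2l⟩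
  have hsub2 : U ⟨F, hFl⟩ ∪ Z ⊆ U ⟨F2, hF2l⟩ := by
    rintro x (hx | hx)
    · obtain ⟨i, hi⟩ := mem_iUnion.1 hx
      exact mem_iUnion.2 ⟨i + 1, hi⟩
    · exact mem_iUnion.2 ⟨0, hZg hx⟩
  have hd : Disjoint (U ⟨F, hFl⟩) Z := by
    rw [Set.disjoint_right]
    intro x hx
    exact (hZ hx).2
  have h1 : μ (U ⟨F, hFl⟩) + μ Z ≤ μ (U ⟨F, hFl⟩) + 0 := by
    rw [← measure_union' hd (hUm _), add_zero]
    exact (measure_mono hsub2).trans hm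
  have h2 := (ENNReal.add_le_add_iff_left (measure_ne_top μ _)).1 h1
  apply hZ0
  rw [← Measure.restrict_eq_self _ (hZ.trans sdiff_subset)]
  exact le_antisymm h2 zero_le

theorem stmt1 (n d : ℕ) (E : Set (EuclideanSpace ℝ (Fin d)))
    (hE : MeasurableSet E) (hfin : μH[(n : ℝ)] E < ⊤) :
    (∃ f : ℕ → EuclideanSpace ℝ (Fin n) → EuclideanSpace ℝ (Fin d),
        (∀ i, ∃ K : NNReal, LipschitzWith K (f i)) ∧
        μH[(n : ℝ)] (E \ ⋃ i, Set.range (f i)) = 0) ↔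
      (∀ᵐ x ∂(μH[(n : ℝ)].restrict E),
        (∫⁻ r in Set.Ioo (0 : ℝ) 1,
          beta2sq n d (μH[(n : ℝ)].restrict E) x r / ENNReal.ofReal r) < ⊤) := by
  rcases lt_or_ge d n with hdn | hnd
  · have h0 : (μH[(n : ℝ)] : Measure (EuclideanSpace ℝ (Fin d))) = 0 := by
      apply Real.hausdorffMeasure_of_finrank_lt
      simpa using hdn
    constructor
    · intro _
      rw [h0]; simp
    · intro _
      refine ⟨fun _ _ => 0, fun _ => ⟨0, LipschitzWith.const _⟩, ?_⟩
      rw [h0]; simp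
  · constructor
    · rintro ⟨f, hf, h0⟩
      exact dir1 hnd E hE hfin f hf h0
    · intro h
      rcases Nat.eq_zero_or_pos n with hn | hn
      · subst hn
        have hf : E.Finite := by
          rw [Nat.cast_zero] at hfin
          by_contra hinf
          obtain ⟨N, hN⟩ := ENNReal.exists_nat_gt hfin.ne
          obtain ⟨T, hTE, hTc⟩ := Set.Infinite.exists_subset_card_eq hinf N
          have h1 : (μH[(0:ℝ)] : Measure (EuclideanSpace ℝ (Fin d))) (T : Set _) = N := by
            rw [← sum_measure_singleton]
            simp [Measure.hausdorffMeasure_zero_singleton, hTc]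
          have h2 := measure_mono (μ := (μH[(0:ℝ)] : Measure (EuclideanSpace ℝ (Fin d)))) hTE
          rw [h1] at h2
          exact absurd h2 (not_le.2 hN)
        rcases E.eq_empty_or_nonempty with rfl | hne
        · exact ⟨fun _ _ => 0, fun _ => ⟨0, LipschitzWith.const _⟩, by simp⟩
        · obtain ⟨g, hg⟩ := hf.countable.exists_eq_range hne
          refine ⟨fun i _ => g i, fun _ => ⟨0, LipschitzWith.const _⟩, ?_⟩
          have : E \ ⋃ i, Set.range (fun _ : EuclideanSpace ℝ (Fin 0) => g i) = ∅ := by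
            rw [Set.sdiff_eq_empty, hg]
            rintro _ ⟨i, rfl⟩
            exact mem_iUnion.2 ⟨i, 0, rfl⟩
          rw [this, measure_empty]
      · exact dir2 hn E hE hfin h
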